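/- The inequality N2(0,4,m) > N2(2,4,m) holds for every non-negative integer m with m ≡ 1 (mod 8), for every m with m ≡ 2 (mod 8), for every m with m ≡ 7 (mod 8), and for every m ≥ 68 with m ≡ 4 (mod 8). -/

import Mathlib

open scoped Classical

/-- The M2-rank of a partition: ⌈ℓ/2⌉ − s, where ℓ is the largest part
(0 for the empty partition) and s is the number of parts. -/
def m2Rank {n : ℕ} (P : n.Partition) : ℤ :=
  (((P.parts.sup + 1) / 2 : ℕ) : ℤ) - (Multiset.card P.parts : ℤ)

/-- A partition has no repeated odd parts. -/
def NoRepeatedOddParts {n : ℕ} (P : n.Partition) : Prop :=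
  ∀ j : ℕ, Odd j → P.parts.count j ≤ 1

/-- `N2 r m n` is the number of partitions of `n` without repeated odd parts whose
M2-rank is congruent to `r` modulo `m`. -/
noncomputable def N2 (r : ℤ) (m n : ℕ) : ℕ :=
  Nat.card {P : n.Partition // NoRepeatedOddParts P ∧ m2Rank P ≡ r [ZMOD (m : ℤ)]}

namespace M2
open PowerSeries Complex
open scoped PowerSeries.WithPiTopology

/-- weight used for bounded partitions -/
noncomputable def wt (k : ℕ) (i c : ℕ) : ℂ :=
  if 2 * k < i then 0 else if Odd i ∧ 1 < c then 0 else (-I) ^ c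

noncomputable def GG (k : ℕ) : ℂ⟦X⟧ := Nat.Partition.genFun (wt k)

noncomputable def fac (i : ℕ) : ℂ⟦X⟧ :=
  1 + ∑' j : ℕ, (if Odd (i+1) ∧ 1 < j+1 then (0:ℂ) else (-I)^(j+1)) • X ^ ((i + 1) * (j + 1))

lemma GG_eq (k : ℕ) : GG k = ∏ i ∈ Finset.range (2*k), fac i := by
  have h := Nat.Partition.hasProd_genFun (wt k)
  have h2 := hasProd_prod_of_ne_finset_one (s := Finset.range (2*k))
    (f := fun i ↦ (1 : ℂ⟦X⟧) + ∑' j, wt k (i + 1) (j + 1) • X ^ ((i + 1) * (j + 1))) (L := .unconditional ℕ) (by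
      intro b hb
      have : 2 * k < b + 1 := by simp at hb; omega
      simp [wt, this])
  rw [GG, h.unique h2]
  apply Finset.prod_congr rfl
  intro i hi
  have : ¬ 2 * k < i + 1 := by simp at hi; omega
  simp [wt, fac, this]

lemma fac_odd (k : ℕ) : fac (2*k) = 1 - C I * X^(2*k+1) := by
  rw [fac, tsum_eq_single 0]
  · simp [smul_eq_C_mul, sub_eq_add_neg]
  · intro j hj
    have : Odd (2*k+1) := ⟨k, by ring⟩
    have h2 : 1 < j + 1 := by omega
    simp only [this, h2, and_self, if_true, zero_smul]

lemma fac_even (k : ℕ) : (1 + C I * X^(2*k+2)) * fac (2*k+1) = 1 := by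
  have hne : ¬ Odd (2*k+1+1) := by rw [Nat.not_odd_iff_even]; exact ⟨k+1, by ring⟩
  have h1 : fac (2*k+1) = ∑' j : ℕ, (-(C I * X^(2*k+2) : ℂ⟦X⟧))^j := by
    have hs : Summable (fun j : ℕ => (-(C I * X^(2*k+2) : ℂ⟦X⟧))^j) := by
      apply PowerSeries.WithPiTopology.summable_pow_of_constantCoeff_eq_zero
      simp
    rw [hs.tsum_eq_zero_add, fac]
    simp only [hne, false_and, if_false, pow_zero]
    congr 1
    apply tsum_congr
    intro j
    rw [smul_eq_C_mul, ← neg_mul, mul_pow, ← pow_mul, ← map_neg, map_pow]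
  rw [h1]
  have := PowerSeries.WithPiTopology.tsum_pow_mul_one_sub_of_constantCoeff_eq_zero
    (f := (-(C I * X^(2*k+2) : ℂ⟦X⟧))) (by simp)
  rw [sub_neg_eq_add] at this
  rw [mul_comm]; exact this

lemma GG_zero : GG 0 = 1 := by simp [GG_eq]

lemma GG_succ (k : ℕ) : (1 + C I * X^(2*k+2)) * GG (k+1) = (1 - C I * X^(2*k+1)) * GG k := by
  have := fac_even k
  rw [GG_eq, GG_eq, show 2*(k+1) = 2*k+1+1 by ring, Finset.prod_range_succ, Finset.prod_range_succ, fac_odd]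
  linear_combination (∏ i ∈ Finset.range (2*k), fac i) * (1 - C I * X^(2*k+1)) * this

lemma prod_wt {n : ℕ} (k : ℕ) (P : n.Partition) : P.parts.toFinsupp.prod (wt k) =
    if NoRepeatedOddParts P ∧ P.parts.sup ≤ 2*k then (-I)^(Multiset.card P.parts) else 0 := by
  simp_rw [Finsupp.prod, Multiset.toFinsupp_support, Multiset.toFinsupp_apply]
  split_ifs with h
  · rw [← Multiset.toFinset_sum_count_eq, ← Finset.prod_pow_eq_pow_sum]
    apply Finset.prod_congr rfl
    intro i hi
    rw [Multiset.mem_toFinset] at hi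
    have h1 : i ≤ 2*k := (Multiset.le_sup hi).trans h.2
    have h2 : ¬ (Odd i ∧ 1 < P.parts.count i) := by
      rintro ⟨ho, hc⟩
      have := h.1 i ho
      omega
    simp [wt, not_lt.mpr h1, h2]
  · rw [Finset.prod_eq_zero_iff]
    by_cases h1 : NoRepeatedOddParts P
    · have h2 : ¬ P.parts.sup ≤ 2*k := fun h2 => h ⟨h1, h2⟩
      rw [Multiset.sup_le] at h2
      push Not at h2
      obtain ⟨b, hb, hb2⟩ := h2
      exact ⟨b, by simpa using hb, by simp [wt, hb2]⟩
    · unfold NoRepeatedOddParts at h1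
      push Not at h1
      obtain ⟨j, hj, hc⟩ := h1
      have : j ∈ P.parts := Multiset.count_pos.mp (by omega)
      refine ⟨j, by simpa using this, ?_⟩
      simp only [wt, hj, hc, and_self, if_true, ite_self]

noncomputable def cc (k n : ℕ) : ℂ := coeff n (GG k)

lemma cc_eq (k n : ℕ) : cc k n = ∑ P : n.Partition,
    if NoRepeatedOddParts P ∧ P.parts.sup ≤ 2*k then (-I)^(Multiset.card P.parts) else 0 := by
  rw [cc, GG, Nat.Partition.coeff_genFun]
  exact Finset.sum_congr rfl fun P _ => prod_wt k P

lemma card_part (n : ℕ) : Fintype.card n.Partition ≤ 2^n := by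
  refine (Fintype.card_le_of_surjective _ (Nat.Partition.ofComposition_surj (n := n))).trans ?_
  rw [composition_card]
  exact Nat.pow_le_pow_right (by norm_num) (by omega)

lemma sum_part_bound (n : ℕ) (f : n.Partition → ℂ) (hf : ∀ P, ‖f P‖ ≤ 1) : ‖∑ P, f P‖ ≤ 2^n := by
  refine (norm_sum_le _ _).trans ?_
  refine (Finset.sum_le_sum fun P _ => hf P).trans ?_
  simp
  exact_mod_cast card_part n

lemma cc_bound (k n : ℕ) : ‖cc k n‖ ≤ 2^n := by
  rw [cc_eq]
  apply sum_part_bound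
  intro P
  split_ifs <;> simp

lemma sup_le {n : ℕ} (P : n.Partition) : P.parts.sup ≤ n := by
  rw [Multiset.sup_le]
  intro b hb
  have := Multiset.single_le_sum (s := P.parts) (fun x _ => Nat.zero_le x) b hb
  rwa [P.parts_sum] at this

/-- the main coefficient sequence -/
noncomputable def uu (n : ℕ) : ℂ := ∑ P : n.Partition, if NoRepeatedOddParts P then I ^ (m2Rank P) else 0

lemma uu_bound (n : ℕ) : ‖uu n‖ ≤ 2^n := by
  rw [uu]
  apply sum_part_bound
  intro P
  split_ifs <;> simp

lemma I_zpow_re (r : ℤ) : (I^r).re = (if r ≡ 0 [ZMOD 4] then 1 else 0) - (if r ≡ 2 [ZMOD 4] then 1 else 0) := by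
  have hI : I ≠ 0 := I_ne_zero
  obtain ⟨k, hk⟩ : ∃ k, r = 4 * k + r % 4 := ⟨r/4, by omega⟩
  have h4 : (I:ℂ)^(4:ℤ) = 1 := by
    have : (I:ℂ)^(4:ℤ) = I^(4:ℕ) := by norm_cast
    rw [this, I_pow_four]
  have hr : I^r = I^(r % 4) := by
    conv_lhs => rw [hk]
    rw [zpow_add₀ hI, zpow_mul, h4, one_zpow, one_mul]
  rw [hr]
  simp only [Int.ModEq]
  rcases (show r % 4 = 0 ∨ r % 4 = 1 ∨ r % 4 = 2 ∨ r % 4 = 3 by omega) with h | h | h | h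
  · simp [h]
  · simp [h]
  · have : (I:ℂ)^(2:ℤ) = -1 := by rw [← I_sq]; norm_cast
    simp [h, this]
  · have : (I:ℂ)^(3:ℤ) = -I := by rw [← I_pow_three]; norm_cast
    simp [h, this]

lemma N2_card (r : ℤ) (n : ℕ) : (N2 r 4 n : ℝ) = ∑ P : n.Partition, if NoRepeatedOddParts P ∧ m2Rank P ≡ r [ZMOD 4] then 1 else 0 := by
  rw [N2, Nat.card_eq_fintype_card, Fintype.card_subtype, Finset.sum_boole]
  rfl

lemma uu_re (n : ℕ) : (uu n).re = (N2 0 4 n : ℝ) - N2 2 4 n := by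
  rw [N2_card, N2_card, uu, re_sum, ← Finset.sum_sub_distrib]
  apply Finset.sum_congr rfl
  intro P _
  by_cases h : NoRepeatedOddParts P
  · simp [h, I_zpow_re]
  · simp [h]

/-- increments -/
noncomputable def dd (k n : ℕ) : ℂ := cc (k+1) n - cc k n

lemma dd_bound (k n : ℕ) : ‖dd k n‖ ≤ 2 * 2^n := by
  rw [dd]
  refine (norm_sub_le _ _).trans ?_
  have := cc_bound (k+1) n
  have := cc_bound k n
  linarith

lemma dd_eq (k n : ℕ) : dd k n = ∑ P : n.Partition,
    if NoRepeatedOddParts P ∧ (P.parts.sup + 1)/2 = k+1 then (-I)^(Multiset.card P.parts) else 0 := by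
  rw [dd, cc_eq, cc_eq, ← Finset.sum_sub_distrib]
  apply Finset.sum_congr rfl
  intro P _
  by_cases h : NoRepeatedOddParts P
  · simp only [h, true_and]
    by_cases h1 : P.parts.sup ≤ 2*k
    · rw [if_pos (by omega), if_pos h1, if_neg (by omega), sub_self]
    · by_cases h2 : P.parts.sup ≤ 2*(k+1)
      · rw [if_pos h2, if_neg h1, if_pos (by omega), sub_zero]
      · rw [if_neg h2, if_neg h1, if_neg (by omega), sub_zero]
  · simp [h]

lemma dd_zero (k n : ℕ) (h : n ≤ k) : dd k n = 0 := by
  rw [dd_eq]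
  apply Finset.sum_eq_zero
  intro P _
  rw [if_neg]
  rintro ⟨_, h2⟩
  have := sup_le P
  omega

lemma uu_eq (n : ℕ) : uu n = cc 0 n + ∑ k ∈ Finset.range n, I^(k+1) * dd k n := by
  simp_rw [dd_eq, cc_eq, uu, Finset.mul_sum]
  rw [Finset.sum_comm, ← Finset.sum_add_distrib]
  apply Finset.sum_congr rfl
  intro P _
  by_cases h : NoRepeatedOddParts P
  · simp only [h, true_and, if_true]
    have hs := sup_le P
    have hr : I^(m2Rank P) = I^((P.parts.sup+1)/2) * (-I)^(Multiset.card P.parts) := by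
      rw [m2Rank, zpow_sub₀ I_ne_zero, zpow_natCast, zpow_natCast, div_eq_mul_inv, ← inv_pow, inv_I]
    rw [hr]
    by_cases h0 : P.parts.sup = 0
    · rw [h0, Finset.sum_eq_zero]
      · simp
      · intro k _
        rw [if_neg (by omega), mul_zero]
    · rw [if_neg (by omega), Finset.sum_eq_single ((P.parts.sup+1)/2 - 1)]
      · rw [if_pos (by omega), zero_add, show (P.parts.sup + 1) / 2 - 1 + 1 = (P.parts.sup + 1) / 2 by omega]
      · intro k _ hk
        rw [if_neg (by omega), mul_zero]
      · intro hk
        simp at hk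
        omega
  · simp [h]

end M2

namespace M2
open PowerSeries Complex

/-- evaluation of a formal power series -/
noncomputable def ev (f : ℂ⟦X⟧) (q : ℂ) : ℂ := ∑' n, coeff n f * q^n

def EvS (f : ℂ⟦X⟧) (q : ℂ) : Prop := Summable (fun n => ‖coeff n f * q^n‖)

lemma ev_mul {f g : ℂ⟦X⟧} {q : ℂ} (hf : EvS f q) (hg : EvS g q) : ev (f*g) q = ev f q * ev g q := by
  unfold ev
  rw [tsum_mul_tsum_eq_tsum_sum_antidiagonal_of_summable_norm hf hg]
  apply tsum_congr
  intro n
  rw [coeff_mul, Finset.sum_mul]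
  apply Finset.sum_congr rfl
  intro x hx
  rw [Finset.HasAntidiagonal.mem_antidiagonal] at hx
  rw [← hx, pow_add]; ring

lemma EvS_mul {f g : ℂ⟦X⟧} {q : ℂ} (hf : EvS f q) (hg : EvS g q) : EvS (f*g) q := by
  unfold EvS
  have := summable_norm_sum_mul_antidiagonal_of_summable_norm hf hg
  refine this.congr (fun n => ?_)
  rw [coeff_mul, Finset.sum_mul]
  congr 1
  apply Finset.sum_congr rfl
  intro x hx
  rw [Finset.HasAntidiagonal.mem_antidiagonal] at hx
  rw [← hx, pow_add]; ring

lemma EvS_add {f g : ℂ⟦X⟧} {q : ℂ} (hf : EvS f q) (hg : EvS g q) : EvS (f+g) q := by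
  unfold EvS at *
  refine Summable.of_nonneg_of_le (fun _ => norm_nonneg _) (fun n => ?_) (hf.add hg)
  rw [map_add, add_mul]; exact norm_add_le _ _

lemma ev_add {f g : ℂ⟦X⟧} {q : ℂ} (hf : EvS f q) (hg : EvS g q) : ev (f+g) q = ev f q + ev g q := by
  unfold ev
  rw [← Summable.tsum_add (Summable.of_norm hf) (Summable.of_norm hg)]
  simp_rw [map_add, add_mul]

lemma coeff_mono (a : ℂ) (m n : ℕ) : coeff n (C a * X^m : ℂ⟦X⟧) = if n = m then a else 0 := by
  rw [coeff_C_mul, coeff_X_pow]; split_ifs <;> simp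

lemma EvS_mono (a : ℂ) (m : ℕ) (q : ℂ) : EvS (C a * X^m) q := by
  apply summable_of_ne_finset_zero (s := {m})
  intro n hn
  simp at hn
  rw [coeff_mono, if_neg hn]; simp

lemma ev_mono (a : ℂ) (m : ℕ) (q : ℂ) : ev (C a * X^m) q = a * q^m := by
  rw [ev, tsum_eq_single m]
  · rw [coeff_mono, if_pos rfl]
  · intro n hn; rw [coeff_mono, if_neg hn, zero_mul]

lemma EvS_one (q : ℂ) : EvS 1 q := by simpa using EvS_mono 1 0 q
lemma ev_one (q : ℂ) : ev 1 q = 1 := by simpa using ev_mono 1 0 q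

lemma summ_of_bound {c : ℕ → ℂ} {q : ℂ} (K : ℝ) (hc : ∀ n, ‖c n‖ ≤ K * 2^n) (hq : ‖q‖ ≤ 1/8) :
    Summable (fun n => ‖c n * q^n‖) := by
  have : Summable (fun n : ℕ => K * (1/4:ℝ)^n) := (summable_geometric_of_lt_one (by norm_num) (by norm_num)).mul_left K
  refine Summable.of_nonneg_of_le (fun _ => norm_nonneg _) (fun n => ?_) this
  rw [norm_mul, norm_pow]
  calc _ ≤ (K * 2^n) * (1/8)^n := by
        gcongr
        · exact (norm_nonneg _).trans (hc n)
        · exact hc n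
    _ = _ := by rw [mul_assoc, ← mul_pow]; norm_num

lemma EvS_GG (k : ℕ) {q : ℂ} (hq : ‖q‖ ≤ 1/8) : EvS (GG k) q :=
  summ_of_bound 1 (fun n => by rw [one_mul]; exact cc_bound k n) hq

noncomputable def gk (k : ℕ) (q : ℂ) : ℂ := ∏ j ∈ Finset.range k, (1 - I * q^(2*j+1)) / (1 + I*q^(2*j+2))

lemma qpow_le {q : ℂ} (hq : ‖q‖ ≤ 1/8) (m : ℕ) : ‖q^m‖ ≤ 1 := by
  rw [norm_pow]; exact pow_le_one₀ (norm_nonneg _) (by linarith)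

lemma qpow_le' {q : ℂ} (hq : ‖q‖ ≤ 1/8) (m : ℕ) : ‖q^(m+1)‖ ≤ 1/8 := by
  rw [pow_succ, norm_mul]
  have := qpow_le hq m
  nlinarith [norm_nonneg q, norm_nonneg (q^m)]

lemma one_add_ne {x : ℂ} (h : ‖x‖ ≤ 1/8) : 1 + x ≠ 0 := by
  intro h0
  have : x = -1 := by linear_combination h0
  rw [this] at h; norm_num at h

lemma I_mul_norm (x : ℂ) : ‖I * x‖ = ‖x‖ := by simp

lemma ev_GG (k : ℕ) {q : ℂ} (hq : ‖q‖ ≤ 1/8) : ev (GG k) q = gk k q := by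
  induction k with
  | zero => simp [GG_zero, ev_one, gk]
  | succ k ih =>
    have h := congrArg (fun f => ev f q) (GG_succ k)
    have e1 : (1 - C I * X^(2*k+1) : ℂ⟦X⟧) = 1 + C (-I) * X^(2*k+1) := by simp [sub_eq_add_neg]
    rw [e1, ev_mul (EvS_add (EvS_one q) (EvS_mono _ _ _)) (EvS_GG _ hq),
      ev_mul (EvS_add (EvS_one q) (EvS_mono _ _ _)) (EvS_GG _ hq),
      ev_add (EvS_one q) (EvS_mono _ _ _), ev_add (EvS_one q) (EvS_mono _ _ _), ev_mono, ev_mono, ev_one, ih] at h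
    have hne : 1 + I * q^(2*k+2) ≠ 0 := one_add_ne (by rw [I_mul_norm]; exact qpow_le' hq _)
    rw [gk, Finset.prod_range_succ, ← gk]
    field_simp
    linear_combination h

lemma summable_dd {q : ℂ} (hq : ‖q‖ ≤ 1/8) :
    Summable (Function.uncurry fun k n : ℕ => I^(k+1) * dd k n * q^n) := by
  have hg : Summable (fun n : ℕ => (1/2:ℝ)^n) := summable_geometric_of_lt_one (by norm_num) (by norm_num)
  have h := (hg.mul_of_nonneg hg (fun _ => by positivity) (fun _ => by positivity)).mul_left 2
  refine Summable.of_norm_bounded h ?_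
  rintro ⟨k, n⟩
  simp only [Function.uncurry, norm_mul, norm_pow, norm_I, one_pow, one_mul]
  rcases le_or_gt n k with hk | hk
  · rw [dd_zero k n hk]; simp
  · calc _ ≤ (2 * 2^n) * (1/8:ℝ)^n := by
          have h8 : ‖q‖^n ≤ (1/8:ℝ)^n := pow_le_pow_left₀ (norm_nonneg _) hq n
          exact mul_le_mul (dd_bound k n) h8 (by positivity) (by positivity)
      _ = 2 * ((1/2:ℝ)^n * (1/2)^n) := by rw [mul_assoc, ← mul_pow, ← mul_pow]; norm_num
      _ ≤ 2 * ((1/2:ℝ)^k * (1/2)^n) := by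
          have := pow_le_pow_of_le_one (a := (1/2:ℝ)) (by norm_num) (by norm_num) hk.le
          gcongr

noncomputable def UU (q : ℂ) : ℂ := ∑' n, uu n * q^n

lemma UU_eq1 {q : ℂ} (hq : ‖q‖ ≤ 1/8) : UU q = 1 + ∑' k : ℕ, I^(k+1) * (gk (k+1) q - gk k q) := by
  have hs := summable_dd hq
  have h1 : ∀ n, uu n * q^n = cc 0 n * q^n + ∑' k, I^(k+1) * dd k n * q^n := by
    intro n
    rw [tsum_eq_sum (s := Finset.range n), uu_eq, add_mul, Finset.sum_mul]
    intro k hk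
    rw [dd_zero k n (by simpa using hk)]; simp
  rw [UU, tsum_congr h1, Summable.tsum_add (f := fun n => cc 0 n * q^n) (Summable.of_norm (EvS_GG 0 hq)), Summable.tsum_comm (f := fun k n => I^(k+1) * dd k n * q^n)]
  · congr 1
    · have := ev_one q; rw [← GG_zero] at this; exact this
    · apply tsum_congr
      intro k
      rw [← ev_GG _ hq, ← ev_GG _ hq, ev, ev, ← Summable.tsum_sub (Summable.of_norm (EvS_GG _ hq)) (Summable.of_norm (EvS_GG _ hq)), ← tsum_mul_left]
      apply tsum_congr
      intro n
      rw [dd, cc, cc]; ring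
  · exact hs
  · exact ((Equiv.prodComm ℕ ℕ).summable_iff.mpr hs).prod

noncomputable def Ak (k : ℕ) (q : ℂ) : ℂ := ∏ j ∈ Finset.range k, (1 - I * q^(2*j+1))
noncomputable def Bk (n k : ℕ) (q : ℂ) : ℂ := ∏ j ∈ Finset.range k, (1 + I * q^(2*n+2+2*j))
noncomputable def TT (n : ℕ) (q : ℂ) : ℂ := ∑' k : ℕ, (I*q^(2*n))^k * Ak k q / Bk n k q

lemma Bk_ne {q : ℂ} (hq : ‖q‖ ≤ 1/8) (n k : ℕ) : Bk n k q ≠ 0 := by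
  rw [Bk, Finset.prod_ne_zero_iff]
  intro j _
  apply one_add_ne
  rw [I_mul_norm, show 2*n+2+2*j = (2*n+1+2*j)+1 by ring]; exact qpow_le' hq _

lemma Ak_norm {q : ℂ} (hq : ‖q‖ ≤ 1/8) (k : ℕ) : ‖Ak k q‖ ≤ 2^k := by
  rw [Ak, norm_prod]
  have : (2:ℝ)^k = ∏ j ∈ Finset.range k, (2:ℝ) := by simp
  rw [this]
  apply Finset.prod_le_prod (fun _ _ => norm_nonneg _)
  intro j _
  refine (norm_sub_le _ _).trans ?_
  rw [I_mul_norm]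
  have := qpow_le hq (2*j+1)
  rw [norm_one]; linarith

lemma Bk_norm {q : ℂ} (hq : ‖q‖ ≤ 1/8) (n k : ℕ) : ‖(Bk n k q)⁻¹‖ ≤ 2^k := by
  rw [Bk, ← Finset.prod_inv_distrib, norm_prod]
  have : (2:ℝ)^k = ∏ j ∈ Finset.range k, (2:ℝ) := by simp
  rw [this]
  apply Finset.prod_le_prod (fun _ _ => norm_nonneg _)
  intro j _
  rw [norm_inv]
  have h1 : (1/2:ℝ) ≤ ‖1 + I * q^(2*n+2+2*j)‖ := by
    have h2 := norm_sub_le (1 + I * q^(2*n+2+2*j)) (I * q^(2*n+2+2*j))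
    rw [add_sub_cancel_right, norm_one, I_mul_norm, show 2*n+2+2*j = (2*n+1+2*j)+1 by ring] at h2
    have := qpow_le' hq (2*n+1+2*j)
    rw [show 2*n+2+2*j = (2*n+1+2*j)+1 by ring]
    linarith
  calc _ ≤ (1/2:ℝ)⁻¹ := inv_anti₀ (by norm_num) h1
    _ = 2 := by norm_num

lemma TT_term_bound {q : ℂ} (hq : ‖q‖ ≤ 1/8) (n k : ℕ) :
    ‖(I*q^(2*(n+1)))^k * Ak k q / Bk (n+1) k q‖ ≤ (1/2)^k := by
  rw [div_eq_mul_inv, norm_mul, norm_mul, norm_pow, I_mul_norm]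
  have h1 : ‖q^(2*(n+1))‖ ≤ 1/8 := by rw [show 2*(n+1) = (2*n+1)+1 by ring]; exact qpow_le' hq _
  calc _ ≤ (1/8:ℝ)^k * 2^k * 2^k := by
        gcongr
        · exact Ak_norm hq k
        · exact Bk_norm hq _ k
    _ = _ := by rw [← mul_pow, ← mul_pow]; norm_num

lemma TT_summable {q : ℂ} (hq : ‖q‖ ≤ 1/8) (n : ℕ) :
    Summable fun k : ℕ => (I*q^(2*(n+1)))^k * Ak k q / Bk (n+1) k q :=
  Summable.of_norm_bounded (summable_geometric_of_lt_one (by norm_num) (by norm_num)) (TT_term_bound hq n)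

lemma TT_norm {q : ℂ} (hq : ‖q‖ ≤ 1/8) (n : ℕ) : ‖TT (n+1) q‖ ≤ 2 := by
  have := tsum_of_norm_bounded (hasSum_geometric_of_lt_one (r := (1/2:ℝ)) (by norm_num) (by norm_num)) (TT_term_bound hq n)
  rw [TT]; norm_num at this ⊢; exact this

lemma Bk_succ' (n k : ℕ) (q : ℂ) : Bk n (k+1) q = (1 + I * q^(2*n+2)) * Bk (n+1) k q := by
  rw [Bk, Finset.prod_range_succ', mul_comm, Bk]
  congr 1
  apply Finset.prod_congr rfl
  intro j _
  congr 3; ring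

lemma TT_rec {q : ℂ} (hq : ‖q‖ ≤ 1/8) (n : ℕ) (hn : 1 ≤ n) :
    (1 - I*q^(2*n)) * TT n q = 1 + q^(2*n+1) * (1 + q^(2*n+1)) / (1 + I*q^(2*n+2)) * TT (n+1) q := by
  obtain ⟨n, rfl⟩ : ∃ m, n = m+1 := ⟨n-1, by omega⟩
  have hs := TT_summable hq n
  have hs2 := TT_summable hq (n+1)
  generalize hN : n+1 = N at *
  rw [sub_mul, one_mul]
  conv_lhs => rw [TT]
  conv_rhs => rw [TT]
  rw [← tsum_mul_left, ← tsum_mul_left]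
  rw [hs.tsum_eq_zero_add, add_sub_assoc, ← Summable.tsum_sub ((summable_nat_add_iff 1).mpr hs) (hs.mul_left _)]
  congr 1
  · simp [Ak, Bk]
  · apply tsum_congr
    intro k
    have hB : Bk N (k+1) q = Bk N k q * (1 + I * q^(2*N+2+2*k)) := by rw [Bk, Finset.prod_range_succ, ← Bk]
    have hA : Ak (k+1) q = Ak k q * (1 - I * q^(2*k+1)) := by rw [Ak, Finset.prod_range_succ, ← Ak]
    have hB' := Bk_succ' N k q
    have n1 := Bk_ne hq N (k+1)
    have n2 := Bk_ne hq N k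
    have n3 := Bk_ne hq (N+1) k
    have n4 : 1 + I * q^(2*N+2) ≠ 0 := by
      intro h; rw [h, zero_mul] at hB'; exact n1 hB'
    have e1 : q^(2*N+1) * (1 + q^(2*N+1)) / (1 + I * q^(2*N+2)) * ((I * q^(2*(N+1)))^k * Ak k q / Bk (N+1) k q)
       = q^(2*N+1) * (1 + q^(2*N+1)) * (I * q^(2*(N+1)))^k * Ak k q / Bk N (k+1) q := by
      rw [hB']; field_simp
    have n5 : 1 + I * q^(2*N+2+2*k) ≠ 0 := by
      intro h; rw [h, mul_zero] at hB; exact n1 hB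
    rw [e1, hA, hB]
    field_simp
    ring_nf
    simp only [I_sq]
    ring

lemma UU_eq2 {q : ℂ} (hq : ‖q‖ ≤ 1/8) : UU q = 1 + q * (1+q)/(1 + I*q^2) * TT 1 q := by
  rw [UU_eq1 hq, TT, ← tsum_mul_left]
  congr 1
  apply tsum_congr
  intro k
  have h1 : ∀ k, gk k q = Ak k q / Bk 0 k q := by
    intro k
    rw [gk, Finset.prod_div_distrib, Ak, Bk]
    congr 1
    apply Finset.prod_congr rfl
    intro j _
    congr 3; ring
  have hB : Bk 0 (k+1) q = Bk 0 k q * (1 + I * q^(2*k+2)) := by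
    rw [Bk, Finset.prod_range_succ, ← Bk]; ring_nf
  have hA : Ak (k+1) q = Ak k q * (1 - I * q^(2*k+1)) := by rw [Ak, Finset.prod_range_succ, ← Ak]
  have hB' := Bk_succ' 0 k q
  have n1 := Bk_ne hq 0 (k+1)
  have n2 := Bk_ne hq 0 k
  have n3 := Bk_ne hq 1 k
  have n4 : 1 + I * q^2 ≠ 0 := one_add_ne (by rw [I_mul_norm]; exact qpow_le' hq _)
  have n5 : 1 + I * q^(2*k+2) ≠ 0 := one_add_ne (by rw [I_mul_norm]; exact qpow_le' hq _)
  simp only [mul_zero, zero_add] at hB'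
  have e1 : q * (1+q) / (1 + I * q^2) * ((I * q^(2*1))^k * Ak k q / Bk 1 k q)
       = q * (1+q) * (I * q^(2*1))^k * Ak k q / Bk 0 (k+1) q := by
      rw [hB']; field_simp
  rw [e1, h1, h1, hA, hB]
  field_simp
  ring_nf
  simp only [I_sq]
  ring

noncomputable def ww (n : ℕ) (q : ℂ) : ℂ :=
  q^(n^2) * (∏ j ∈ Finset.range n, (1 + q^(2*j+1))) / ∏ j ∈ Finset.range n, (1 + q^(4*j+4))

lemma ww_succ (n : ℕ) (q : ℂ) : ww (n+1) q = ww n q * (q^(2*n+1) * (1 + q^(2*n+1)) / (1 + q^(4*n+4))) := by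
  rw [ww, ww, Finset.prod_range_succ, Finset.prod_range_succ, mul_div_assoc, mul_div_mul_comm, show (n+1)^2 = n^2 + (2*n+1) by ring, pow_add]
  ring

lemma ww_norm {q : ℂ} (hq : ‖q‖ ≤ 1/8) (n : ℕ) : ‖ww n q‖ ≤ (1/2)^n := by
  induction n with
  | zero => simp [ww]
  | succ n ih =>
    rw [ww_succ, norm_mul, pow_succ (1/2:ℝ)]
    refine mul_le_mul ih ?_ (norm_nonneg _) (by positivity)
    rw [norm_div, norm_mul]
    have h1 := qpow_le' hq (2*n)
    have h2 := qpow_le' hq (4*n+3)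
    have h3 : ‖1 + q^(2*n+1)‖ ≤ 2 := (norm_add_le _ _).trans (by rw [norm_one]; linarith)
    have h4 : 7/8 ≤ ‖1 + q^(4*n+4)‖ := by
      have := norm_sub_le (1 + q^(4*n+4)) (q^(4*n+4))
      rw [add_sub_cancel_right, norm_one] at this
      linarith
    rw [div_le_iff₀ (by linarith)]
    nlinarith [norm_nonneg (q^(2*n+1)), norm_nonneg (1 + q^(2*n+1))]

lemma UU_partial {q : ℂ} (hq : ‖q‖ ≤ 1/8) (N : ℕ) :
    UU q = ∑ n ∈ Finset.range (N+1), ww n q + ww (N+1) q * ((1 - I*q^(2*(N+1))) * TT (N+1) q) := by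
  induction N with
  | zero =>
    rw [UU_eq2 hq]
    simp [ww]
    have n4 : 1 + I * q^2 ≠ 0 := one_add_ne (by rw [I_mul_norm]; exact qpow_le' hq _)
    have n5 : 1 + q^4 ≠ 0 := one_add_ne (qpow_le' hq _)
    have : (1 + q^4) = (1 + I*q^2) * (1 - I*q^2) := by ring_nf; simp
    have n6 : 1 - I*q^2 ≠ 0 := by intro h; rw [this, h, mul_zero] at n5; exact n5 rfl
    rw [this]
    generalize I * q^2 = y at *
    field_simp
  | succ N ih =>
    rw [ih, Finset.sum_range_succ _ (N+1), add_assoc]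
    congr 1
    rw [TT_rec hq (N+1) (by omega), ww_succ (N+1)]
    have n4 : 1 + I * q^(2*(N+1)+2) ≠ 0 := one_add_ne (by rw [I_mul_norm]; exact qpow_le' hq _)
    have n5 : 1 + q^(4*(N+1)+4) ≠ 0 := one_add_ne (qpow_le' hq _)
    have : (1 + q^(4*(N+1)+4)) = (1 + I*q^(2*(N+1)+2)) * (1 - I*q^(2*(N+1)+2)) := by ring_nf; simp
    have n6 : 1 - I*q^(2*(N+1)+2) ≠ 0 := by intro h; rw [this, h, mul_zero] at n5; exact n5 rfl
    rw [this, show 2 * (N+1+1) = 2*(N+1)+2 by ring]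
    generalize I * q^(2*(N+1)+2) = y at *
    field_simp

lemma UU_eq3 {q : ℂ} (hq : ‖q‖ ≤ 1/8) : HasSum (fun n => ww n q) (UU q) := by
  have hs : Summable (fun n => ww n q) :=
    Summable.of_norm_bounded (summable_geometric_of_lt_one (by norm_num) (by norm_num)) (ww_norm hq)
  have h1 := (hs.hasSum.tendsto_sum_nat).comp (Filter.tendsto_add_atTop_nat 1)
  have h2 : Filter.Tendsto (fun N => ww (N+1) q * ((1 - I*q^(2*(N+1))) * TT (N+1) q)) Filter.atTop (nhds 0) := by
    have hz : Filter.Tendsto (fun N : ℕ => (1/2:ℝ)^(N+1) * 4) Filter.atTop (nhds 0) := by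
      have := ((tendsto_pow_atTop_nhds_zero_of_lt_one (r := (1/2:ℝ)) (by norm_num) (by norm_num)).comp (Filter.tendsto_add_atTop_nat 1)).mul_const 4
      simpa using this
    refine squeeze_zero_norm (fun N => ?_) hz
    rw [norm_mul, norm_mul]
    have a1 := ww_norm hq (N+1)
    have a2 := TT_norm hq N
    have a3 : ‖1 - I*q^(2*(N+1))‖ ≤ 2 := by
      refine (norm_sub_le _ _).trans ?_
      rw [I_mul_norm, norm_one]
      have := qpow_le hq (2*(N+1)); linarith
    gcongr
    nlinarith [norm_nonneg (TT (N+1) q), norm_nonneg (1 - I*q^(2*(N+1)))]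
  have h3 := h1.add h2
  have h4 : (fun N : ℕ => UU q) = fun N => ((fun n => ∑ i ∈ Finset.range n, ww i q) ∘ fun a => a + 1) N + ww (N+1) q * ((1 - I*q^(2*(N+1))) * TT (N+1) q) := by
    funext N; exact UU_partial hq N
  rw [← h4, add_zero] at h3
  have := tendsto_nhds_unique h3 tendsto_const_nhds
  rw [← this]
  exact hs.hasSum

end M2

namespace M2
open Complex

noncomputable def invq (q : ℂ) (k : ℤ) : ℂ :=
  if k < 0 then 0 else ∏ j ∈ Finset.range k.toNat, (1 - q^(2*j+2))⁻¹

lemma one_sub_ne {x : ℂ} (h : ‖x‖ ≤ 1/8) : 1 - x ≠ 0 := by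
  intro h0
  have : x = 1 := by linear_combination -h0
  rw [this] at h; norm_num at h

lemma invq_neg (q : ℂ) {k : ℤ} (h : k < 0) : invq q k = 0 := by simp [invq, h]

lemma invq_zero (q : ℂ) : invq q 0 = 1 := by simp [invq]

lemma invq_rec {q : ℂ} (hq : ‖q‖ ≤ 1/8) (k : ℤ) : invq q (k-1) = (1 - q^(2*k)) * invq q k := by
  rcases lt_trichotomy k 0 with h | h | h
  · rw [invq_neg _ h, invq_neg _ (by omega), mul_zero]
  · subst h; rw [invq_neg _ (by omega)]; simp
  · obtain ⟨n, rfl⟩ : ∃ n : ℕ, k = n + 1 := ⟨(k-1).toNat, by omega⟩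
    have h1 : ((n:ℤ)+1-1) = (n:ℤ) := by ring
    have h2 : q^(2*((n:ℤ)+1)) = q^(2*n+2) := by
      rw [show 2*((n:ℤ)+1) = ((2*n+2 : ℕ) : ℤ) by push_cast; ring, zpow_natCast]
    rw [h1, h2, invq, invq, if_neg (by omega), if_neg (by omega)]
    have h3 : ((n:ℤ)+1).toNat = n + 1 := by omega
    rw [h3, Int.toNat_natCast, Finset.prod_range_succ]
    have := one_sub_ne (qpow_le' hq (2*n+1))
    field_simp

lemma invq_norm {q : ℂ} (hq : ‖q‖ ≤ 1/8) (k : ℤ) : ‖invq q k‖ ≤ 2^k.toNat := by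
  rw [invq]
  split_ifs with h
  · simp
  · rw [norm_prod]
    have : (2:ℝ)^k.toNat = ∏ j ∈ Finset.range k.toNat, (2:ℝ) := by simp
    rw [this]
    apply Finset.prod_le_prod (fun _ _ => norm_nonneg _)
    intro j _
    rw [norm_inv]
    have h1 : (1/2:ℝ) ≤ ‖1 - q^(2*j+2)‖ := by
      have h2 := norm_add_le (1 - q^(2*j+2)) (q^(2*j+2))
      rw [sub_add_cancel, norm_one] at h2
      have := qpow_le' hq (2*j+1)
      rw [show 2*j+1+1 = 2*j+2 by ring] at this
      linarith
    calc _ ≤ (1/2:ℝ)⁻¹ := inv_anti₀ (by norm_num) h1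
      _ = 2 := by norm_num

noncomputable def DD (q : ℂ) (n : ℕ) (m : ℤ) : ℂ := invq q (n - m) * invq q (n + m)

lemma DD_zero (q : ℂ) {n : ℕ} {m : ℤ} (h : n < m.natAbs) : DD q n m = 0 := by
  rw [DD]
  rcases lt_or_ge m 0 with h1 | h1
  · rw [invq_neg q (k := n + m) (by omega), mul_zero]
  · rw [invq_neg q (k := n - m) (by omega), zero_mul]

lemma DD_neg (q : ℂ) (n : ℕ) (m : ℤ) : DD q n (-m) = DD q n m := by
  rw [DD, DD, sub_neg_eq_add, ← sub_eq_add_neg, mul_comm]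

lemma DD_norm {q : ℂ} (hq : ‖q‖ ≤ 1/8) (n : ℕ) (m : ℤ) : ‖DD q n m‖ ≤ 4^n := by
  rcases lt_or_ge n m.natAbs with h | h
  · rw [DD_zero q h]; simp
  · rw [DD, norm_mul]
    calc _ ≤ (2:ℝ)^((n:ℤ)-m).toNat * 2^((n:ℤ)+m).toNat := by
          gcongr <;> exact invq_norm hq _
      _ = _ := by
          rw [← pow_add, show ((n:ℤ)-m).toNat + ((n:ℤ)+m).toNat = 2 * n by omega, pow_mul]; norm_num

lemma summable_D (q : ℂ) (n : ℕ) (b : ℤ → ℂ) : Summable (fun m : ℤ => b m * DD q n m) := by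
  apply summable_of_ne_finset_zero (s := Finset.Icc (-n:ℤ) n)
  intro m hm
  rw [DD_zero, mul_zero]
  simp at hm; omega

lemma neg_one_zpow_add_one (m : ℤ) : (-1:ℂ)^(m+1) = -(-1)^m := by
  rw [zpow_add₀ (by norm_num)]; simp

lemma neg_one_zpow_neg (m : ℤ) : (-1:ℂ)^(-m) = (-1)^m := by
  rw [zpow_neg, ← inv_zpow]; norm_num

lemma unit_pair {q : ℂ} (hq : ‖q‖ ≤ 1/8) (h0 : q ≠ 0) (n : ℕ) :
    ∑' m : ℤ, (-1)^m * q^(m^2-m) * DD q n m = if n = 0 then 1 else 0 := by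
  split_ifs with hn
  · subst hn
    rw [tsum_eq_single 0]
    · simp [DD, invq_zero]
    · intro m hm
      rw [DD_zero, mul_zero]; omega
  · set e : ℤ → ℂ := fun m => (-1)^m * q^(m^2-m) * (invq q (n-m) * invq q (n+m-1)) with he
    have hes : Summable e := by
      apply summable_of_ne_finset_zero (s := Finset.Icc (-n:ℤ) n)
      intro m hm
      simp at hm
      rcases lt_or_ge m (-n) with h | h
      · simp [he, invq_neg q (k := n+m-1) (by omega)]
      · simp [he, invq_neg q (k := n-m) (by omega)]
    have key : ∀ m : ℤ, e m - e (m+1) = (1 - q^(2*(n:ℤ))) * ((-1)^m * q^(m^2-m) * DD q n m + (-1)^m * q^(m^2+m) * DD q n m) := by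
      intro m
      simp only [he, DD]
      have r1 := invq_rec hq ((n:ℤ)-m)
      have r2 := invq_rec hq ((n:ℤ)+m)
      rw [show (n:ℤ) - (m+1) = n - m - 1 by ring, show (n:ℤ)+(m+1)-1 = n+m by ring, r1, r2, neg_one_zpow_add_one]
      have z1 : q^((m+1)^2-(m+1)) = q^(m^2-m) * q^(2*m) := by rw [← zpow_add₀ h0]; ring_nf
      have z2 : q^(m^2+m) = q^(m^2-m) * q^(2*m) := by rw [← zpow_add₀ h0]; ring_nf
      have z3 : q^(2*((n:ℤ)+m)) = q^(2*(n:ℤ)) * q^(2*m) := by rw [← zpow_add₀ h0]; ring_nf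
      have z4 : q^(2*((n:ℤ)-m)) * q^(2*m) = q^(2*(n:ℤ)) := by rw [← zpow_add₀ h0]; ring_nf
      rw [z1, z2, z3]
      linear_combination (-(-1)^m * q^(m^2-m) * invq q (n-m) * invq q (n+m)) * z4
    have hes1 : Summable (fun m => e (m+1)) := (Equiv.addRight (1:ℤ)).summable_iff.mpr hes
    have htel : ∑' m, (e m - e (m+1)) = 0 := by
      rw [Summable.tsum_sub hes hes1, sub_eq_zero]
      exact ((Equiv.addRight (1:ℤ)).tsum_eq e).symm
    simp_rw [key] at htel
    rw [tsum_mul_left, mul_eq_zero] at htel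
    have hne : 1 - q^(2*(n:ℤ)) ≠ 0 := by
      have : q^(2*(n:ℤ)) = q^((2*n-1)+1) := by
        rw [show 2*(n:ℤ) = ((2*n-1+1 : ℕ) : ℤ) by omega, zpow_natCast]
      rw [this]; exact one_sub_ne (qpow_le' hq _)
    have h2 := htel.resolve_left hne
    rw [Summable.tsum_add (summable_D q n _) (summable_D q n _)] at h2
    have h3 : ∑' m : ℤ, (-1)^m * q^(m^2+m) * DD q n m = ∑' m : ℤ, (-1)^m * q^(m^2-m) * DD q n m := by
      rw [← (Equiv.neg ℤ).tsum_eq]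
      apply tsum_congr
      intro m
      simp only [Equiv.neg_apply]
      rw [DD_neg, neg_one_zpow_neg]
      ring_nf
    rw [h3] at h2
    linear_combination h2 / 2

lemma one_add_zpow_ne {q : ℂ} (_h0 : q ≠ 0) (h1 : ‖q‖ < 1) (m : ℤ) : 1 + q^m ≠ 0 := by
  intro h
  have h2 : q^m = -1 := by linear_combination h
  have h3 : ‖q‖^m = 1 := by rw [← norm_zpow, h2]; simp
  rcases eq_or_ne m 0 with rfl | hm
  · norm_num at h2
  · rw [zpow_eq_one_iff_right₀ (norm_nonneg _) h1.ne] at h3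
    exact hm h3

noncomputable def alp (q : ℂ) (m : ℤ) : ℂ := 2 * (-1)^m * q^(m^2+m) / (1 + q^(4*m))

lemma alp_pair {q : ℂ} (hq : ‖q‖ ≤ 1/8) (h0 : q ≠ 0) (n : ℕ) :
    ∑' m : ℤ, alp q m * DD q n m = (∏ j ∈ Finset.range n, (1 + q^(4*j+4)))⁻¹ := by
  induction n with
  | zero =>
    rw [tsum_eq_single 0]
    · simp [DD, invq_zero, alp]; norm_num
    · intro m hm
      rw [DD_zero, mul_zero]; omega
  | succ n ih =>
    have key : ∀ m : ℤ, (1 + q^(4*n+4)) * (alp q m * DD q (n+1) m) - alp q m * DD q n m =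
        2 * q^(2*n+2) * ((-1)^m * q^(m^2-m) * DD q (n+1) m) := by
      intro m
      have r1 := invq_rec hq ((n:ℤ)+1-m)
      have r2 := invq_rec hq ((n:ℤ)+1+m)
      simp only [DD, alp]
      push_cast
      rw [show (n:ℤ) - m = n + 1 - m - 1 by ring, show (n:ℤ) + m = n+1+m-1 by ring, r1, r2]
      have hne := one_add_zpow_ne h0 (by linarith) (4*m)
      have a1 : q^(4*n+4) = q^(4*(n:ℤ)+4) := by norm_cast
      have a2 : q^(2*n+2) = q^(2*(n:ℤ)+2) := by norm_cast
      have z1 : q^(4*(n:ℤ)+4) = q^(2*(n:ℤ)+2) * q^(2*(n:ℤ)+2) := by rw [← zpow_add₀ h0]; ring_nf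
      have z2 : q^(2*((n:ℤ)+1-m)) * q^(2*m) = q^(2*(n:ℤ)+2) := by rw [← zpow_add₀ h0]; ring_nf
      have z3 : q^(2*((n:ℤ)+1+m)) = q^(2*(n:ℤ)+2) * q^(2*m) := by rw [← zpow_add₀ h0]; ring_nf
      have z4 : q^(4*m) = q^(2*m) * q^(2*m) := by rw [← zpow_add₀ h0]; ring_nf
      have z5 : q^(m^2+m) = q^(m^2-m) * q^(2*m) := by rw [← zpow_add₀ h0]; ring_nf
      rw [a1, a2, z1, z3, z5]
      rw [z4] at hne ⊢
      rw [← z2]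
      generalize q^(2*m) = Y at *
      generalize q^(2*((n:ℤ)+1-m)) = Z at *
      generalize q^(m^2-m) = W at *
      have hne' : 1 + Y^2 ≠ 0 := by rw [sq]; exact hne
      field_simp
      ring
    have h2 : ∑' m : ℤ, ((1 + q^(4*n+4)) * (alp q m * DD q (n+1) m) - alp q m * DD q n m) = 0 := by
      simp_rw [key]
      rw [tsum_mul_left, unit_pair hq h0, if_neg (by omega), mul_zero]
    rw [Summable.tsum_sub ((summable_D q _ _).mul_left _) (summable_D q _ _), tsum_mul_left, ih] at h2
    have hne : 1 + q^(4*n+4) ≠ 0 := one_add_ne (qpow_le' hq _)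
    rw [Finset.prod_range_succ, mul_inv, eq_mul_inv_iff_mul_eq₀ hne]
    linear_combination h2

noncomputable def wn (q : ℂ) (n : ℕ) : ℂ := q^(n^2) * ∏ j ∈ Finset.range n, (1 + q^(2*j+1))

lemma wn_norm {q : ℂ} (hq : ‖q‖ ≤ 1/128) (n : ℕ) : ‖wn q n‖ ≤ (1/64)^n := by
  have hq8 : ‖q‖ ≤ 1/8 := by linarith
  rw [wn, norm_mul, norm_prod]
  have h1 : ‖q^(n^2)‖ ≤ (1/128)^n := by
    rw [norm_pow]
    calc ‖q‖^(n^2) ≤ ‖q‖^n := pow_le_pow_of_le_one (norm_nonneg _) (by linarith) (by nlinarith)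
      _ ≤ _ := by gcongr
  have h2 : ∏ j ∈ Finset.range n, ‖1 + q^(2*j+1)‖ ≤ 2^n := by
    have : (2:ℝ)^n = ∏ j ∈ Finset.range n, (2:ℝ) := by simp
    rw [this]
    apply Finset.prod_le_prod (fun _ _ => norm_nonneg _)
    intro j _
    refine (norm_add_le _ _).trans ?_
    have := qpow_le hq8 (2*j+1)
    rw [norm_one]; linarith
  calc _ ≤ (1/128:ℝ)^n * 2^n := by
        refine mul_le_mul h1 h2 (Finset.prod_nonneg fun _ _ => norm_nonneg _) (by positivity)
    _ = _ := by rw [← mul_pow]; norm_num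

lemma wn_succ (q : ℂ) (n : ℕ) : wn q (n+1) = wn q n * (q^(2*n+1) * (1 + q^(2*n+1))) := by
  rw [wn, wn, Finset.prod_range_succ, show (n+1)^2 = n^2 + (2*n+1) by ring, pow_add]
  ring

lemma summable_natAbs {r : ℝ} (h0 : 0 ≤ r) (h1 : r < 1) : Summable (fun m : ℤ => r^m.natAbs) := by
  apply Summable.of_nat_of_neg
  · simpa using summable_geometric_of_lt_one h0 h1
  · simpa using summable_geometric_of_lt_one h0 h1

lemma summable_wD {q : ℂ} (hq : ‖q‖ ≤ 1/128) (b : ℤ → ℂ) (K : ℝ) (hb : ∀ m, ‖b m‖ ≤ K) :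
    Summable (Function.uncurry fun (n : ℕ) (m : ℤ) => wn q n * (b m * DD q n m)) := by
  have hq8 : ‖q‖ ≤ 1/8 := by linarith
  have hg : Summable (fun n : ℕ => (1/4:ℝ)^n) := summable_geometric_of_lt_one (by norm_num) (by norm_num)
  have hg2 : Summable (fun m : ℤ => (1/4:ℝ)^m.natAbs) := summable_natAbs (by norm_num) (by norm_num)
  have h := (hg.mul_of_nonneg hg2 (fun _ => by positivity) (fun _ => by positivity)).mul_left K
  refine Summable.of_norm_bounded h ?_
  have hK : 0 ≤ K := (norm_nonneg _).trans (hb 0)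
  rintro ⟨n, m⟩
  simp only [Function.uncurry, norm_mul]
  rcases lt_or_ge n m.natAbs with hk | hk
  · rw [DD_zero q hk]; simp; positivity
  · calc _ ≤ (1/64:ℝ)^n * (K * 4^n) := by
          have := wn_norm hq n
          have := hb m
          have := DD_norm hq8 n m
          gcongr
      _ = K * ((1/4:ℝ)^n * (1/4)^n) := by
          have : (1/64:ℝ)^n * 4^n = (1/4:ℝ)^n * (1/4)^n := by rw [← mul_pow, ← mul_pow]; norm_num
          linear_combination K * this
      _ ≤ _ := by
          have := pow_le_pow_of_le_one (a := (1/4:ℝ)) (by norm_num) (by norm_num) hk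
          gcongr

noncomputable def SS (q : ℂ) (m : ℤ) : ℂ := ∑' n : ℕ, wn q n * DD q n m

lemma SS_summable {q : ℂ} (hq : ‖q‖ ≤ 1/128) (m : ℤ) : Summable (fun n : ℕ => wn q n * DD q n m) := by
  have hq8 : ‖q‖ ≤ 1/8 := by linarith
  refine Summable.of_norm_bounded (g := fun n : ℕ => (1/4:ℝ)^n) (summable_geometric_of_lt_one (by norm_num) (by norm_num)) ?_
  intro n
  rw [norm_mul]
  calc _ ≤ (1/64:ℝ)^n * 4^n := by
          have := wn_norm hq n
          have := DD_norm hq8 n m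
          gcongr
    _ ≤ (1/4:ℝ)^n := by rw [← mul_pow]; gcongr; norm_num

lemma SS_succ {q : ℂ} (hq : ‖q‖ ≤ 1/128) (h0 : q ≠ 0) (m : ℤ) : SS q (m+1) = q^(2*m+1) * SS q m := by
  have hq8 : ‖q‖ ≤ 1/8 := by linarith
  set G : ℕ → ℂ := fun n => -(1 - q^(2*m+1)) * (wn q n * (invq q (n-m-1) * invq q (n+m))) with hG
  have key : ∀ n : ℕ, wn q n * DD q n (m+1) - q^(2*m+1) * (wn q n * DD q n m) = G (n+1) - G n := by
    intro n
    simp only [hG, DD, wn_succ]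
    push_cast
    have r1 := invq_rec hq8 ((n:ℤ)-m)
    have r2 := invq_rec hq8 ((n:ℤ)+m+1)
    rw [show (n:ℤ)-(m+1) = n-m-1 by ring, show (n:ℤ)+1-m-1 = n-m by ring, show (n:ℤ)+(m+1) = n+m+1 by ring,
      show (n:ℤ)+1+m = n+m+1 by ring, r1, show (n:ℤ)+m = n+m+1-1 by ring, r2]
    have a2 : q^(2*n+1) = q^(2*(n:ℤ)+1) := by norm_cast
    have z0 : q^(2*(n:ℤ)+1) = q^(2*(n:ℤ)) * q := by rw [zpow_add₀ h0, zpow_one]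
    have z2 : q^(2*((n:ℤ)-m)) * q^(2*m) = q^(2*(n:ℤ)) := by rw [← zpow_add₀ h0]; ring_nf
    have z3 : q^(2*((n:ℤ)+m+1)) = q^(2*(n:ℤ)) * q^(2*m) * q^2 := by
      rw [← zpow_natCast, ← zpow_add₀ h0, ← zpow_add₀ h0]; push_cast; ring_nf
    have z4 : q^(2*m+1) = q^(2*m) * q := by rw [zpow_add₀ h0, zpow_one]
    rw [show (n:ℤ)+m+1-1+1 = n+m+1 by ring, a2, z0, z3, z4, ← z2]
    ring
  have hS1 := SS_summable hq (m+1)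
  have hS2 := (SS_summable hq m).mul_left (q^(2*m+1))
  have hG0 : G 0 = 0 := by
    simp only [hG]
    rcases lt_or_ge m 0 with h | h
    · rw [invq_neg q (k := ((0:ℕ):ℤ)+m) (by simpa using h)]; simp
    · rw [invq_neg q (k := ((0:ℕ):ℤ)-m-1) (by push_cast; omega)]; simp
  have hGl : Filter.Tendsto G Filter.atTop (nhds 0) := by
    have hz : Filter.Tendsto (fun n : ℕ => ‖-(1 - q^(2*m+1))‖ * (1/16:ℝ)^n) Filter.atTop (nhds 0) := by
      have := (tendsto_pow_atTop_nhds_zero_of_lt_one (r := (1/16:ℝ)) (by norm_num) (by norm_num)).const_mul ‖-(1 - q^(2*m+1))‖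
      simpa using this
    refine squeeze_zero_norm (fun n => ?_) hz
    simp only [hG]
    rw [norm_mul, norm_mul, norm_mul]
    gcongr
    have b1 := wn_norm hq n
    have b2 : ‖invq q (n-m-1)‖ * ‖invq q (n+m)‖ ≤ 4^n := by
      rcases lt_or_ge ((n:ℤ)-m-1) 0 with h | h
      · rw [invq_neg q h]; simp
      rcases lt_or_ge ((n:ℤ)+m) 0 with h' | h'
      · rw [invq_neg q h']; simp
      calc _ ≤ (2:ℝ)^((n:ℤ)-m-1).toNat * 2^((n:ℤ)+m).toNat := by
            gcongr <;> exact invq_norm hq8 _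
        _ = 2^(2*n-1) := by rw [← pow_add]; congr 1; omega
        _ ≤ 2^(2*n) := pow_le_pow_right₀ (by norm_num) (by omega)
        _ = _ := by rw [pow_mul]; norm_num
    calc _ ≤ (1/64:ℝ)^n * 4^n := by gcongr
      _ = _ := by rw [← mul_pow]; norm_num
  have h1 : HasSum (fun n => G (n+1) - G n) (SS q (m+1) - q^(2*m+1) * SS q m) := by
    simp_rw [← key]
    have := hS1.hasSum.sub hS2.hasSum
    rwa [tsum_mul_left] at this
  have h2 := h1.tendsto_sum_nat
  simp_rw [Finset.sum_range_sub, hG0, sub_zero] at h2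
  have := tendsto_nhds_unique h2 hGl
  linear_combination this

lemma SS_eq {q : ℂ} (hq : ‖q‖ ≤ 1/128) (h0 : q ≠ 0) (m : ℤ) : SS q m = q^(m^2) * SS q 0 := by
  induction m using Int.induction_on with
  | zero => simp
  | succ i ih => 
    rw [SS_succ hq h0, ih, ← mul_assoc, ← zpow_add₀ h0]; ring_nf
  | pred i ih =>
    have := SS_succ hq h0 (-i-1)
    rw [show -(i:ℤ)-1+1 = -i by ring, ih] at this
    have hne : q^(2*(-(i:ℤ)-1)+1) ≠ 0 := zpow_ne_zero _ h0
    apply mul_left_cancel₀ hne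
    rw [← this, ← mul_assoc, ← zpow_add₀ h0]; ring_nf

lemma zpow_norm_le {q : ℂ} (hq : ‖q‖ ≤ 1) {k : ℤ} (hk : 0 ≤ k) : ‖q^k‖ ≤ 1 := by
  obtain ⟨n, rfl⟩ := Int.eq_ofNat_of_zero_le hk
  rw [zpow_natCast, norm_pow]; exact pow_le_one₀ (norm_nonneg _) hq

lemma sum_wbD {q : ℂ} (hq : ‖q‖ ≤ 1/128) (h0 : q ≠ 0) (b : ℤ → ℂ) (K : ℝ) (hb : ∀ m, ‖b m‖ ≤ K) :
    ∑' n : ℕ, wn q n * ∑' m, b m * DD q n m = SS q 0 * ∑' m : ℤ, b m * q^(m^2) := by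
  simp_rw [← tsum_mul_left]
  rw [Summable.tsum_comm (f := fun (m:ℤ) (n:ℕ) => wn q n * (b m * DD q n m))]
  · apply tsum_congr
    intro m
    have : SS q 0 * (b m * q^(m^2)) = b m * SS q m := by rw [SS_eq hq h0 m]; ring
    rw [this, SS, ← tsum_mul_left]
    apply tsum_congr
    intro n; ring
  · exact (Equiv.prodComm ℤ ℕ).summable_iff.mpr (summable_wD hq b K hb)

noncomputable def psim (q : ℂ) : ℂ := ∑' m : ℤ, (-1)^m * q^(2*m^2-m)

lemma neg_one_zpow_norm (m : ℤ) : ‖(-1:ℂ)^m‖ = 1 := by rw [norm_zpow]; simp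

lemma S0_eq {q : ℂ} (hq : ‖q‖ ≤ 1/128) (h0 : q ≠ 0) : SS q 0 * psim q = 1 := by
  have hq8 : ‖q‖ ≤ 1/8 := by linarith
  have := sum_wbD hq h0 (fun m => (-1)^m * q^(m^2-m)) 1 (by
    intro m
    rw [norm_mul, neg_one_zpow_norm, one_mul]
    exact zpow_norm_le (by linarith) (by rcases le_or_gt m 0 with h | h <;> nlinarith))
  simp_rw [unit_pair hq8 h0] at this
  rw [tsum_eq_single 0 (by intro n hn; simp [hn])] at this
  simp only [if_true, mul_one] at this
  rw [show wn q 0 = 1 by simp [wn]] at this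
  rw [this, psim]
  congr 1
  apply tsum_congr
  intro m
  rw [mul_assoc, ← zpow_add₀ h0]; ring_nf

lemma alp_norm {q : ℂ} (hq : ‖q‖ ≤ 1/128) (h0 : q ≠ 0) (m : ℤ) : ‖alp q m‖ ≤ 4 := by
  have hq1 : ‖q‖ ≤ 1 := by linarith
  have aux : ∀ m : ℤ, 0 ≤ m → (1/2:ℝ) ≤ ‖1 + q^(4*m)‖ := by
    intro m hm
    rcases hm.eq_or_lt with h | h
    · subst h; norm_num
    · obtain ⟨n, hn⟩ := Int.eq_ofNat_of_zero_le (show 0 ≤ 4*m-1 by omega)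
      have h1 : q^(4*m) = q^(n+1) := by rw [show 4*m = ((n+1:ℕ):ℤ) by push_cast; omega, zpow_natCast]
      have h2 := qpow_le' (q := q) (by linarith) n
      have := norm_sub_le (1 + q^(4*m)) (q^(4*m))
      rw [add_sub_cancel_right, norm_one] at this
      rw [← h1] at h2
      linarith
  have aux2 : ∀ m k : ℤ, 0 ≤ m → 0 ≤ k → ‖2 * (-1)^m * q^k / (1 + q^(4*m))‖ ≤ 4 := by
    intro m k hm hk
    rw [norm_div, norm_mul, norm_mul, neg_one_zpow_norm, mul_one]
    have h1 := aux m hm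
    have h2 := zpow_norm_le hq1 hk
    rw [div_le_iff₀ (by linarith)]
    have : ‖(2:ℂ)‖ = 2 := by simp
    rw [this]; linarith
  rcases le_or_gt 0 m with h | h
  · exact aux2 m _ h (by nlinarith)
  · have h1 := aux2 (-m) (m^2-3*m) (by omega) (by nlinarith)
    have : alp q m = 2 * (-1)^(-m) * q^(m^2-3*m) / (1 + q^(4*-m)) := by
      rw [alp, neg_one_zpow_neg, div_eq_div_iff (one_add_zpow_ne h0 (by linarith) _) (one_add_zpow_ne h0 (by linarith) _)]
      have z1 : q^(m^2+m) = q^(m^2-3*m) * q^(4*m) := by rw [← zpow_add₀ h0]; ring_nf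
      have z2 : q^(4*m) * q^(4*-m) = 1 := by rw [← zpow_add₀ h0]; simp
      rw [z1]
      linear_combination (2 * (-1)^m * q^(m^2-3*m)) * z2
    rw [this]; exact h1

/-- Part A conclusion -/
lemma partA {q : ℂ} (hq : ‖q‖ ≤ 1/128) (h0 : q ≠ 0) :
    psim q * UU q = 2 * ∑' m : ℤ, (-1)^m * q^(2*m^2+m) / (1 + q^(4*m)) := by
  have hq8 : ‖q‖ ≤ 1/8 := by linarith
  have h1 := sum_wbD hq h0 (alp q) 4 (alp_norm hq h0)
  simp_rw [alp_pair hq8 h0] at h1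
  have h2 : UU q = ∑' n : ℕ, wn q n * (∏ j ∈ Finset.range n, (1 + q^(4*j+4)))⁻¹ := (UU_eq3 hq8).tsum_eq.symm
  rw [h2, h1]
  have h3 : ∑' m : ℤ, alp q m * q^(m^2) = 2 * ∑' m : ℤ, (-1)^m * q^(2*m^2+m) / (1 + q^(4*m)) := by
    rw [← tsum_mul_left]
    apply tsum_congr
    intro m
    have z1 : q^(2*m^2+m) = q^(m^2+m) * q^(m^2) := by rw [← zpow_add₀ h0]; ring_nf
    rw [alp, z1]; ring
  rw [h3]
  linear_combination (2 * ∑' m : ℤ, (-1)^m * q^(2*m^2+m) / (1 + q^(4*m))) * S0_eq hq h0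

end M2

namespace M2
open Complex

lemma realS_nat {r v : ℝ} (h0 : 0 < r) (h1 : r < 1) (hv : 0 < v) : Summable (fun n : ℕ => r^(n^2) * v^n) := by
  apply summable_of_ratio_test_tendsto_lt_one (l := 0) (by norm_num)
  · exact Filter.Eventually.of_forall (fun n => by positivity)
  · have : (fun n : ℕ => ‖r^((n+1)^2) * v^(n+1)‖ / ‖r^(n^2) * v^n‖) = fun n : ℕ => (r^2)^n * (r * v) := by
      funext n
      rw [Real.norm_of_nonneg (by positivity), Real.norm_of_nonneg (by positivity)]
      rw [div_eq_iff (by positivity)]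
      ring
    rw [this]
    have h2 : Filter.Tendsto (fun n : ℕ => (r^2)^n) Filter.atTop (nhds 0) :=
      tendsto_pow_atTop_nhds_zero_of_lt_one (by positivity) (by nlinarith)
    simpa using h2.mul_const (r*v)

lemma realS {r v : ℝ} (h0 : 0 < r) (h1 : r < 1) (hv : 0 < v) : Summable (fun n : ℤ => r^(n^2) * v^n) := by
  apply Summable.of_nat_of_neg
  · have := realS_nat h0 h1 hv
    refine this.congr (fun n => ?_)
    rw [← zpow_natCast, ← zpow_natCast]; push_cast; rfl
  · have := realS_nat h0 h1 (inv_pos.mpr hv)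
    refine this.congr (fun n => ?_)
    rw [← zpow_natCast, ← zpow_natCast, inv_zpow', neg_sq]; push_cast; rfl

noncomputable def Ph (p u : ℂ) : ℂ := ∑' n : ℤ, p^(n^2) * u^n

lemma Ph_summ {p u : ℂ} (h0 : p ≠ 0) (h1 : ‖p‖ < 1) (hu : u ≠ 0) : Summable (fun n : ℤ => ‖p^(n^2) * u^n‖) := by
  have := realS (norm_pos_iff.mpr h0) h1 (norm_pos_iff.mpr hu)
  simpa using this

lemma Ph_hasSum {p u : ℂ} (h0 : p ≠ 0) (h1 : ‖p‖ < 1) (hu : u ≠ 0) : HasSum (fun n : ℤ => p^(n^2) * u^n) (Ph p u) :=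
  (Ph_summ h0 h1 hu).of_norm.hasSum

lemma Ph_inv (p u : ℂ) : Ph p u⁻¹ = Ph p u := by
  rw [Ph, Ph, ← (Equiv.neg ℤ).tsum_eq]
  refine tsum_congr (fun n => ?_)
  simp

lemma Ph_shift {p u : ℂ} (h0 : p ≠ 0) (hu : u ≠ 0) : Ph p (p^2*u) = p⁻¹ * u⁻¹ * Ph p u := by
  rw [Ph, Ph, ← tsum_mul_left, ← (Equiv.addRight (1:ℤ)).tsum_eq (fun n : ℤ => p⁻¹ * u⁻¹ * (p^(n^2) * u^n))]
  refine tsum_congr (fun n => ?_)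
  simp only [Equiv.coe_addRight]
  rw [mul_zpow, zpow_add_one₀ hu, show (n+1)^2 = n^2 + 2*n + 1 by ring, zpow_add_one₀ h0, zpow_add₀ h0, zpow_mul p 2 n]
  field_simp

noncomputable def parEquiv : (ℤ × ℤ) ⊕ (ℤ × ℤ) ≃ ℤ × ℤ := Equiv.ofBijective
  (Sum.elim (fun x => (x.1 + x.2, x.1 - x.2)) (fun x => (x.1 + x.2 + 1, x.1 - x.2))) (by
  constructor
  · rintro (⟨a, b⟩ | ⟨a, b⟩) (⟨c, d⟩ | ⟨c, d⟩) h <;> simp at h ⊢ <;> omega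
  · rintro ⟨m, n⟩
    rcases Int.even_or_odd' (m + n) with ⟨k, h | h⟩
    · exact ⟨Sum.inl (k, m - k), by simp; omega⟩
    · exact ⟨Sum.inr (k, m - k - 1), by simp; omega⟩)

lemma parity {F : ℤ × ℤ → ℂ} (hF : Summable F) :
    ∑' x, F x = ∑' x : ℤ × ℤ, F (x.1 + x.2, x.1 - x.2) + ∑' x : ℤ × ℤ, F (x.1 + x.2 + 1, x.1 - x.2) := by
  rw [← parEquiv.tsum_eq]
  have h := (parEquiv.summable_iff).mpr hF
  have h1 : Summable ((F ∘ parEquiv) ∘ Sum.inl) := h.comp_injective Sum.inl_injective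
  have h2 : Summable ((F ∘ parEquiv) ∘ Sum.inr) := h.comp_injective Sum.inr_injective
  exact (HasSum.sum h1.hasSum h2.hasSum).tsum_eq

lemma Ph_prod {p u p' u' : ℂ} (h0 : p ≠ 0) (h1 : ‖p‖ < 1) (hu : u ≠ 0) (h0' : p' ≠ 0) (h1' : ‖p'‖ < 1) (hu' : u' ≠ 0) :
    Ph p u * Ph p' u' = ∑' x : ℤ × ℤ, (p^(x.1^2) * u^x.1) * (p'^(x.2^2) * u'^x.2) := by
  rw [Ph, Ph]
  exact tsum_mul_tsum_of_summable_norm (Ph_summ h0 h1 hu) (Ph_summ h0' h1' hu')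

lemma Ph_prod_summ {p u p' u' : ℂ} (h0 : p ≠ 0) (h1 : ‖p‖ < 1) (hu : u ≠ 0) (h0' : p' ≠ 0) (h1' : ‖p'‖ < 1) (hu' : u' ≠ 0) :
    Summable (fun x : ℤ × ℤ => (p^(x.1^2) * u^x.1) * (p'^(x.2^2) * u'^x.2)) :=
  summable_mul_of_summable_norm (f := fun n : ℤ => p^(n^2) * u^n) (g := fun n : ℤ => p'^(n^2) * u'^n)
    (Ph_summ h0 h1 hu) (Ph_summ h0' h1' hu')

lemma sq_norm_lt {p : ℂ} (h1 : ‖p‖ < 1) : ‖p^2‖ < 1 := by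
  rw [norm_pow]; nlinarith [norm_nonneg p]

lemma Ph_add {p a b : ℂ} (h0 : p ≠ 0) (h1 : ‖p‖ < 1) (ha : a ≠ 0) (hb : b ≠ 0) :
    Ph p a * Ph p b = Ph (p^2) (a*b) * Ph (p^2) (a/b) + p * a * (Ph (p^2) (p^2*a*b) * Ph (p^2) (p^2*a/b)) := by
  have h02 : p^2 ≠ 0 := pow_ne_zero _ h0
  have h12 := sq_norm_lt h1
  rw [Ph_prod h0 h1 ha h0 h1 hb, parity (Ph_prod_summ h0 h1 ha h0 h1 hb),
    Ph_prod h02 h12 (by positivity) h02 h12 (by positivity),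
    Ph_prod h02 h12 (by positivity) h02 h12 (by positivity), ← tsum_mul_left]
  congr 1
  · refine tsum_congr (fun x => ?_)
    obtain ⟨i, j⟩ := x
    simp only
    have e1 : (p^2)^(i^2) = p^(2*i^2) := by rw [zpow_mul]; norm_cast
    have e2 : (p^2)^(j^2) = p^(2*j^2) := by rw [zpow_mul]; norm_cast
    rw [e1, e2, mul_zpow, div_zpow, zpow_add₀ ha, zpow_sub₀ hb,
      show (i+j)^2 = i^2+j^2+2*i*j by ring, show (i-j)^2 = i^2+j^2-2*i*j by ring, zpow_sub₀ h0, zpow_add₀ h0,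
      zpow_add₀ h0, show 2*i^2 = i^2+i^2 by ring, show 2*j^2 = j^2+j^2 by ring, zpow_add₀ h0, zpow_add₀ h0]
    have : p^(2*i*j) ≠ 0 := zpow_ne_zero _ h0
    generalize p^(2*i*j) = z at *
    field_simp
  · refine tsum_congr (fun x => ?_)
    obtain ⟨i, j⟩ := x
    simp only
    have e0 : p^2 = p^(2:ℤ) := by norm_cast
    have e1 : (p^(2:ℤ))^(i^2) = p^(2*i^2) := by rw [zpow_mul]
    have e2 : (p^(2:ℤ))^(j^2) = p^(2*j^2) := by rw [zpow_mul]
    have e3 : (p^(2:ℤ))^(i) = p^(2*i) := by rw [zpow_mul]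
    have e4 : (p^(2:ℤ))^(j) = p^(2*j) := by rw [zpow_mul]
    rw [e0, e1, e2, mul_zpow, mul_zpow, div_zpow, mul_zpow, e3, e4, zpow_add_one₀ ha, zpow_add₀ ha, zpow_sub₀ hb]
    have e5 : p^((i+j+1)^2) * p^((i-j)^2) = p * (p^(2*i^2) * p^(2*i) * (p^(2*j^2)*p^(2*j))) := by
      rw [← zpow_add₀ h0, ← zpow_add₀ h0, ← zpow_add₀ h0, ← zpow_add₀ h0, ← zpow_one_add₀ h0]; ring_nf
    have hb' : b^j ≠ 0 := zpow_ne_zero _ hb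
    have hb'' : b^i ≠ 0 := zpow_ne_zero _ hb
    calc _ = (p^((i+j+1)^2) * p^((i-j)^2)) * (a^i*a^j*a * (b^i/b^j)) := by ring
      _ = _ := by rw [e5]; field_simp

noncomputable def par1Equiv : ℤ ⊕ ℤ ≃ ℤ := Equiv.ofBijective
  (Sum.elim (fun x => 2*x) (fun x => 2*x+1)) (by
  constructor
  · rintro (a | a) (c | c) h <;> simp at h ⊢ <;> omega
  · intro m
    rcases Int.even_or_odd' m with ⟨k, h | h⟩
    · exact ⟨Sum.inl k, by simp; omega⟩
    · exact ⟨Sum.inr k, by simp; omega⟩)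

lemma par1 {F : ℤ → ℂ} (hF : Summable F) : ∑' n, F n = ∑' n, F (2*n) + ∑' n, F (2*n+1) := by
  rw [← par1Equiv.tsum_eq]
  have h := (par1Equiv.summable_iff).mpr hF
  have h1 : Summable ((F ∘ par1Equiv) ∘ Sum.inl) := h.comp_injective Sum.inl_injective
  have h2 : Summable ((F ∘ par1Equiv) ∘ Sum.inr) := h.comp_injective Sum.inr_injective
  exact (HasSum.sum h1.hasSum h2.hasSum).tsum_eq

lemma par4 {F : ℤ → ℂ} (hF : Summable F) : ∑' n, F n = ∑' n, F (4*n) + ∑' n, F (4*n+1) + ∑' n, F (4*n+2) + ∑' n, F (4*n+3) := by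
  have i1 : Function.Injective (fun n : ℤ => 2*n) := fun a b h => by simp at h; exact h
  have i2 : Function.Injective (fun n : ℤ => 2*n+1) := fun a b h => by simp at h; exact h
  have h1 : Summable (fun n : ℤ => F (2*n)) := hF.comp_injective i1
  have h2 : Summable (fun n : ℤ => F (2*n+1)) := hF.comp_injective i2
  rw [par1 hF, par1 h1, par1 h2]
  have e1 : ∀ n : ℤ, 2*(2*n) = 4*n := fun n => by ring
  have e2 : ∀ n : ℤ, 2*(2*n+1) = 4*n+2 := fun n => by ring
  have e3 : ∀ n : ℤ, 4*n+2+1 = 4*n+3 := fun n => by ring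
  simp only [e1, e2, e3]
  ring

end M2

namespace M2
open Complex

noncomputable def jj (p w : ℂ) : ℂ := Ph p (-(w/p))

lemma jj_shift {p w : ℂ} (h0 : p ≠ 0) (hw : w ≠ 0) : jj p (p^2*w) = -w⁻¹ * jj p w := by
  have := Ph_shift (p := p) (u := -(w/p)) h0 (by simp [hw, h0])
  rw [jj, jj, show -(p^2*w/p) = p^2 * -(w/p) by ring, this]
  field_simp

lemma jj_one {p : ℂ} (h0 : p ≠ 0) : jj p 1 = 0 := by
  have h1 := Ph_shift (p := p) (u := -(1/p)) h0 (by simp [h0])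
  have h2 := Ph_inv p (-(1/p))
  rw [show (-(1/p))⁻¹ = p^2 * -(1/p) by field_simp, h1] at h2
  rw [jj]
  have h3 : p⁻¹ * (-(1/p))⁻¹ = -1 := by field_simp
  rw [h3] at h2
  linear_combination (-1/2) * h2

lemma jj_zshift {p w : ℂ} (h0 : p ≠ 0) (hw : w ≠ 0) (r : ℤ) :
    jj p w = (-1)^r * p^(r^2-r) * w^r * jj p (p^(2*r)*w) := by
  have step : ∀ r : ℤ, jj p (p^(2*(r+1))*w) = -(p^(2*r)*w)⁻¹ * jj p (p^(2*r)*w) := by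
    intro r
    rw [← jj_shift h0 (mul_ne_zero (zpow_ne_zero _ h0) hw)]
    congr 1
    rw [← mul_assoc]
    congr 1
    rw [show p^2 = p^(2:ℤ) by norm_cast, ← zpow_add₀ h0]
    ring_nf
  have key : ∀ r : ℤ, (-1)^(r+1) * p^((r+1)^2-(r+1)) * w^(r+1) * jj p (p^(2*(r+1))*w) =
      (-1)^r * p^(r^2-r) * w^r * jj p (p^(2*r)*w) := by
    intro r
    rw [step, neg_one_zpow_add_one, zpow_add_one₀ hw, show (r+1)^2-(r+1) = (r^2-r) + 2*r by ring, zpow_add₀ h0]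
    have h := zpow_ne_zero (2*r) h0
    generalize p^(2*r) = z at *
    field_simp
  induction r using Int.induction_on with
  | zero => simp
  | succ i ih => rw [key]; exact ih
  | pred i ih => rw [← key, sub_add_cancel]; exact ih

lemma jj_p2 {p : ℂ} (h0 : p ≠ 0) (r : ℤ) : jj p (p^(2*r)) = 0 := by
  have := jj_zshift h0 one_ne_zero r
  rw [jj_one h0, mul_one] at this
  have h2 := (mul_eq_zero.mp this.symm).resolve_left (by
    refine mul_ne_zero (mul_ne_zero (zpow_ne_zero _ (by norm_num)) (zpow_ne_zero _ h0)) (by simp))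
  exact h2

noncomputable def tt (p : ℂ) (M : ℕ) : ℂ := ∑' k : ℕ, (-1)^(M+k) * p^((M+k)^2+(M+k))

lemma tt_term {p : ℂ} (h1 : ‖p‖ < 1) (M k : ℕ) :
    ‖(-1)^(M+k) * p^((M+k)^2+(M+k))‖ ≤ ‖p‖^(M^2+M) * ‖p‖^k := by
  rw [norm_mul, norm_pow, norm_pow, norm_neg, norm_one, one_pow, one_mul, ← pow_add]
  exact pow_le_pow_of_le_one (norm_nonneg _) h1.le (by nlinarith)

lemma tt_summ {p : ℂ} (h1 : ‖p‖ < 1) (M : ℕ) : Summable (fun k : ℕ => (-1)^(M+k) * p^((M+k)^2+(M+k))) :=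
  Summable.of_norm_bounded ((summable_geometric_of_lt_one (norm_nonneg _) h1).mul_left _) (tt_term h1 M)

lemma tt_norm {p : ℂ} (h1 : ‖p‖ < 1) (M : ℕ) : ‖tt p M‖ ≤ ‖p‖^(M^2+M) * (1-‖p‖)⁻¹ := by
  have := tsum_of_norm_bounded ((summable_geometric_of_lt_one (norm_nonneg _) h1).mul_left (‖p‖^(M^2+M))).hasSum (tt_term h1 M)
  rwa [tsum_mul_left, tsum_geometric_of_lt_one (norm_nonneg _) h1] at this

lemma tt_succ {p : ℂ} (h1 : ‖p‖ < 1) (M : ℕ) : tt p M = (-1)^M * p^(M^2+M) + tt p (M+1) := by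
  rw [tt, (tt_summ h1 M).tsum_eq_zero_add, tt]
  congr 1
  refine tsum_congr (fun k => ?_)
  rw [show M + (k+1) = M + 1 + k by ring]

noncomputable def ss (p : ℂ) (m : ℤ) : ℂ := tt p m.natAbs

lemma ss_norm {p : ℂ} (h1 : ‖p‖ < 1) (m : ℤ) : ‖ss p m‖ ≤ (1-‖p‖)⁻¹ * ‖p‖^(m^2) * ‖p‖^m.natAbs := by
  refine (tt_norm h1 _).trans (le_of_eq ?_)
  have : ‖p‖^(m^2) = ‖p‖^(m.natAbs^2) := by
    rw [← zpow_natCast]; push_cast; rw [sq_abs]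
  rw [this, pow_add]; ring

lemma ss_diff {p : ℂ} (h1 : ‖p‖ < 1) (m : ℤ) : ss p m - ss p (m-1) = (-1)^m * p^(m^2-m) := by
  rcases le_or_gt m 0 with h | h
  · obtain ⟨M, rfl⟩ : ∃ M : ℕ, m = -(M:ℤ) := ⟨m.natAbs, by omega⟩
    rw [ss, ss, show (-(M:ℤ)).natAbs = M by omega, show (-(M:ℤ)-1).natAbs = M+1 by omega, tt_succ h1 M]
    rw [neg_one_zpow_neg, show (-(M:ℤ))^2 - -(M:ℤ) = ((M^2+M : ℕ) : ℤ) by push_cast; ring, zpow_natCast, zpow_natCast]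
    ring
  · obtain ⟨M, rfl⟩ : ∃ M : ℕ, m = (M:ℤ)+1 := ⟨m.natAbs - 1, by omega⟩
    rw [ss, ss, show ((M:ℤ)+1).natAbs = M+1 by omega, show ((M:ℤ)+1-1).natAbs = M by omega, tt_succ h1 M]
    rw [neg_one_zpow_add_one, show ((M:ℤ)+1)^2 - ((M:ℤ)+1) = ((M^2+M : ℕ) : ℤ) by push_cast; ring, zpow_natCast, zpow_natCast]
    ring

lemma npow_le_one {p : ℂ} (h1 : ‖p‖ < 1) (n : ℕ) : ‖p‖^n ≤ 1 := pow_le_one₀ (norm_nonneg _) h1.le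

lemma ss_norm' {p : ℂ} (h1 : ‖p‖ < 1) (m : ℤ) : ‖ss p m‖ ≤ (1-‖p‖)⁻¹ * ‖p‖^(m^2) := by
  refine (ss_norm h1 m).trans ?_
  have h2 : 0 < 1 - ‖p‖ := by linarith
  have h3 : 0 ≤ (1-‖p‖)⁻¹ * ‖p‖^(m^2) := by positivity
  nlinarith [npow_le_one h1 m.natAbs]

noncomputable def Ee (p w : ℂ) : ℂ := ∑' m : ℤ, ss p m * w^m

lemma Ee_summ {p w : ℂ} (h0 : p ≠ 0) (h1 : ‖p‖ < 1) (hw : w ≠ 0) : Summable (fun m : ℤ => ‖ss p m * w^m‖) := by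
  refine Summable.of_nonneg_of_le (fun _ => norm_nonneg _) (fun m => ?_)
    ((realS (norm_pos_iff.mpr h0) h1 (norm_pos_iff.mpr hw)).mul_left (1-‖p‖)⁻¹)
  rw [norm_mul, norm_zpow, ← mul_assoc]
  exact mul_le_mul_of_nonneg_right (ss_norm' h1 m) (by positivity)

lemma jj_eq {p w : ℂ} (h0 : p ≠ 0) : jj p w = ∑' m : ℤ, (-1)^m * p^(m^2-m) * w^m := by
  rw [jj, Ph]
  refine tsum_congr (fun m => ?_)
  rw [show -(w/p) = (-1) * (w * p⁻¹) by ring, mul_zpow, mul_zpow, inv_zpow, zpow_sub₀ h0]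
  ring

lemma Ee_mul {p w : ℂ} (h0 : p ≠ 0) (h1 : ‖p‖ < 1) (hw : w ≠ 0) : (1-w) * Ee p w = jj p w := by
  have hs := (Ee_summ h0 h1 hw).of_norm
  have h2 : w * Ee p w = ∑' m : ℤ, ss p (m-1) * w^m := by
    rw [Ee, ← tsum_mul_left, ← (Equiv.addRight (1:ℤ)).tsum_eq (fun m : ℤ => ss p (m-1) * w^m)]
    refine tsum_congr (fun m => ?_)
    simp only [Equiv.coe_addRight, add_sub_cancel_right]
    rw [zpow_add_one₀ hw]; ring
  have h3 : Summable (fun m : ℤ => ss p (m-1) * w^m) := by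
    rw [← (Equiv.addRight (1:ℤ)).summable_iff]
    refine (hs.mul_left w).congr (fun m => ?_)
    simp only [Function.comp, Equiv.coe_addRight, add_sub_cancel_right]
    rw [zpow_add_one₀ hw]; ring
  rw [sub_mul, one_mul, h2, Ee, ← hs.tsum_sub h3, jj_eq h0]
  refine tsum_congr (fun m => ?_)
  rw [← ss_diff h1 m]; ring

noncomputable def CC (p : ℂ) : ℂ := Ee p 1

lemma Ee_p2 {p : ℂ} (h0 : p ≠ 0) (h1 : ‖p‖ < 1) (r : ℤ) : Ee p (p^(2*r)) = if r = 0 then CC p else 0 := by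
  split_ifs with h
  · simp [h, CC]
  · have h2 := Ee_mul h0 h1 (zpow_ne_zero (2*r) h0)
    rw [jj_p2 h0] at h2
    refine (mul_eq_zero.mp h2).resolve_left ?_
    intro h3
    have h4 : ‖p^(2*r)‖ = 1 := by
      rw [show p^(2*r) = 1 by linear_combination -h3]; simp
    rw [norm_zpow] at h4
    have h5 := norm_pos_iff.mpr h0
    rw [zpow_eq_one_iff_right₀ h5.le h1.ne] at h4
    omega

end M2

namespace M2
open Complex

noncomputable def Lam (p x u : ℂ) : ℂ := ∑' r : ℤ, (-1)^r * p^(r^2) * u^r / (1 - p^(2*r)*(x*u))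

noncomputable def gt (p x u : ℂ) (y : ℤ × ℤ) : ℂ := p^(2*y.1*y.2-y.1) * x^y.2 * u^(y.1+y.2) * ss p (y.2-y.1)

lemma gt_summ {p x u : ℂ} (h0 : p ≠ 0) (h1 : ‖p‖ < 1) (hx : x ≠ 0) (hu : u ≠ 0) : Summable (gt p x u) := by
  have hp := norm_pos_iff.mpr h0
  have hx' := norm_pos_iff.mpr hx
  have hu' := norm_pos_iff.mpr hu
  have a1 := realS hp h1 (show 0 < ‖u‖/‖p‖ by positivity)
  have a2 := realS hp h1 (show 0 < ‖x‖*‖u‖ by positivity)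
  have a3 := (a1.mul_of_nonneg a2 (fun _ => by positivity) (fun _ => by positivity)).mul_left (1-‖p‖)⁻¹
  refine Summable.of_norm_bounded a3 (fun y => ?_)
  obtain ⟨r, k⟩ := y
  rw [gt]
  simp only [norm_mul, norm_zpow]
  calc _ ≤ ‖p‖^(2*r*k-r) * ‖x‖^k * ‖u‖^(r+k) * ((1-‖p‖)⁻¹ * ‖p‖^((k-r)^2)) :=
        mul_le_mul_of_nonneg_left (ss_norm' h1 _) (by positivity)
    _ = (1-‖p‖)⁻¹ * ((‖p‖^(2*r*k-r) * ‖p‖^((k-r)^2)) * ‖x‖^k * ‖u‖^(r+k)) := by ring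
    _ = (1-‖p‖)⁻¹ * ((‖p‖^(r^2) * ‖p‖^(-r) * ‖p‖^(k^2)) * ‖x‖^k * ‖u‖^(r+k)) := by
        congr 3
        rw [← zpow_add₀ hp.ne', ← zpow_add₀ hp.ne', ← zpow_add₀ hp.ne']; ring_nf
    _ = _ := by
        rw [zpow_add₀ hu'.ne', div_zpow, mul_zpow, zpow_neg]
        field_simp

noncomputable def gg (p x u : ℂ) : ℂ := ∑' y, gt p x u y

def shearEquiv : ℤ × ℤ ≃ ℤ × ℤ where
  toFun y := (y.1, y.1 + y.2)
  invFun y := (y.1, y.2 - y.1)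
  left_inv y := by simp
  right_inv y := by simp

lemma gg_eq {p x u : ℂ} (h0 : p ≠ 0) (h1 : ‖p‖ < 1) (hx : x ≠ 0) (hu : u ≠ 0) :
    gg p x u = ∑' r : ℤ, p^(2*r^2-r) * x^r * u^(2*r) * Ee p (p^(2*r)*(x*u)) := by
  rw [gg, ← shearEquiv.tsum_eq, Summable.tsum_prod (f := fun y => gt p x u (shearEquiv y))
    ((shearEquiv.summable_iff).mpr (gt_summ h0 h1 hx hu))]
  refine tsum_congr (fun r => ?_)
  rw [Ee, ← tsum_mul_left]
  refine tsum_congr (fun m => ?_)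
  simp only [shearEquiv, gt, Equiv.coe_fn_mk, add_sub_cancel_left]
  rw [mul_zpow, mul_zpow, ← zpow_mul, zpow_add₀ hx, show r + (r+m) = 2*r+m by ring, zpow_add₀ hu,
    show 2*r*(r+m)-r = (2*r^2-r) + 2*r*m by ring, zpow_add₀ h0]
  ring

lemma gg_Lam {p x u : ℂ} (h0 : p ≠ 0) (h1 : ‖p‖ < 1) (hx : x ≠ 0) (hu : u ≠ 0)
    (hne : ∀ r : ℤ, 1 - p^(2*r)*(x*u) ≠ 0) : gg p x u = Lam p x u * jj p (x*u) := by
  rw [gg_eq h0 h1 hx hu, Lam, ← tsum_mul_right]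
  refine tsum_congr (fun r => ?_)
  have hxu := mul_ne_zero hx hu
  rw [jj_zshift h0 hxu r, ← Ee_mul h0 h1 (mul_ne_zero (zpow_ne_zero (2*r) h0) hxu)]
  have h2 := hne r
  have h3 : ((-1:ℂ)^r) * (-1)^r = 1 := by rw [← mul_zpow]; simp
  have h4 : p^(2*r^2-r) = p^(r^2) * p^(r^2-r) := by rw [← zpow_add₀ h0]; ring_nf
  have h5 : u^(2*r) = u^r * u^r := by rw [← zpow_add₀ hu]; ring_nf
  rw [h4, h5, mul_zpow]
  generalize hz : 1 - p^(2*r)*(x*u) = z at *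
  field_simp
  linear_combination (-Ee p (p ^ (2 * r) * x * u)) * h3

lemma gg_star {p x : ℂ} (h0 : p ≠ 0) (h1 : ‖p‖ < 1) (hx : x ≠ 0) : gg p x x⁻¹ = CC p := by
  rw [gg_eq h0 h1 hx (inv_ne_zero hx), mul_inv_cancel₀ hx]
  simp only [mul_one, Ee_p2 h0 h1]
  rw [tsum_eq_single 0]
  · simp
  · intro r hr; simp [hr]

lemma parity_s1 {F : ℤ × ℤ → ℂ} (hF : Summable F) : Summable (fun x : ℤ × ℤ => F (x.1 + x.2, x.1 - x.2)) :=
  hF.comp_injective (i := fun x : ℤ × ℤ => (x.1 + x.2, x.1 - x.2)) (by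
    rintro ⟨a, b⟩ ⟨c, d⟩ h; simp at h ⊢; omega)

lemma parity_s2 {F : ℤ × ℤ → ℂ} (hF : Summable F) : Summable (fun x : ℤ × ℤ => F (x.1 + x.2 + 1, x.1 - x.2)) :=
  hF.comp_injective (i := fun x : ℤ × ℤ => (x.1 + x.2 + 1, x.1 - x.2)) (by
    rintro ⟨a, b⟩ ⟨c, d⟩ h; simp at h ⊢; omega)

set_option maxHeartbeats 2000000 in
lemma gg_AB {p x : ℂ} (h0 : p ≠ 0) (h1 : ‖p‖ < 1) (hx : x ≠ 0) : ∃ c0 c1 : ℂ, ∀ u, u ≠ 0 →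
    gg p x u = c0 * Ph (p^2) (x*u^2/p) + c1 * (u * Ph (p^2) (p*x*u^2)) := by
  refine ⟨∑' j : ℤ, p^(-2*j^2+j) * x^j * ss p (2*j), ∑' j : ℤ, p^(-2*j^2-j) * x^(j+1) * ss p (2*j+1), fun u hu => ?_⟩
  have hs := gt_summ h0 h1 hx hu
  have hs' : Summable (fun y : ℤ × ℤ => gt p x u (y.2, y.1)) :=
    hs.comp_injective (i := fun y : ℤ × ℤ => (y.2, y.1)) (by rintro ⟨a, b⟩ ⟨c, d⟩ h; simp at h ⊢; omega)
  have e : gg p x u = ∑' y : ℤ × ℤ, gt p x u (y.2, y.1) := ((Equiv.prodComm ℤ ℤ).tsum_eq (gt p x u)).symm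
  rw [e]
  refine (parity hs').trans ?_
  have s1 : Summable (fun y : ℤ × ℤ => gt p x u (y.1 - y.2, y.1 + y.2)) := parity_s1 hs'
  have s2 : Summable (fun y : ℤ × ℤ => gt p x u (y.1 - y.2, y.1 + y.2 + 1)) := parity_s2 hs'
  have hp2 : p^2 = p^(2:ℤ) := by norm_cast
  have hu2 : u^2 = u^(2:ℤ) := by norm_cast
  congr 1
  · refine s1.tsum_prod.trans ?_
    rw [Ph, ← tsum_mul_left]
    refine tsum_congr (fun i => ?_)
    rw [← tsum_mul_right]
    refine tsum_congr (fun j => ?_)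
    simp only [gt]
    rw [hp2, hu2, ← zpow_mul, div_zpow, mul_zpow, ← zpow_mul, show i + j - (i-j) = 2*j by ring, show i - j + (i+j) = 2*i by ring,
      zpow_add₀ hx]
    have : p^(2*(i-j)*(i+j)-(i-j)) = p^(-2*j^2+j) * (p^(2*i^2)/p^i) := by
      rw [← zpow_sub₀ h0, ← zpow_add₀ h0]; ring_nf
    rw [this]; ring
  · refine s2.tsum_prod.trans ?_
    rw [Ph, ← tsum_mul_left, ← tsum_mul_left]
    refine tsum_congr (fun i => ?_)
    rw [← tsum_mul_right]
    refine tsum_congr (fun j => ?_)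
    simp only [gt]
    rw [hp2, hu2, ← zpow_mul, mul_zpow, mul_zpow, ← zpow_mul, show i + j + 1 - (i-j) = 2*j+1 by ring, show i - j + (i+j+1) = 2*i+1 by ring,
      zpow_add_one₀ hu, show i + j + 1 = i + (j+1) by ring, zpow_add₀ hx]
    have : p^(2*(i-j)*(i+(j+1))-(i-j)) = p^(-2*j^2-j) * (p^(2*i^2)*p^i) := by
      rw [← zpow_add₀ h0, ← zpow_add₀ h0]; ring_nf
    rw [this]; ring

lemma Ph_shift' {p u : ℂ} (h0 : p ≠ 0) (hu : u ≠ 0) : Ph (p^2) (p^4*u) = p⁻¹^2 * u⁻¹ * Ph (p^2) u := by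
  rw [show p^4*u = (p^2)^2 * u by ring, Ph_shift (pow_ne_zero 2 h0) hu, inv_pow]

/-- the Appell difference formula -/
lemma appell_diff {p x u0 u1 : ℂ} (h0 : p ≠ 0) (h1 : ‖p‖ < 1) (hx : x ≠ 0) (hu0 : u0 ≠ 0) (hu1 : u1 ≠ 0)
    (hne0 : ∀ r : ℤ, 1 - p^(2*r)*(x*u0) ≠ 0) (hne1 : ∀ r : ℤ, 1 - p^(2*r)*(x*u1) ≠ 0) :
    (Lam p x u1 * Ph p (-u0) - Lam p x u0 * Ph p (-u1)) * (jj p (x*u0) * jj p (x*u1)) =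
      -(x * u0 * CC p * Ph p (-(x*u0*u1)) * jj p (u1/u0)) := by
  obtain ⟨c0, c1, hc⟩ := gg_AB h0 h1 hx
  have hst := hc x⁻¹ (inv_ne_zero hx)
  rw [gg_star h0 h1 hx] at hst
  have hh : ∀ u, u ≠ 0 → Ph p (-u) * jj p (x*u) = x * ((x⁻¹ * Ph (p^2) (p*x*x⁻¹^2)) * Ph (p^2) (x*u^2/p) -
      Ph (p^2) (x*x⁻¹^2/p) * (u * Ph (p^2) (p*x*u^2))) := by
    intro u hu
    rw [jj, Ph_add h0 h1 (neg_ne_zero.mpr hu) (by simp [hx, hu, h0])]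
    have e1 : -u * -(x*u/p) = x*u^2/p := by ring
    have e2 : -u / -(x*u/p) = p*x*x⁻¹^2 := by field_simp
    have e3 : p^2 * -u * -(x*u/p) = p*x*u^2 := by field_simp
    have e4 : p^2 * -u / -(x*u/p) = p^4 * (x*x⁻¹^2/p) := by field_simp
    rw [e1, e2, e3, e4, Ph_shift' h0 (by simp [hx, h0])]
    field_simp
    ring
  have hw : Ph (p^2) (x*u1^2/p) * (u0 * Ph (p^2) (p*x*u0^2)) - Ph (p^2) (x*u0^2/p) * (u1 * Ph (p^2) (p*x*u1^2)) =
      u0 * Ph p (-(x*u0*u1)) * jj p (u1/u0) := by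
    rw [jj, mul_assoc u0, Ph_add h0 h1 (by simp [hx, hu0, hu1]) (by simp [hu0, hu1, h0])]
    have e1 : -(x*u0*u1) * -(u1/u0/p) = x*u1^2/p := by field_simp
    have e2 : -(x*u0*u1) / -(u1/u0/p) = p*x*u0^2 := by field_simp
    have e3 : p^2 * -(x*u0*u1) * -(u1/u0/p) = p*x*u1^2 := by field_simp
    have e4 : p^2 * -(x*u0*u1) / -(u1/u0/p) = p^4 * (x*u0^2/p) := by field_simp
    rw [e1, e2, e3, e4, Ph_shift' h0 (by simp [hx, h0, hu0])]
    field_simp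
    ring
  have g0 := gg_Lam h0 h1 hx hu0 hne0
  have g1 := gg_Lam h0 h1 hx hu1 hne1
  have k0 := hh u0 hu0
  have k1 := hh u1 hu1
  have c0' := hc u0 hu0
  have c1' := hc u1 hu1
  have : (Lam p x u1 * Ph p (-u0) - Lam p x u0 * Ph p (-u1)) * (jj p (x*u0) * jj p (x*u1)) =
      gg p x u1 * (Ph p (-u0) * jj p (x*u0)) - gg p x u0 * (Ph p (-u1) * jj p (x*u1)) := by
    rw [g0, g1]; ring
  rw [this, k0, k1, c0', c1', hst]
  have hR : -(x * u0 * (c0 * Ph (p^2) (x*x⁻¹^2/p) + c1 * (x⁻¹ * Ph (p^2) (p*x*x⁻¹^2))) * Ph p (-(x*u0*u1)) * jj p (u1/u0)) =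
    -(x * (c0 * Ph (p^2) (x*x⁻¹^2/p) + c1 * (x⁻¹ * Ph (p^2) (p*x*x⁻¹^2)))) * (u0 * Ph p (-(x*u0*u1)) * jj p (u1/u0)) := by ring
  rw [hR, ← hw]
  ring

/-- Kronecker -/
lemma kron_aux {p a b : ℂ} (h0 : p ≠ 0) (h1 : ‖p‖ < 1) (ha0 : a ≠ 0) (ha : ‖a‖ < 1) (hap : ‖p‖^2 < ‖a‖) (hb : b ≠ 0) :
    ∑' n : ℤ, a^n * ((-1)^n * p^(n^2-n) * b^n * Ee p (p^(2*n)*b)) =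
      jj p (a*b) * ∑' m : ℤ, (-1)^m * a^(-m) * p^(m-m^2) * ss p m := by
  have hp := norm_pos_iff.mpr h0
  have ha' := norm_pos_iff.mpr ha0
  have hS1 : Summable (fun m : ℤ => ‖(-1)^m * a^(-m) * p^(m-m^2) * ss p m‖) := by
    have hbd : ∀ m : ℤ, ‖(-1)^m * a^(-m) * p^(m-m^2) * ss p m‖ ≤ (1-‖p‖)⁻¹ * (‖a‖^(-m) * (‖p‖^m * ‖p‖^m.natAbs)) := by
      intro m
      rw [norm_mul, norm_mul, norm_mul, neg_one_zpow_norm, one_mul, norm_zpow, norm_zpow]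
      calc _ ≤ ‖a‖^(-m) * ‖p‖^(m-m^2) * ((1-‖p‖)⁻¹ * ‖p‖^(m^2) * ‖p‖^m.natAbs) :=
            mul_le_mul_of_nonneg_left (ss_norm h1 m) (by positivity)
        _ = _ := by
            rw [zpow_sub₀ hp.ne']
            have := (zpow_pos hp (m^2)).ne'
            field_simp
    refine Summable.of_nonneg_of_le (fun _ => norm_nonneg _) hbd (Summable.mul_left _ ?_)
    apply Summable.of_nat_of_neg
    · have : ‖p‖^2/‖a‖ < 1 := by rw [div_lt_one ha']; exact hap
      refine (summable_geometric_of_lt_one (by positivity) this).congr (fun n => ?_)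
      rw [zpow_neg, zpow_natCast, zpow_natCast, Int.natAbs_natCast, div_pow, ← pow_mul, mul_comm 2 n, pow_mul]
      field_simp
    · refine (summable_geometric_of_lt_one (by positivity) ha).congr (fun n => ?_)
      rw [neg_neg, zpow_neg, zpow_natCast, zpow_natCast, Int.natAbs_neg, Int.natAbs_natCast]
      field_simp
  have hab := mul_ne_zero ha0 hb
  have hS2 : Summable (fun m : ℤ => ‖(-1)^m * p^(m^2-m) * (a*b)^m‖) := by
    refine (Ph_summ h0 h1 (u := -(a*b/p)) (by simp [h0, ha0, hb])).congr (fun m => ?_)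
    congr 1
    rw [show -(a*b/p) = (-1) * ((a*b) * p⁻¹) by ring, mul_zpow, mul_zpow, inv_zpow, zpow_sub₀ h0]
    ring
  rw [jj_eq h0, tsum_mul_tsum_of_summable_norm hS2 hS1]
  have hs := summable_mul_of_summable_norm hS2 hS1
  let e : ℤ × ℤ ≃ ℤ × ℤ := ⟨fun y => (y.1 + y.2, y.2), fun y => (y.1 - y.2, y.2), fun y => by simp, fun y => by simp⟩
  have hs3 := (e.summable_iff).mpr hs
  rw [← e.tsum_eq]
  refine Eq.trans ?_ (Summable.tsum_prod hs3).symm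
  refine tsum_congr (fun n => ?_)
  rw [Ee, ← tsum_mul_left, ← tsum_mul_left]
  refine tsum_congr (fun m => ?_)
  simp only [e, Function.comp, Equiv.coe_fn_mk]
  have h3 : ((-1:ℂ)^m) * (-1)^m = 1 := by rw [← mul_zpow]; simp
  have h4 : p^((n+m)^2-(n+m)) * p^(m-m^2) = p^(n^2-n) * p^(2*n*m) := by
    rw [← zpow_add₀ h0, ← zpow_add₀ h0]; ring_nf
  rw [mul_zpow, mul_zpow, ← zpow_mul, zpow_add₀ ha0, zpow_add₀ hb, zpow_add₀ (by norm_num : (-1:ℂ) ≠ 0), zpow_neg]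
  have ham := zpow_ne_zero m ha0
  calc _ = (p^(n^2-n) * p^(2*n*m)) * (a^n * (-1)^n * b^n * b^m * ss p m) := by ring
    _ = _ := by
        rw [← h4]
        field_simp
        linear_combination (-ss p m) * h3

lemma kron {p a b : ℂ} (h0 : p ≠ 0) (h1 : ‖p‖ < 1) (ha0 : a ≠ 0) (ha : ‖a‖ < 1) (hap : ‖p‖^2 < ‖a‖) (hb : b ≠ 0)
    (hne : ∀ r : ℤ, 1 - p^(2*r)*b ≠ 0) :
    (∑' n : ℤ, a^n / (1 - p^(2*n)*b)) * (jj p a * jj p b) = CC p * jj p (a*b) := by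
  have k1 := kron_aux h0 h1 ha0 ha hap hb
  have k2 := kron_aux h0 h1 ha0 ha hap (one_ne_zero)
  have k3 : ∑' n : ℤ, a^n * ((-1)^n * p^(n^2-n) * 1^n * Ee p (p^(2*n)*1)) = CC p := by
    simp only [mul_one, Ee_p2 h0 h1]
    rw [tsum_eq_single 0]
    · simp
    · intro r hr; simp [hr]
  rw [k3, mul_one] at k2
  have k4 : (∑' n : ℤ, a^n / (1 - p^(2*n)*b)) * jj p b =
      ∑' n : ℤ, a^n * ((-1)^n * p^(n^2-n) * b^n * Ee p (p^(2*n)*b)) := by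
    rw [← tsum_mul_right]
    refine tsum_congr (fun n => ?_)
    rw [jj_zshift h0 hb n, ← Ee_mul h0 h1 (mul_ne_zero (zpow_ne_zero (2*n) h0) hb)]
    have := hne n
    field_simp
  calc _ = ((∑' n : ℤ, a^n / (1 - p^(2*n)*b)) * jj p b) * jj p a := by ring
    _ = _ := by rw [k4, k1, k2]; ring

end M2

namespace M2
open Complex

lemma tsum_natAbs {r : ℝ} (h0 : 0 ≤ r) (h1 : r < 1) : HasSum (fun m : ℤ => r^m.natAbs) ((1-r)⁻¹ + (1-r)⁻¹ * r) := by
  apply HasSum.of_nat_of_neg_add_one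
  · simpa using hasSum_geometric_of_lt_one h0 h1
  · refine ((hasSum_geometric_of_lt_one h0 h1).mul_right r).congr_fun (fun n => ?_) |> id
    rw [show (-((n:ℤ)+1)).natAbs = n+1 by omega, pow_succ]

lemma theta_bound {q : ℂ} (hq : ‖q‖ ≤ 1/8) (f : ℤ → ℂ) (hf : ∀ n, ‖f n‖ ≤ ‖q‖^n.natAbs) (hf0 : f 0 = 1) :
    ∑' n, f n ≠ 0 := by
  have hlt : ‖q‖ < 1 := by linarith
  have hS : Summable f := Summable.of_norm_bounded (tsum_natAbs (norm_nonneg q) hlt).summable hf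
  intro h
  rw [hS.tsum_eq_add_tsum_ite 0, hf0] at h
  have hg : HasSum (fun n : ℤ => ‖q‖^n.natAbs - if n = 0 then (1:ℝ) else 0) ((1-‖q‖)⁻¹ + (1-‖q‖)⁻¹ * ‖q‖ - 1) :=
    (tsum_natAbs (norm_nonneg q) hlt).sub (hasSum_ite_eq 0 1)
  have hb := tsum_of_norm_bounded (f := fun n => if n = 0 then 0 else f n) hg (by
    intro n
    by_cases hn : n = 0
    · simp [hn]
    · simpa [hn] using hf n)
  have e : (∑' n : ℤ, if n = 0 then 0 else f n) = -1 := by linear_combination h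
  rw [e, norm_neg, norm_one] at hb
  have h3 : (1-‖q‖)⁻¹ ≤ 8/7 := by
    rw [inv_le_comm₀ (by linarith) (by norm_num)]; linarith
  nlinarith [norm_nonneg q]

noncomputable def TP (Q : ℂ) (a b : ℤ) : ℂ := Ph (Q^a) (Q^b)
noncomputable def TM (Q : ℂ) (a b : ℤ) : ℂ := Ph (Q^a) (-(Q^b))

lemma TP_eq {Q : ℂ} (h0 : Q ≠ 0) (a b : ℤ) : TP Q a b = ∑' n : ℤ, Q^(a*n^2+b*n) := by
  rw [TP, Ph]
  refine tsum_congr (fun n => ?_)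
  rw [zpow_add₀ h0, zpow_mul, zpow_mul]

lemma TM_eq {Q : ℂ} (h0 : Q ≠ 0) (a b : ℤ) : TM Q a b = ∑' n : ℤ, (-1)^n * Q^(a*n^2+b*n) := by
  rw [TM, Ph]
  refine tsum_congr (fun n => ?_)
  rw [zpow_add₀ h0, zpow_mul, zpow_mul, neg_eq_neg_one_mul, mul_zpow]; ring

lemma zp_le {Q : ℂ} (hQ : ‖Q‖ ≤ 1/8) (e : ℤ) (n : ℤ) (h : |n| ≤ e) : ‖Q^e‖ ≤ ‖Q‖^n.natAbs := by
  rw [Int.abs_eq_natAbs] at h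
  obtain ⟨m, rfl⟩ : ∃ m : ℕ, e = m := ⟨e.toNat, by omega⟩
  rw [zpow_natCast, norm_pow]
  exact pow_le_pow_of_le_one (norm_nonneg _) (by linarith) (by omega)

lemma quad_ge {a b : ℤ} (h : |b| < a) (n : ℤ) : |n| ≤ a*n^2+b*n := by
  rcases abs_lt.mp h with ⟨h1, h2⟩
  have ha : 0 ≤ a := (abs_nonneg b).trans h.le
  rcases lt_trichotomy n 0 with hn | hn | hn
  · rw [abs_of_neg hn]
    have : 0 ≤ a * (n * (n+1)) := mul_nonneg ha (by nlinarith)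
    nlinarith
  · simp [hn]
  · rw [abs_of_pos hn]
    have : 0 ≤ a * (n * (n-1)) := mul_nonneg ha (by nlinarith)
    nlinarith

lemma TP_ne {Q : ℂ} (hQ : ‖Q‖ ≤ 1/8) (h0 : Q ≠ 0) {a b : ℤ} (h : |b| < a) : TP Q a b ≠ 0 := by
  rw [TP_eq h0]
  refine theta_bound hQ _ (fun n => zp_le hQ _ n (quad_ge h n)) (by simp)

lemma TM_ne {Q : ℂ} (hQ : ‖Q‖ ≤ 1/8) (h0 : Q ≠ 0) {a b : ℤ} (h : |b| < a) : TM Q a b ≠ 0 := by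
  rw [TM_eq h0]
  refine theta_bound hQ _ (fun n => ?_) (by simp)
  rw [norm_mul, neg_one_zpow_norm, one_mul]
  exact zp_le hQ _ n (quad_ge h n)

lemma TP_neg (Q : ℂ) (a b : ℤ) : TP Q a (-b) = TP Q a b := by
  rw [TP, TP, zpow_neg, Ph_inv]

lemma TM_neg (Q : ℂ) (a b : ℤ) : TM Q a (-b) = TM Q a b := by
  rw [TM, TM, zpow_neg, ← inv_neg, Ph_inv]

lemma TP_shift {Q : ℂ} (h0 : Q ≠ 0) (a b : ℤ) : TP Q a (b+2*a) = Q^(-(a+b)) * TP Q a b := by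
  rw [TP, TP, show Q^(b+2*a) = (Q^a)^2 * Q^b by
    rw [← zpow_natCast (Q^a), ← zpow_mul, ← zpow_add₀ h0]; ring_nf]
  rw [Ph_shift (zpow_ne_zero _ h0) (zpow_ne_zero _ h0), zpow_neg, zpow_add₀ h0, mul_inv]

lemma TM_shift {Q : ℂ} (h0 : Q ≠ 0) (a b : ℤ) : TM Q a (b+2*a) = -Q^(-(a+b)) * TM Q a b := by
  rw [TM, TM, show -(Q^(b+2*a)) = (Q^a)^2 * -(Q^b) by
    rw [← zpow_natCast (Q^a), ← zpow_mul, mul_neg, ← zpow_add₀ h0]; ring_nf]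
  rw [Ph_shift (zpow_ne_zero _ h0) (neg_ne_zero.mpr (zpow_ne_zero _ h0)), zpow_neg, zpow_add₀ h0, mul_inv, inv_neg]
  ring

lemma zp_lt {Q : ℂ} (hQ : ‖Q‖ ≤ 1/8) {a : ℤ} (ha : 0 < a) : ‖Q^a‖ < 1 := by
  obtain ⟨m, rfl⟩ : ∃ m : ℕ, a = m := ⟨a.toNat, by omega⟩
  rw [zpow_natCast, norm_pow]
  exact pow_lt_one₀ (norm_nonneg _) (by linarith) (by omega)

lemma TPTP {Q : ℂ} (hQ : ‖Q‖ ≤ 1/8) (h0 : Q ≠ 0) {a : ℤ} (ha : 0 < a) (b c : ℤ) :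
    TP Q a b * TP Q a c = TP Q (2*a) (b+c) * TP Q (2*a) (b-c) +
      Q^(a+b) * (TP Q (2*a) (b+c+2*a) * TP Q (2*a) (b-c+2*a)) := by
  simp only [TP]
  rw [Ph_add (zpow_ne_zero _ h0) (zp_lt hQ ha) (zpow_ne_zero _ h0) (zpow_ne_zero _ h0)]
  have e0 : (Q^a)^2 = Q^(2*a) := by rw [← zpow_natCast (Q^a), ← zpow_mul]; ring_nf
  rw [e0, ← zpow_add₀ h0, ← zpow_sub₀ h0, ← zpow_add₀ h0, ← zpow_add₀ h0, ← zpow_add₀ h0, ← zpow_sub₀ h0]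
  ring_nf

lemma TMTM {Q : ℂ} (hQ : ‖Q‖ ≤ 1/8) (h0 : Q ≠ 0) {a : ℤ} (ha : 0 < a) (b c : ℤ) :
    TM Q a b * TM Q a c = TP Q (2*a) (b+c) * TP Q (2*a) (b-c) -
      Q^(a+b) * (TP Q (2*a) (b+c+2*a) * TP Q (2*a) (b-c+2*a)) := by
  simp only [TP, TM]
  rw [Ph_add (zpow_ne_zero _ h0) (zp_lt hQ ha) (neg_ne_zero.mpr (zpow_ne_zero _ h0)) (neg_ne_zero.mpr (zpow_ne_zero _ h0))]
  have e0 : (Q^a)^2 = Q^(2*a) := by rw [← zpow_natCast (Q^a), ← zpow_mul]; ring_nf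
  rw [e0]
  simp only [mul_neg, neg_mul, neg_neg, neg_div_neg_eq]
  rw [← zpow_add₀ h0, ← zpow_sub₀ h0, ← zpow_add₀ h0, ← zpow_add₀ h0, ← zpow_add₀ h0, ← zpow_sub₀ h0]
  ring_nf

lemma TPTM {Q : ℂ} (hQ : ‖Q‖ ≤ 1/8) (h0 : Q ≠ 0) {a : ℤ} (ha : 0 < a) (b c : ℤ) :
    TP Q a b * TM Q a c = TM Q (2*a) (b+c) * TM Q (2*a) (b-c) +
      Q^(a+b) * (TM Q (2*a) (b+c+2*a) * TM Q (2*a) (b-c+2*a)) := by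
  simp only [TP, TM]
  rw [Ph_add (zpow_ne_zero _ h0) (zp_lt hQ ha) (zpow_ne_zero _ h0) (neg_ne_zero.mpr (zpow_ne_zero _ h0))]
  have e0 : (Q^a)^2 = Q^(2*a) := by rw [← zpow_natCast (Q^a), ← zpow_mul]; ring_nf
  rw [e0]
  simp only [mul_neg, div_neg]
  rw [← zpow_add₀ h0, ← zpow_sub₀ h0, ← zpow_add₀ h0, ← zpow_add₀ h0, ← zpow_add₀ h0, ← zpow_sub₀ h0]
  ring_nf

/-- 2-dissection -/
lemma TP_split {Q : ℂ} (hQ : ‖Q‖ ≤ 1/8) (h0 : Q ≠ 0) {a : ℤ} (ha : 0 < a) (b : ℤ) :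
    TP Q a b = TP Q (4*a) (2*b) + Q^(a+b) * TP Q (4*a) (2*b+4*a) := by
  have hs := (Ph_summ (zpow_ne_zero a h0) (zp_lt hQ ha) (zpow_ne_zero b h0)).of_norm
  have hs' : Summable (fun n : ℤ => Q^(a*n^2+b*n)) := hs.congr (fun n => by rw [zpow_add₀ h0, zpow_mul, zpow_mul])
  rw [TP_eq h0, par1 hs', TP_eq h0, TP_eq h0, ← tsum_mul_left]
  congr 1
  · refine tsum_congr (fun n => ?_); ring_nf
  · refine tsum_congr (fun n => ?_); rw [← zpow_add₀ h0]; ring_nf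

lemma TM_split {Q : ℂ} (hQ : ‖Q‖ ≤ 1/8) (h0 : Q ≠ 0) {a : ℤ} (ha : 0 < a) (b : ℤ) :
    TM Q a b = TP Q (4*a) (2*b) - Q^(a+b) * TP Q (4*a) (2*b+4*a) := by
  have hs := (Ph_summ (zpow_ne_zero a h0) (zp_lt hQ ha) (neg_ne_zero.mpr (zpow_ne_zero b h0))).of_norm
  have hs' : Summable (fun n : ℤ => (-1)^n * Q^(a*n^2+b*n)) := hs.congr (fun n => by
    rw [zpow_add₀ h0, zpow_mul, zpow_mul, neg_eq_neg_one_mul, mul_zpow]; ring)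
  rw [TM_eq h0, par1 hs', TP_eq h0, TP_eq h0, ← tsum_mul_left, sub_eq_add_neg, ← tsum_neg]
  congr 1
  · refine tsum_congr (fun n => ?_)
    rw [zpow_mul]; norm_num; ring_nf
  · refine tsum_congr (fun n => ?_)
    rw [neg_one_zpow_add_one, zpow_mul, ← zpow_add₀ h0]; norm_num; ring_nf

/-- step d -/
lemma step_d {q : ℂ} (hq : ‖q‖ ≤ 1/128) (h0 : q ≠ 0) :
    TP q 2 2 * UU q = 2 * ∑' a : ℤ, q^(2*a^2+2*a) / (1 - q^(4*a+1)) := by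
  have hq8 : ‖q‖ ≤ 1/8 := by linarith
  have hp0 : q^(2:ℤ) ≠ 0 := zpow_ne_zero _ h0
  have hp1 : ‖q^(2:ℤ)‖ < 1 := zp_lt hq8 (by norm_num)
  have hne1 : ∀ r : ℤ, 1 - (q^(2:ℤ))^(2*r)*((-q⁻¹)*q) ≠ 0 := by
    intro r
    have := one_add_zpow_ne h0 (by linarith : ‖q‖ < 1) (4*r)
    rw [← zpow_mul, show (-q⁻¹)*q = -1 by field_simp, show 2*(2*r) = 4*r by ring]
    simpa using this
  have hne2 : ∀ r : ℤ, 1 - (q^(2:ℤ))^(2*r)*((-q⁻¹)*(-q^(2:ℤ))) ≠ 0 := by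
    intro r h
    rw [← zpow_mul, show (-q⁻¹)*(-q^(2:ℤ)) = q by field_simp, show 2*(2*r) = 4*r by ring, ← zpow_add_one₀ h0] at h
    have h2 : ‖q^(4*r+1)‖ = 1 := by rw [show q^(4*r+1) = 1 by linear_combination -h]; simp
    rw [norm_zpow, zpow_eq_one_iff_right₀ (norm_nonneg _) (by linarith)] at h2
    omega
  have key := appell_diff (p := q^(2:ℤ)) (x := -q⁻¹) (u0 := q) (u1 := -q^(2:ℤ)) hp0 hp1 (by simp [h0]) h0 (by simp [h0]) hne1 hne2
  have z1 : Ph (q^(2:ℤ)) (-(-q⁻¹*q*(-q^(2:ℤ)))) = 0 := by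
    have := jj_p2 hp0 1
    rw [jj] at this
    rw [← this]; congr 1; field_simp
    norm_cast; ring
  rw [z1] at key
  have L0 : Lam (q^(2:ℤ)) (-q⁻¹) q = ∑' m:ℤ, (-1)^m*q^(2*m^2+m)/(1+q^(4*m)) := by
    rw [Lam]
    refine tsum_congr (fun m => ?_)
    rw [show (-q⁻¹)*q = -1 by field_simp, zpow_add₀ h0, ← zpow_mul, ← zpow_mul, show 2*(2*m) = 4*m by ring]
    ring
  have L1 : Lam (q^(2:ℤ)) (-q⁻¹) (-q^(2:ℤ)) = ∑' a : ℤ, q^(2*a^2+2*a) / (1 - q^(4*a+1)) := by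
    rw [Lam]
    refine tsum_congr (fun m => ?_)
    rw [show (-q⁻¹)*(-q^(2:ℤ)) = q by field_simp, zpow_add₀ h0, ← zpow_mul, ← zpow_mul, show 2*(2*m) = 4*m by ring,
      ← zpow_add_one₀ h0, neg_eq_neg_one_mul (q^(2:ℤ)), mul_zpow, ← zpow_mul]
    have h3 : ((-1:ℂ)^m) * (-1)^m = 1 := by rw [← mul_zpow]; simp
    linear_combination (q ^ (2 * m ^ 2) * q^(2*m) / (1 - q ^ (4 * m + 1))) * h3
  have t0 : Ph (q^(2:ℤ)) (-q) = psim q := by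
    have : Ph (q^(2:ℤ)) (-q) = TM q 2 1 := by rw [TM, zpow_one]
    rw [this, ← TM_neg, TM_eq h0, psim]
    refine tsum_congr (fun m => ?_); ring_nf
  have t1 : Ph (q^(2:ℤ)) (-(-q^(2:ℤ))) = TP q 2 2 := by rw [TP, neg_neg]
  have n0 : jj (q^(2:ℤ)) (-q⁻¹*q) ≠ 0 := by
    have : jj (q^(2:ℤ)) (-q⁻¹*q) = TP q 2 (-2) := by
      rw [jj, TP, show (-q⁻¹)*q = -1 by field_simp]; congr 1; rw [zpow_neg]; ring
    rw [this, TP_split hq8 h0 (by norm_num)]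
    norm_num
    rw [show (4:ℤ) = -(-4) by norm_num, TP_neg, ← two_mul]
    exact mul_ne_zero two_ne_zero (TP_ne hq8 h0 (by norm_num))
  have n1 : jj (q^(2:ℤ)) (-q⁻¹*(-q^(2:ℤ))) ≠ 0 := by
    have : jj (q^(2:ℤ)) (-q⁻¹*(-q^(2:ℤ))) = TM q 2 (-1) := by
      rw [jj, TM, show (-q⁻¹)*(-q^(2:ℤ)) = q by field_simp]; congr 1; rw [zpow_neg, zpow_one]; field_simp
    rw [this]
    exact TM_ne hq8 h0 (by norm_num)
  have hA := partA hq h0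
  have hps : psim q ≠ 0 := right_ne_zero_of_mul_eq_one (S0_eq hq h0)
  rw [L0, L1, t0, t1, mul_zero, zero_mul, neg_zero] at key
  have key2 := (mul_eq_zero.mp key).resolve_right (mul_ne_zero n0 n1)
  apply mul_left_cancel₀ hps
  linear_combination (TP q 2 2) * hA - 2 * key2

end M2

namespace M2
open Complex

noncomputable def vv (c e : ℕ) : ℂ := (-1)^e * uu (4*e+c)
noncomputable def VV (c : ℕ) (Q : ℂ) : ℂ := ∑' e : ℕ, vv c e * Q^e

lemma UU_split {q Q : ℂ} (hq : ‖q‖ ≤ 1/8) (hQ : q^4 = -Q) :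
    UU q = VV 0 Q + q * VV 1 Q + q^2 * VV 2 Q + q^3 * VV 3 Q := by
  have hs : Summable (fun n : ℕ => uu n * q^n) :=
    (summ_of_bound (c := uu) 1 (fun n => by simpa using uu_bound n) hq).of_norm
  have inj : ∀ (a b : ℕ), 0 < a → Function.Injective (fun n : ℕ => a*n+b) := by
    intro a b ha x y h
    have : a * x = a * y := by simpa using h
    exact Nat.eq_of_mul_eq_mul_left ha this
  have h1 : Summable (fun n : ℕ => uu (2*n) * q^(2*n)) := hs.comp_injective (inj 2 0 (by norm_num))
  have h2 : Summable (fun n : ℕ => uu (2*n+1) * q^(2*n+1)) := hs.comp_injective (inj 2 1 (by norm_num))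
  have h3 : Summable (fun n : ℕ => uu (2*(2*n)) * q^(2*(2*n))) := h1.comp_injective (inj 2 0 (by norm_num))
  have h4 : Summable (fun n : ℕ => uu (2*(2*n+1)) * q^(2*(2*n+1))) := h1.comp_injective (inj 2 1 (by norm_num))
  have h5 : Summable (fun n : ℕ => uu (2*(2*n)+1) * q^(2*(2*n)+1)) := h2.comp_injective (inj 2 0 (by norm_num))
  have h6 : Summable (fun n : ℕ => uu (2*(2*n+1)+1) * q^(2*(2*n+1)+1)) := h2.comp_injective (inj 2 1 (by norm_num))
  have e1 : ∑' n : ℕ, uu n * q^n = ∑' n : ℕ, uu (2*n) * q^(2*n) + ∑' n : ℕ, uu (2*n+1) * q^(2*n+1) :=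
    (tsum_even_add_odd (f := fun n => uu n * q^n) h1 h2).symm
  have e2 := (tsum_even_add_odd (f := fun n => uu (2*n) * q^(2*n)) h3 h4).symm
  have e3 := (tsum_even_add_odd (f := fun n => uu (2*n+1) * q^(2*n+1)) h5 h6).symm
  have key : ∀ (c : ℕ) (g : ℕ → ℕ), (∀ e, g e = 4*e+c) → ∑' e : ℕ, uu (g e) * q^(g e) = q^c * VV c Q := by
    intro c g hg
    rw [VV, ← tsum_mul_left]
    refine tsum_congr (fun e => ?_)
    rw [hg, pow_add, pow_mul, hQ, vv, neg_pow Q e]; ring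
  rw [UU, e1, e2, e3, key 0 (fun n => 2*(2*n)) (fun e => by ring), key 2 (fun n => 2*(2*n+1)) (fun e => by ring),
    key 1 (fun n => 2*(2*n)+1) (fun e => by ring), key 3 (fun n => 2*(2*n+1)+1) (fun e => by ring)]
  ring

noncomputable def Ls (Q : ℂ) (c s T : ℤ) : ℂ := (-Q)^T * Lam (Q^8) (Q^(-1-4*c)) (-Q^(4*s+2+4*c))
noncomputable def LL (c : ℤ) (Q : ℂ) : ℂ := Ls Q c 0 0 + Ls Q c 1 (1+c) + Ls Q c 2 (3+2*c) + Ls Q c 3 (6+3*c)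

lemma inv_bound {q : ℂ} (hq : ‖q‖ ≤ 1/8) (h0 : q ≠ 0) (k : ℤ) (hk : k ≠ 0) : ‖(1 - q^k)⁻¹‖ ≤ 2 ∧ 1 - q^k ≠ 0 := by
  have aux : ∀ (m : ℕ), 0 < m → ‖q^(m:ℤ)‖ ≤ 1/8 ∧ (1/2:ℝ) ≤ ‖1 - q^(m:ℤ)‖ := by
    intro m hm
    obtain ⟨n, rfl⟩ : ∃ n, m = n+1 := ⟨m-1, by omega⟩
    have h1 := qpow_le' hq n
    rw [zpow_natCast]
    refine ⟨h1, ?_⟩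
    have h2 := norm_add_le (1 - q^(n+1)) (q^(n+1))
    rw [sub_add_cancel, norm_one] at h2
    linarith
  have aux2 : ∀ x : ℂ, (1/2:ℝ) ≤ ‖x‖ → ‖x⁻¹‖ ≤ 2 := by
    intro x hx
    rw [norm_inv]
    calc _ ≤ (1/2:ℝ)⁻¹ := inv_anti₀ (by norm_num) hx
      _ = 2 := by norm_num
  rcases lt_or_gt_of_ne hk with h | h
  · obtain ⟨m, rfl⟩ : ∃ m : ℕ, k = -(m:ℤ) := ⟨k.natAbs, by omega⟩
    obtain ⟨h1, h2⟩ := aux m (by omega)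
    have hz : q^(m:ℤ) ≠ 0 := zpow_ne_zero _ h0
    have hne : 1 - q^(m:ℤ) ≠ 0 := by
      intro h; rw [h] at h2; norm_num at h2
    have e : 1 - q^(-(m:ℤ)) = -((1 - q^(m:ℤ)) / q^(m:ℤ)) := by rw [zpow_neg]; field_simp; ring
    rw [e]
    refine ⟨?_, neg_ne_zero.mpr (div_ne_zero hne hz)⟩
    rw [inv_neg, norm_neg, inv_div, div_eq_mul_inv, norm_mul]
    have := aux2 _ h2
    nlinarith [norm_nonneg (q^(m:ℤ)), norm_nonneg ((1 - q^(m:ℤ))⁻¹)]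
  · obtain ⟨m, rfl⟩ : ∃ m : ℕ, k = (m:ℤ) := ⟨k.natAbs, by omega⟩
    obtain ⟨h1, h2⟩ := aux m (by omega)
    refine ⟨aux2 _ h2, ?_⟩
    intro h; rw [h] at h2; norm_num at h2

lemma R_summ {q : ℂ} (hq : ‖q‖ ≤ 1/8) (h0 : q ≠ 0) (c : ℤ) :
    Summable (fun a : ℤ => q^(2*a^2+2*a+4*c*a) / (1 - q^(16*a+4))) := by
  have h1 := (Ph_summ (p := q^(2:ℤ)) (u := q^(2+4*c)) (zpow_ne_zero _ h0) (zp_lt hq (by norm_num)) (zpow_ne_zero _ h0)).mul_right 2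
  refine Summable.of_norm_bounded h1 (fun a => ?_)
  rw [div_eq_mul_inv, norm_mul]
  refine mul_le_mul (le_of_eq ?_) (inv_bound hq h0 _ (by omega)).1 (norm_nonneg _) (norm_nonneg _)
  congr 1
  rw [← zpow_mul, ← zpow_mul, ← zpow_add₀ h0]; ring_nf

lemma R_eq {q Q : ℂ} (hq : ‖q‖ ≤ 1/8) (h0 : q ≠ 0) (hQ : q^4 = -Q) (c : ℤ) :
    ∑' a : ℤ, q^(2*a^2+2*a+4*c*a) / (1 - q^(16*a+4)) = LL c Q := by
  have hQ0 : Q ≠ 0 := by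
    rintro rfl; simp at hQ; exact h0 hQ
  have hq4 : ∀ E : ℤ, q^(4*E) = (-Q)^E := fun E => by
    rw [zpow_mul, ← hQ]; norm_cast
  have key : ∀ s T : ℤ, 4*T = 2*s^2+2*s+4*c*s → ∑' a : ℤ, q^(2*(4*a+s)^2+2*(4*a+s)+4*c*(4*a+s)) / (1 - q^(16*(4*a+s)+4)) = Ls Q c s T := by
    intro s T hT
    rw [Ls, Lam, ← tsum_mul_left]
    refine tsum_congr (fun a => ?_)
    have e1 : 2*(4*a+s)^2+2*(4*a+s)+4*c*(4*a+s) = 4*(T + (2*(4*a^2) + 2*(1*a) + (4*s+4*c)*a)) := by linear_combination -hT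
    have e2 : 16*(4*a+s)+4 = 4*(2*(2*(4*a)+2*s)+1) := by ring
    rw [e1, e2, hq4, hq4, zpow_add₀ (neg_ne_zero.mpr hQ0)]
    have s1 : ∀ E : ℤ, Even E → (-Q)^E = Q^E := fun E hE => hE.neg_zpow Q
    have s2 : (-Q)^(2*(2*(4*a)+2*s)+1) = -Q^(2*(2*(4*a)+2*s)+1) := (odd_two_mul_add_one _).neg_zpow Q
    have s3 : (-Q)^(2*(4*a^2) + 2*(1*a) + (4*s+4*c)*a) = Q^(8*a^2 + (4*s+2+4*c)*a) := by
      rw [s1 _ ⟨4*a^2+a+(2*s+2*c)*a, by ring⟩]; ring_nf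
    have s4 : ((-1:ℂ)^a) * (-1)^a = 1 := by rw [← mul_zpow]; simp
    have s5 : (Q^8)^(2*a) * (Q^(-1-4*c) * -Q^(4*s+2+4*c)) = -Q^(2*(2*(4*a)+2*s)+1) := by
      rw [mul_neg, mul_neg, ← zpow_add₀ hQ0, ← zpow_natCast, ← zpow_mul, ← zpow_add₀ hQ0]
      push_cast; ring_nf
    rw [s2, s3, s5, neg_eq_neg_one_mul (Q^(4*s+2+4*c)), mul_zpow, ← zpow_natCast, ← zpow_mul, ← zpow_mul, zpow_add₀ hQ0]
    push_cast
    linear_combination (-(-Q)^T * (Q^(8*a^2) * Q^((4*s+2+4*c)*a) / (1 - -Q^(2*(2*(4*a)+2*s)+1)))) * s4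
  have k0 := key 0 0 (by ring)
  simp only [add_zero] at k0
  rw [par4 (R_summ hq h0 c), k0, key 1 (1+c) (by ring), key 2 (3+2*c) (by ring), key 3 (6+3*c) (by ring), LL]

lemma dis_one {q Q : ℂ} (hq : ‖q‖ ≤ 1/128) (h0 : q ≠ 0) (hQ : q^4 = -Q) :
    TM Q 2 1 * (VV 0 Q + q * VV 1 Q + q^2 * VV 2 Q + q^3 * VV 3 Q) =
      LL 0 Q + q * LL 1 Q + q^2 * LL 2 Q + q^3 * LL 3 Q := by
  have hq8 : ‖q‖ ≤ 1/8 := by linarith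
  have hQ0 : Q ≠ 0 := by
    rintro rfl; simp at hQ; exact h0 hQ
  rw [← UU_split hq8 hQ]
  have hd := step_d hq h0
  have h1 : TP q 2 2 = 2 * TM Q 2 1 := by
    rw [TP_split hq8 h0 (by norm_num)]
    norm_num
    have h2 := TP_shift h0 8 (-4)
    norm_num at h2
    rw [h2, TP_neg]
    have h3 : TP q 8 4 = TM Q 2 1 := by
      rw [TP_eq h0, TM_eq hQ0]
      refine tsum_congr (fun n => ?_)
      rw [show 8*n^2+4*n = 4*(2*n^2+1*n) by ring, zpow_mul]
      have : q^(4:ℤ) = -Q := by rw [← hQ]; norm_cast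
      rw [this, neg_eq_neg_one_mul, mul_zpow]
      congr 1
      rw [zpow_add₀ (by norm_num), zpow_mul]; norm_num
    rw [h3]
    have : q^(4:ℤ) ≠ 0 := zpow_ne_zero _ h0
    field_simp; norm_num
  rw [h1] at hd
  have hd2 : TM Q 2 1 * UU q = ∑' a : ℤ, q^(2*a^2+2*a) / (1 - q^(4*a+1)) := by linear_combination hd/2
  rw [hd2, ← R_eq hq8 h0 hQ 0, ← R_eq hq8 h0 hQ 1, ← R_eq hq8 h0 hQ 2, ← R_eq hq8 h0 hQ 3,
    ← tsum_mul_left, ← tsum_mul_left, ← tsum_mul_left,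
    ← (R_summ hq8 h0 0).tsum_add ((R_summ hq8 h0 1).mul_left q),
    ← ((R_summ hq8 h0 0).add ((R_summ hq8 h0 1).mul_left q)).tsum_add ((R_summ hq8 h0 2).mul_left (q^2)),
    ← (((R_summ hq8 h0 0).add ((R_summ hq8 h0 1).mul_left q)).add ((R_summ hq8 h0 2).mul_left (q^2))).tsum_add ((R_summ hq8 h0 3).mul_left (q^3))]
  refine tsum_congr (fun a => ?_)
  have n1 := (inv_bound hq8 h0 (4*a+1) (by omega)).2
  have n2 := (inv_bound hq8 h0 (16*a+4) (by omega)).2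
  have e2 : q^(16*a+4) = (q * q^(4*a))^4 := by
    rw [← zpow_one_add₀ h0, ← zpow_natCast, ← zpow_mul]; congr 1; push_cast; ring
  have e1 : q^(4*a+1) = q * q^(4*a) := by rw [← zpow_one_add₀ h0]; ring_nf
  have f1 : q^(2*a^2+2*a+4*0*a) = q^(2*a^2+2*a) := by ring_nf
  have f2 : q^(2*a^2+2*a+4*1*a) = q^(2*a^2+2*a) * q^(4*a) := by rw [← zpow_add₀ h0]; ring_nf
  have f3 : q^(2*a^2+2*a+4*2*a) = q^(2*a^2+2*a) * (q^(4*a) * q^(4*a)) := by rw [← zpow_add₀ h0, ← zpow_add₀ h0]; ring_nf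
  have f4 : q^(2*a^2+2*a+4*3*a) = q^(2*a^2+2*a) * (q^(4*a) * q^(4*a) * q^(4*a)) := by
    rw [← zpow_add₀ h0, ← zpow_add₀ h0, ← zpow_add₀ h0]; ring_nf
  rw [e1] at n1
  rw [e2] at n2
  rw [e1, e2, f1, f2, f3, f4]
  generalize q^(4*a) = z at *
  generalize q^(2*a^2+2*a) = y at *
  have n2' : 1 - q^4 * z^4 ≠ 0 := by rw [← mul_pow]; exact n2
  rw [mul_pow, div_eq_iff n1]
  field_simp
  ring

lemma exists_root {Q : ℂ} (hQ : ‖Q‖ ≤ (1/128)^4) : ∃ q : ℂ, q^4 = -Q ∧ ‖q‖ ≤ 1/128 := by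
  obtain ⟨q, hq⟩ := IsAlgClosed.exists_pow_nat_eq (-Q) (n := 4) (by norm_num)
  refine ⟨q, hq, ?_⟩
  have : ‖q‖^4 ≤ (1/128)^4 := by rw [← norm_pow, hq, norm_neg]; exact hQ
  exact le_of_pow_le_pow_left₀ (by norm_num) (by norm_num) this

lemma dissect {Q : ℂ} (hQ : ‖Q‖ ≤ (1/128)^4) (hQ0 : Q ≠ 0) :
    TM Q 2 1 * VV 0 Q = LL 0 Q ∧ TM Q 2 1 * VV 1 Q = LL 1 Q ∧ TM Q 2 1 * VV 2 Q = LL 2 Q ∧ TM Q 2 1 * VV 3 Q = LL 3 Q := by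
  obtain ⟨q, hq, hn⟩ := exists_root hQ
  have h0 : q ≠ 0 := by
    rintro rfl; apply hQ0; simpa using hq.symm
  have hI : I^2 = -1 := I_sq
  have a1 := dis_one hn h0 hq
  have a2 := dis_one (q := -q) (by simpa using hn) (by simpa using h0) (by rw [← hq]; ring)
  have a3 := dis_one (q := I*q) (by simpa using hn) (by simp [h0]) (by
    rw [← hq]; linear_combination (q^4 * (I^2 - 1)) * hI)
  have a4 := dis_one (q := -(I*q)) (by simpa using hn) (by simp [h0]) (by
    rw [← hq]; linear_combination (q^4 * (I^2 - 1)) * hI)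
  have hI3 : I^3 = -I := by linear_combination I * hI
  simp only [neg_pow (I*q), mul_pow, hI, hI3] at a3 a4
  refine ⟨?_, ?_, ?_, ?_⟩
  · linear_combination (a1 + a2 + a3 + a4)/4
  · apply mul_left_cancel₀ h0
    linear_combination (a1 - a2 - I*a3 + I*a4)/4 + (q * VV 1 Q * TM Q 2 1 / 2 - q * LL 1 Q / 2 - q^3 * VV 3 Q * TM Q 2 1/2 + q^3 * LL 3 Q/2) * hI
  · apply mul_left_cancel₀ (pow_ne_zero 2 h0)
    linear_combination (a1 + a2 - a3 - a4)/4
  · apply mul_left_cancel₀ (pow_ne_zero 3 h0)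
    linear_combination (a1 - a2 + I*a3 - I*a4)/4 + (-q * VV 1 Q * TM Q 2 1 / 2 + q * LL 1 Q / 2 + q^3 * VV 3 Q * TM Q 2 1/2 - q^3 * LL 3 Q/2) * hI

end M2

namespace M2
open Complex

noncomputable def KK (Q : ℂ) (a b : ℤ) : ℂ := ∑' n : ℤ, Q^(a*n) / (1 - Q^(16*n+b))
noncomputable def LA (Q : ℂ) (k : ℤ) : ℂ := ∑' r : ℤ, (-1)^r * Q^(8*r^2+k*r) / (1 - Q^(16*r+4))

lemma Y_red {Q : ℂ} (h0 : Q ≠ 0) (a i j : ℤ) (h : i + j = 2*a) : TP Q a i = Q^(a-i) * TP Q a j := by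
  have := TP_shift h0 a (-j)
  rw [show -j + 2*a = i by linarith, TP_neg] at this
  rw [this]; congr 2; linarith

lemma J_prod {Q : ℂ} (hQ : ‖Q‖ ≤ 1/8) (h0 : Q ≠ 0) (k l : ℤ) :
    TM Q 8 (8-k) * TM Q 8 (8-l) = TP Q 16 (16-k-l) * TP Q 16 (l-k) - Q^k * (TP Q 16 (k+l) * TP Q 16 (16-(l-k))) := by
  have := TMTM hQ h0 (a := 8) (by norm_num) (k-8) (l-8)
  rw [← TM_neg Q 8 (8-k), ← TM_neg Q 8 (8-l), neg_sub, neg_sub, this, ← TP_neg Q _ (k-8+(l-8)), ← TP_neg Q _ (k-8-(l-8))]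
  ring_nf

lemma B_prod {Q : ℂ} (hQ : ‖Q‖ ≤ 1/8) (h0 : Q ≠ 0) (k l : ℤ) :
    TP Q 8 (8-k) * TP Q 8 (8-l) = TP Q 16 (16-k-l) * TP Q 16 (l-k) + Q^k * (TP Q 16 (k+l) * TP Q 16 (16-(l-k))) := by
  have := TPTP hQ h0 (a := 8) (by norm_num) (k-8) (l-8)
  rw [← TP_neg Q 8 (8-k), ← TP_neg Q 8 (8-l), neg_sub, neg_sub, this, ← TP_neg Q _ (k-8+(l-8)), ← TP_neg Q _ (k-8-(l-8))]
  ring_nf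

lemma quart {Q : ℂ} (hQ : ‖Q‖ ≤ 1/8) (h0 : Q ≠ 0) :
    (TM Q 8 5)^2 * TM Q 8 3 * TM Q 8 1 - Q^2 * (TM Q 8 7)^2 * TM Q 8 5 * TM Q 8 1 = TM Q 8 6 * TM Q 8 4 * (TM Q 8 2)^2 ∧
    (TM Q 8 1)^2 * TM Q 8 7 * TM Q 8 3 + Q * TM Q 8 5 * (TM Q 8 3)^2 * TM Q 8 7 = TM Q 8 6 * TM Q 8 4 * (TM Q 8 2)^2 ∧
    (TM Q 8 3)^2 * TM Q 8 7 * TM Q 8 5 + Q * (TM Q 8 7)^2 * TM Q 8 5 * TM Q 8 1 = (TM Q 8 6)^2 * TM Q 8 4 * TM Q 8 2 ∧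
    (TP Q 8 5)^2 * TP Q 8 3 * TP Q 8 1 - Q^2 * (TP Q 8 7)^2 * TP Q 8 5 * TP Q 8 1 = TM Q 8 6 * TM Q 8 4 * (TM Q 8 2)^2 ∧
    (TP Q 8 1)^2 * TP Q 8 7 * TP Q 8 3 - Q * TP Q 8 5 * (TP Q 8 3)^2 * TP Q 8 7 = TM Q 8 6 * TM Q 8 4 * (TM Q 8 2)^2 ∧
    (TP Q 8 3)^2 * TP Q 8 7 * TP Q 8 5 - Q * (TP Q 8 7)^2 * TP Q 8 5 * TP Q 8 1 = (TM Q 8 6)^2 * TM Q 8 4 * TM Q 8 2 ∧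
    (TP Q 8 2 + Q * TP Q 8 6) * (TM Q 8 7 * TM Q 8 5 * TM Q 8 3 * TM Q 8 1) = (TP Q 8 2 - Q * TP Q 8 6) * (TP Q 8 7 * TP Q 8 5 * TP Q 8 3 * TP Q 8 1) := by
  have j35 := J_prod hQ h0 3 5
  have j37 := J_prod hQ h0 3 7
  have j13 := J_prod hQ h0 1 3
  have j17 := J_prod hQ h0 1 7
  have j26 := J_prod hQ h0 2 6
  have j46 := J_prod hQ h0 4 6
  have j57 := J_prod hQ h0 5 7
  have j15 := J_prod hQ h0 1 5
  have j24 := J_prod hQ h0 2 4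
  have b35 := B_prod hQ h0 3 5
  have b37 := B_prod hQ h0 3 7
  have b13 := B_prod hQ h0 1 3
  have b17 := B_prod hQ h0 1 7
  have b57 := B_prod hQ h0 5 7
  have b15 := B_prod hQ h0 1 5
  have s3 := TM_split hQ h0 (a := 4) (by norm_num) 3
  have s1 := TM_split hQ h0 (a := 4) (by norm_num) 1
  have r3 := TP_split hQ h0 (a := 4) (by norm_num) 3
  have r1 := TP_split hQ h0 (a := 4) (by norm_num) 1
  have y22 := Y_red h0 16 22 10 (by norm_num)
  have y18 := Y_red h0 16 18 14 (by norm_num)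
  have p := TMTM hQ h0 (a := 4) (by norm_num) 3 1
  have p' := TPTP hQ h0 (a := 4) (by norm_num) 3 1
  have y12 := Y_red h0 8 12 4 (by norm_num)
  have y10 := Y_red h0 8 10 6 (by norm_num)
  norm_num at j35 j37 j13 j17 j26 j46 j57 j15 j24 b35 b37 b13 b17 b57 b15 s3 s1 r3 r1 y22 y18 p p' y12 y10
  norm_cast at j35 j37 j13 j17 j26 j46 j57 j15 j24 b35 b37 b13 b17 b57 b15 s3 s1 r3 r1
  have q7 : Q^7 ≠ 0 := pow_ne_zero _ h0
  have q5 : Q^5 ≠ 0 := pow_ne_zero _ h0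
  have s3' : TM Q 4 3 = TP Q 16 6 - Q * TP Q 16 10 := by
    rw [s3, y22]; field_simp
  have r3' : TP Q 4 3 = TP Q 16 6 + Q * TP Q 16 10 := by
    rw [r3, y22]; field_simp
  have s1' : TM Q 4 1 = TP Q 16 2 - Q^3 * TP Q 16 14 := by
    rw [s1, y18]; field_simp
  have r1' : TP Q 4 1 = TP Q 16 2 + Q^3 * TP Q 16 14 := by
    rw [r1, y18]; field_simp
  have pp : TM Q 4 3 * TM Q 4 1 = TP Q 8 4 * (TP Q 8 2 - Q * TP Q 8 6) := by
    rw [p, y12, y10]; field_simp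
  have pp' : TP Q 4 3 * TP Q 4 1 = TP Q 8 4 * (TP Q 8 2 + Q * TP Q 8 6) := by
    rw [p', y12, y10]; field_simp
  refine ⟨?_, ?_, ?_, ?_, ?_, ?_, ?_⟩
  · calc _ = (TM Q 8 5 * TM Q 8 3) * (TM Q 8 5 * TM Q 8 1) - Q^2 * (TM Q 8 7 * TM Q 8 5) * (TM Q 8 7 * TM Q 8 1) := by ring
      _ = (TM Q 8 6 * TM Q 8 2) * (TM Q 8 4 * TM Q 8 2) := by rw [j35, j37, j13, j17, j26, j46]; ring
      _ = _ := by ring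
  · calc _ = (TM Q 8 7 * TM Q 8 1) * (TM Q 8 3 * TM Q 8 1) + Q * (TM Q 8 5 * TM Q 8 3) * (TM Q 8 7 * TM Q 8 3) := by ring
      _ = (TM Q 8 6 * TM Q 8 2) * (TM Q 8 4 * TM Q 8 2) := by rw [j17, j57, j35, j15, j26, j46]; ring
      _ = _ := by ring
  · calc _ = (TM Q 8 5 * TM Q 8 3) * (TM Q 8 7 * TM Q 8 3) + Q * (TM Q 8 7 * TM Q 8 1) * (TM Q 8 7 * TM Q 8 5) := by ring
      _ = (TM Q 8 6 * TM Q 8 2) * (TM Q 8 6 * TM Q 8 4) := by rw [j17, j13, j35, j15, j26, j24]; ring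
      _ = _ := by ring
  · calc _ = (TP Q 8 5 * TP Q 8 3) * (TP Q 8 5 * TP Q 8 1) - Q^2 * (TP Q 8 7 * TP Q 8 5) * (TP Q 8 7 * TP Q 8 1) := by ring
      _ = (TM Q 8 6 * TM Q 8 2) * (TM Q 8 4 * TM Q 8 2) := by rw [b35, b37, b13, b17, j26, j46]; ring
      _ = _ := by ring
  · calc _ = (TP Q 8 7 * TP Q 8 1) * (TP Q 8 3 * TP Q 8 1) - Q * (TP Q 8 5 * TP Q 8 3) * (TP Q 8 7 * TP Q 8 3) := by ring
      _ = (TM Q 8 6 * TM Q 8 2) * (TM Q 8 4 * TM Q 8 2) := by rw [b17, b57, b35, b15, j26, j46]; ring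
      _ = _ := by ring
  · calc _ = (TP Q 8 5 * TP Q 8 3) * (TP Q 8 7 * TP Q 8 3) - Q * (TP Q 8 7 * TP Q 8 1) * (TP Q 8 7 * TP Q 8 5) := by ring
      _ = (TM Q 8 6 * TM Q 8 2) * (TM Q 8 6 * TM Q 8 4) := by rw [b17, b13, b35, b15, j26, j24]; ring
      _ = _ := by ring
  · apply mul_left_cancel₀ (TP_ne hQ h0 (a := 8) (b := 4) (by norm_num))
    have a1 : TM Q 8 7 * TM Q 8 1 = TP Q 16 8 * TM Q 4 3 := by rw [j17, s3']; ring
    have a2 : TM Q 8 5 * TM Q 8 3 = TP Q 16 8 * TM Q 4 1 := by rw [j35, s1']; ring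
    have a3 : TP Q 8 7 * TP Q 8 1 = TP Q 16 8 * TP Q 4 3 := by rw [b17, r3']; ring
    have a4 : TP Q 8 5 * TP Q 8 3 = TP Q 16 8 * TP Q 4 1 := by rw [b35, r1']; ring
    calc _ = (TP Q 8 4 * (TP Q 8 2 + Q * TP Q 8 6)) * ((TM Q 8 7 * TM Q 8 1) * (TM Q 8 5 * TM Q 8 3)) := by ring
      _ = (TP Q 8 4 * (TP Q 8 2 - Q * TP Q 8 6)) * ((TP Q 8 7 * TP Q 8 1) * (TP Q 8 5 * TP Q 8 3)) := by
        rw [← pp, ← pp', a1, a2, a3, a4]; ring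
      _ = _ := by ring

lemma psi_split {Q : ℂ} (hQ : ‖Q‖ ≤ 1/8) (h0 : Q ≠ 0) : TM Q 2 1 = TP Q 8 2 - Q * TP Q 8 6 := by
  have s := TM_split hQ h0 (a := 2) (by norm_num) 1
  have y10 := Y_red h0 8 10 6 (by norm_num)
  norm_num at s y10
  rw [s, y10]; field_simp

lemma ap_s {Q : ℂ} (hQ : ‖Q‖ ≤ 1/8) (h0 : Q ≠ 0) (c s : ℤ) :
    (Lam (Q^8) (Q^(-1-4*c)) (-Q^(4*s+2+4*c)) * TM Q 8 (5+4*c) - LA Q (5+4*c) * TP Q 8 (4*s+2+4*c)) *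
      (TM Q 8 4 * TP Q 8 (4*s-7)) = -(Q^4 * CC (Q^8) * TP Q 8 (4*s+6+4*c) * TP Q 8 (4*s-11)) := by
  have hp0 : Q^8 ≠ 0 := pow_ne_zero _ h0
  have hp1 : ‖Q^8‖ < 1 := by
    have := zp_lt hQ (a := 8) (by norm_num)
    exact_mod_cast this
  have z8 : Q^8 = Q^(8:ℤ) := by norm_cast
  have z2 : ∀ r : ℤ, (Q^8)^(2*r) = Q^(16*r) := fun r => by rw [z8, ← zpow_mul]; ring_nf
  have hu : Q^(-1-4*c) * Q^(5+4*c) = Q^(4:ℤ) := by rw [← zpow_add₀ h0]; ring_nf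
  have hu1 : Q^(-1-4*c) * -Q^(4*s+2+4*c) = -Q^(4*s+1) := by rw [mul_neg, ← zpow_add₀ h0]; ring_nf
  have key := appell_diff (p := Q^8) (x := Q^(-1-4*c)) (u0 := Q^(5+4*c)) (u1 := -Q^(4*s+2+4*c)) hp0 hp1
    (zpow_ne_zero _ h0) (zpow_ne_zero _ h0) (neg_ne_zero.mpr (zpow_ne_zero _ h0))
    (fun r => by
      rw [hu, z2, ← zpow_add₀ h0]
      exact (inv_bound hQ h0 _ (by omega)).2)
    (fun r => by
      rw [hu1, z2, mul_neg, ← zpow_add₀ h0, sub_neg_eq_add]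
      have := (inv_bound hQ h0 (2*(16*r+(4*s+1))) (by omega)).2
      intro hh
      apply this
      rw [two_mul, zpow_add₀ h0]
      linear_combination (1 - Q^(16*r+(4*s+1))) * hh)
  have hL : Lam (Q^8) (Q^(-1-4*c)) (Q^(5+4*c)) = LA Q (5+4*c) := by
    rw [Lam, LA]
    refine tsum_congr (fun r => ?_)
    rw [hu, z2, ← zpow_add₀ h0, z8, ← zpow_mul, ← zpow_mul, mul_assoc, ← zpow_add₀ h0]
  have e1 : Ph (Q^8) (-Q^(5+4*c)) = TM Q 8 (5+4*c) := by rw [TM, z8]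
  have e2 : Ph (Q^8) (- -Q^(4*s+2+4*c)) = TP Q 8 (4*s+2+4*c) := by rw [TP, z8, neg_neg]
  have e3 : jj (Q^8) (Q^(4:ℤ)) = TM Q 8 4 := by
    rw [← TM_neg, TM, jj, z8, ← zpow_sub₀ h0]; norm_num
  have e4 : jj (Q^8) (-Q^(4*s+1)) = TP Q 8 (4*s-7) := by
    rw [TP, jj, z8, neg_div, neg_neg, ← zpow_sub₀ h0]; ring_nf
  have e5 : Ph (Q^8) (-(Q^(4:ℤ) * -Q^(4*s+2+4*c))) = TP Q 8 (4*s+6+4*c) := by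
    rw [TP, z8, mul_neg, neg_neg, ← zpow_add₀ h0]; ring_nf
  have e6 : jj (Q^8) (-Q^(4*s+2+4*c) / Q^(5+4*c)) = TP Q 8 (4*s-11) := by
    rw [TP, jj, z8, neg_div, neg_div, neg_neg, ← zpow_sub₀ h0, ← zpow_sub₀ h0]; ring_nf
  rw [hu, hu1, hL, e1, e2, e3, e4, e5, e6] at key
  rw [key]; norm_cast

lemma KK_eq {Q : ℂ} (hQ : ‖Q‖ ≤ 1/8) (h0 : Q ≠ 0) (a b : ℤ) (ha : 0 < a) (ha' : a < 16) (hb : ¬ (16:ℤ) ∣ b) :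
    KK Q a b * (TM Q 8 (8-a) * TM Q 8 (8-b)) = CC (Q^8) * TM Q 8 (8-a-b) := by
  have hp0 : Q^8 ≠ 0 := pow_ne_zero _ h0
  have hp1 : ‖Q^8‖ < 1 := by
    have := zp_lt hQ (a := 8) (by norm_num)
    exact_mod_cast this
  have z8 : Q^8 = Q^(8:ℤ) := by norm_cast
  have z2 : ∀ r : ℤ, (Q^8)^(2*r) = Q^(16*r) := fun r => by rw [z8, ← zpow_mul]; ring_nf
  have e : ∀ k : ℤ, jj (Q^8) (Q^k) = TM Q 8 (8-k) := fun k => by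
    rw [← TM_neg, TM, jj, z8, ← zpow_sub₀ h0]; ring_nf
  have key := kron (p := Q^8) (a := Q^a) (b := Q^b) hp0 hp1 (zpow_ne_zero _ h0) (zp_lt hQ ha)
    (by
      have hn : 0 < ‖Q‖ := norm_pos_iff.mpr h0
      rw [norm_pow, norm_zpow, ← pow_mul, ← zpow_natCast]
      refine zpow_lt_zpow_right_of_lt_one₀ hn (by linarith) ?_
      push_cast; omega)
    (zpow_ne_zero _ h0)
    (fun r => by
      rw [z2, ← zpow_add₀ h0]
      exact (inv_bound hQ h0 _ (by omega)).2)
  rw [e, e, ← zpow_add₀ h0, e] at key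
  rw [KK, show (8:ℤ) - a - b = 8 - (a+b) by ring, ← key]
  congr 1
  refine tsum_congr (fun n => ?_)
  rw [z2, ← zpow_add₀ h0, ← zpow_mul]

end M2

namespace M2
open Complex

lemma ap_s2 {Q : ℂ} (hQ : ‖Q‖ ≤ 1/8) (h0 : Q ≠ 0) (c s : ℤ) (h : |4*s-7| < 8) :
    Lam (Q^8) (Q^(-1-4*c)) (-Q^(4*s+2+4*c)) * TM Q 8 (5+4*c) = LA Q (5+4*c) * TP Q 8 (4*s+2+4*c) -
      Q^4 * (CC (Q^8) / TM Q 8 4) * TP Q 8 (4*s+6+4*c) * (TP Q 8 (4*s-11) / TP Q 8 (4*s-7)) := by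
  have n1 := TM_ne hQ h0 (a := 8) (b := 4) (by norm_num)
  have n2 := TP_ne hQ h0 h
  have := ap_s hQ h0 c s
  field_simp
  linear_combination this

lemma ratios {Q : ℂ} (hQ : ‖Q‖ ≤ 1/8) (h0 : Q ≠ 0) : ∃ wb wb2 w w2 : ℂ,
    TP Q 8 5 / TP Q 8 7 - Q^2 * (TP Q 8 7 / TP Q 8 3) = wb ∧
    TP Q 8 1 / TP Q 8 5 - Q * (TP Q 8 3 / TP Q 8 1) = wb ∧
    TP Q 8 3 / TP Q 8 1 - Q * (TP Q 8 7 / TP Q 8 3) = wb2 ∧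
    (TP Q 8 2 + Q * TP Q 8 6) * wb = TM Q 2 1 * w ∧
    (TP Q 8 2 + Q * TP Q 8 6) * wb2 = TM Q 2 1 * w2 ∧
    TM Q 8 5 / TM Q 8 7 - Q^2 * (TM Q 8 7 / TM Q 8 3) = w ∧
    TM Q 8 1 / TM Q 8 5 + Q * (TM Q 8 3 / TM Q 8 1) = w ∧
    TM Q 8 3 / TM Q 8 1 + Q * (TM Q 8 7 / TM Q 8 3) = w2 := by
  obtain ⟨h1, h2, h3, h4, h5, h6, h7⟩ := quart hQ h0
  rw [psi_split hQ h0]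
  have m1 := TM_ne hQ h0 (a := 8) (b := 1) (by norm_num)
  have m3 := TM_ne hQ h0 (a := 8) (b := 3) (by norm_num)
  have m5 := TM_ne hQ h0 (a := 8) (b := 5) (by norm_num)
  have m7 := TM_ne hQ h0 (a := 8) (b := 7) (by norm_num)
  have p1 := TP_ne hQ h0 (a := 8) (b := 1) (by norm_num)
  have p3 := TP_ne hQ h0 (a := 8) (b := 3) (by norm_num)
  have p5 := TP_ne hQ h0 (a := 8) (b := 5) (by norm_num)
  have p7 := TP_ne hQ h0 (a := 8) (b := 7) (by norm_num)
  generalize TM Q 8 1 = xm1 at *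
  generalize TM Q 8 3 = xm3 at *
  generalize TM Q 8 5 = xm5 at *
  generalize TM Q 8 7 = xm7 at *
  generalize TP Q 8 1 = xp1 at *
  generalize TP Q 8 3 = xp3 at *
  generalize TP Q 8 5 = xp5 at *
  generalize TP Q 8 7 = xp7 at *
  generalize TM Q 8 6 * TM Q 8 4 * (TM Q 8 2)^2 = N at *
  generalize (TM Q 8 6)^2 * TM Q 8 4 * TM Q 8 2 = N2 at *
  refine ⟨N/(xp7*xp5*xp3*xp1), N2/(xp7*xp5*xp3*xp1), N/(xm7*xm5*xm3*xm1), N2/(xm7*xm5*xm3*xm1), ?_, ?_, ?_, ?_, ?_, ?_, ?_, ?_⟩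
  · rw [← h4]; field_simp
  · rw [← h5]; field_simp
  · rw [← h6]; field_simp
  · field_simp; linear_combination N * h7
  · field_simp; linear_combination N2 * h7
  · rw [← h1]; field_simp
  · rw [← h2]; field_simp
  · rw [← h3]; field_simp

lemma TM_red {Q : ℂ} (h0 : Q ≠ 0) (a i j : ℤ) (h : i + j = 2*a) : TM Q a i = -Q^(a-i) * TM Q a j := by
  have := TM_shift h0 a (-j)
  rw [show -j + 2*a = i by linarith, TM_neg] at this
  rw [this]; congr 3; linarith

lemma KKs {Q : ℂ} (hQ : ‖Q‖ ≤ 1/8) (h0 : Q ≠ 0) :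
    KK Q 1 12 = CC (Q^8) / TM Q 8 4 * (TM Q 8 5 / TM Q 8 7) ∧
    Q * KK Q 5 12 = -(CC (Q^8) / TM Q 8 4 * (TM Q 8 7 / TM Q 8 3)) ∧
    KK Q 3 4 = CC (Q^8) / TM Q 8 4 * (TM Q 8 1 / TM Q 8 5) ∧
    KK Q 7 4 = CC (Q^8) / TM Q 8 4 * (TM Q 8 3 / TM Q 8 1) := by
  have m1 := TM_ne hQ h0 (a := 8) (b := 1) (by norm_num)
  have m3 := TM_ne hQ h0 (a := 8) (b := 3) (by norm_num)
  have m4 := TM_ne hQ h0 (a := 8) (b := 4) (by norm_num)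
  have m5 := TM_ne hQ h0 (a := 8) (b := 5) (by norm_num)
  have m7 := TM_ne hQ h0 (a := 8) (b := 7) (by norm_num)
  have k1 := KK_eq hQ h0 1 12 (by norm_num) (by norm_num) (by norm_num)
  have k2 := KK_eq hQ h0 5 12 (by norm_num) (by norm_num) (by norm_num)
  have k3 := KK_eq hQ h0 3 4 (by norm_num) (by norm_num) (by norm_num)
  have k4 := KK_eq hQ h0 7 4 (by norm_num) (by norm_num) (by norm_num)
  have r := TM_red h0 8 9 7 (by norm_num)
  norm_num [TM_neg] at k1 k2 k3 k4 r
  rw [r] at k2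
  refine ⟨?_, ?_, ?_, ?_⟩
  · field_simp; linear_combination k1
  · field_simp; field_simp at k2; linear_combination k2
  · field_simp; linear_combination k3
  · field_simp; linear_combination k4

lemma Vforms {Q : ℂ} (hQ' : ‖Q‖ ≤ (1/128)^4) (h0 : Q ≠ 0) :
    -(VV 0 Q * TM Q 8 5) = KK Q 1 12 + Q^3 * KK Q 5 12 - 2 * LA Q 5 ∧
    VV 1 Q * TM Q 8 7 = Q^2 * KK Q 5 12 - KK Q 7 4 + 2 * LA Q 9 ∧
    VV 2 Q * TM Q 8 3 = KK Q 3 4 + Q * KK Q 7 4 + 2 * Q^2 * LA Q 13 ∧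
    -(VV 3 Q * TM Q 8 1) = Q * KK Q 7 4 - Q^3 * KK Q 5 12 + 2 * Q^3 * LA Q 17 := by
  have hQ : ‖Q‖ ≤ 1/8 := hQ'.trans (by norm_num)
  obtain ⟨d0, d1, d2, d3⟩ := dissect hQ' h0
  obtain ⟨k1, k2, k3, k4⟩ := KKs hQ h0
  obtain ⟨wb, wb2, w, w2, h1, h2, h3, h4, h5, h6, h7, h8⟩ := ratios hQ h0
  have hps := psi_split hQ h0
  have nps := TM_ne hQ h0 (a := 2) (b := 1) (by norm_num)
  have y10 := Y_red h0 8 10 6 (by norm_num)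
  have y14 := Y_red h0 8 14 2 (by norm_num)
  have y18 := Y_red h0 8 18 (-2) (by norm_num)
  have y22 := Y_red h0 8 22 (-6) (by norm_num)
  have y26 := Y_red h0 8 26 (-10) (by norm_num)
  have y30 := Y_red h0 8 30 (-14) (by norm_num)
  have y11 := Y_red h0 8 11 5 (by norm_num)
  have x9 := TM_red h0 8 9 7 (by norm_num)
  have x13 := TM_red h0 8 13 3 (by norm_num)
  have x17 := TM_red h0 8 17 (-1) (by norm_num)
  rw [TP_neg, y10] at y26
  rw [TP_neg, y14] at y30
  have D : ∀ c, TM Q 2 1 * VV c Q = LL c Q → True := fun _ _ => trivial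
  simp only [LL, Ls] at d0 d1 d2 d3
  have f := fun c => ap_s2 hQ h0 c 0 (by norm_num)
  have g := fun c => ap_s2 hQ h0 c 1 (by norm_num)
  have p := fun c => ap_s2 hQ h0 c 2 (by norm_num)
  have t := fun c => ap_s2 hQ h0 c 3 (by norm_num)
  have f0 := f 0; have f1 := f 1; have f2 := f 2; have f3 := f 3
  have g0 := g 0; have g1 := g 1; have g2 := g 2; have g3 := g 3
  have p0 := p 0; have p1 := p 1; have p2 := p 2; have p3 := p 3
  have t0 := t 0; have t1 := t 1; have t2 := t 2; have t3 := t 3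
  clear f g p t D
  norm_num [TP_neg, TM_neg] at d0 d1 d2 d3 f0 f1 f2 f3 g0 g1 g2 g3 p0 p1 p2 p3 t0 t1 t2 t3 y10 y14 y18 y22 y26 y30 y11 x9 x13 x17
  simp only [y10, y14, y18, y22, y26, y30, y11, x9, x13, x17] at f0 f1 f2 f3 g0 g1 g2 g3 p0 p1 p2 p3 t0 t1 t2 t3
  clear y10 y14 y18 y22 y26 y30 y11 x9 x13 x17
  simp only [mul_div_assoc] at f0 f1 f2 f3
  generalize TM Q 8 5 / TM Q 8 7 = S1 at *
  generalize TM Q 8 7 / TM Q 8 3 = S2 at *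
  generalize TM Q 8 1 / TM Q 8 5 = S3 at *
  generalize TM Q 8 3 / TM Q 8 1 = S4 at *
  generalize TP Q 8 5 / TP Q 8 7 = R1 at *
  generalize TP Q 8 7 / TP Q 8 3 = R2 at *
  generalize TP Q 8 3 / TP Q 8 1 = R3 at *
  generalize TP Q 8 1 / TP Q 8 5 = R4 at *
  generalize CC (Q^8) / TM Q 8 4 = E at *
  generalize Lam (Q ^ 8) Q⁻¹ (-Q ^ 2) = F0 at *
  generalize Lam (Q ^ 8) Q⁻¹ (-Q ^ 6) = G0 at *
  generalize Lam (Q ^ 8) Q⁻¹ (-Q ^ 10) = P0 at *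
  generalize Lam (Q ^ 8) Q⁻¹ (-Q ^ 14) = T0 at *
  generalize Lam (Q ^ 8) (Q^5)⁻¹ (-Q ^ 6) = F1 at *
  generalize Lam (Q ^ 8) (Q^5)⁻¹ (-Q ^ 10) = G1 at *
  generalize Lam (Q ^ 8) (Q^5)⁻¹ (-Q ^ 14) = P1 at *
  generalize Lam (Q ^ 8) (Q^5)⁻¹ (-Q ^ 18) = T1 at *
  generalize Lam (Q ^ 8) (Q^9)⁻¹ (-Q ^ 10) = F2 at *
  generalize Lam (Q ^ 8) (Q^9)⁻¹ (-Q ^ 14) = G2 at *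
  generalize Lam (Q ^ 8) (Q^9)⁻¹ (-Q ^ 18) = P2 at *
  generalize Lam (Q ^ 8) (Q^9)⁻¹ (-Q ^ 22) = T2 at *
  generalize Lam (Q ^ 8) (Q^13)⁻¹ (-Q ^ 14) = F3 at *
  generalize Lam (Q ^ 8) (Q^13)⁻¹ (-Q ^ 18) = G3 at *
  generalize Lam (Q ^ 8) (Q^13)⁻¹ (-Q ^ 22) = P3 at *
  generalize Lam (Q ^ 8) (Q^13)⁻¹ (-Q ^ 26) = T3 at *
  field_simp at f0 f1 f2 f3 g0 g1 g2 g3 p0 p1 p2 p3 t0 t1 t2 t3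
  have e0 : TM Q 2 1 * (VV 0 Q * TM Q 8 5) = TM Q 2 1 * (2 * LA Q 5 - E * w) := by
    linear_combination TM Q 8 5 * d0 + f0 - Q * g0 - Q * p0 + t0 - 2 * LA Q 5 * hps - E * h4 - E * (Q * TP Q 8 6 * h1 + TP Q 8 2 * h2)
  have e1 : TM Q 2 1 * (VV 1 Q * TM Q 8 7) = TM Q 2 1 * (2 * LA Q 9 - E * w2) := by
    linear_combination TM Q 8 7 * d1 - f1 - Q * g1 + p1 + t1 - 2 * LA Q 9 * hps + E * TP Q 8 6 * (h1 - h2) - E * (Q * TP Q 8 6 + TP Q 8 2) * h3 - E * h5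
  have e2 : TM Q 2 1 * (VV 2 Q * TM Q 8 3) = TM Q 2 1 * (2 * Q^2 * LA Q 13 + E * w) := by
    linear_combination TM Q 8 3 * d2 - f2 + Q^2 * g2 + Q^2 * p2 - Q * t2 - 2 * Q^2 * LA Q 13 * hps + E * (TP Q 8 2 * h1 + Q * TP Q 8 6 * h2) + E * h4
  have e3 : TM Q 2 1 * (VV 3 Q * TM Q 8 1) = TM Q 2 1 * (-(2 * Q^3 * LA Q 17) - E * Q * w2) := by
    linear_combination TM Q 8 1 * d3 - f3 - Q^3 * g3 + Q^2 * p3 + t3 + 2 * Q^3 * LA Q 17 * hps + E * TP Q 8 2 * (h1 - h2) - E * Q * (TP Q 8 2 + Q * TP Q 8 6) * h3 - E * Q * h5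
  replace e0 := mul_left_cancel₀ nps e0
  replace e1 := mul_left_cancel₀ nps e1
  replace e2 := mul_left_cancel₀ nps e2
  replace e3 := mul_left_cancel₀ nps e3
  refine ⟨?_, ?_, ?_, ?_⟩
  · linear_combination -e0 - E * h6 - k1 - Q^2 * k2
  · linear_combination e1 + E * h8 - Q * k2 + k4
  · linear_combination e2 - E * h7 - k3 - Q * k4
  · linear_combination -e3 - E * Q * h8 + Q^2 * k2 - Q * k4

end M2

namespace M2
open Complex

noncomputable def PP (p : ℂ) (n : ℕ) : ℂ := ∏ i ∈ Finset.range n, (1 - p^(2*i+2))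

lemma PP_succ (p : ℂ) (n : ℕ) : PP p (n+1) = PP p n * (1 - p^(2*n+2)) := by
  rw [PP, PP, Finset.prod_range_succ]

lemma DD_step {p : ℂ} (hp : ‖p‖ ≤ 1/8) (h0 : p ≠ 0) (M : ℕ) (m : ℤ) :
    PP p (2*(M+1)) * DD p (M+1) m = PP p (2*M) * ((1 + p^(4*M+2)) * DD p M m + p^(2*(M:ℤ)+2-2*m) * DD p M (m-1)
      + p^(2*(M:ℤ)+2+2*m) * DD p M (m+1)) := by
  rw [show 2*(M+1) = 2*M+1+1 by ring, PP_succ, PP_succ]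
  simp only [DD]
  push_cast
  set x := invq p ((M:ℤ)+1-m) with hx
  set y := invq p ((M:ℤ)+1+m) with hy
  have x1 := invq_rec hp ((M:ℤ)+1-m)
  have y1 := invq_rec hp ((M:ℤ)+1+m)
  have x2 := invq_rec hp ((M:ℤ)-m)
  have y2 := invq_rec hp ((M:ℤ)+m)
  rw [show (M:ℤ)+1-m-1 = M-m by ring, ← hx] at x1
  rw [show (M:ℤ)+1+m-1 = M+m by ring, ← hy] at y1
  rw [show (M:ℤ)-(m-1) = M+1-m by ring, show (M:ℤ)+(m-1) = M+m-1 by ring, show (M:ℤ)-(m+1) = M-m-1 by ring,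
    show (M:ℤ)+(m+1) = M+1+m by ring, ← hx, ← hy, x2, y2, x1, y1]
  have ha : p^(2*((M:ℤ)-m)) = p^(2*((M:ℤ)+1-m)) / p^2 := by
    rw [eq_div_iff (by positivity), ← zpow_natCast, ← zpow_add₀ h0]; congr 1; push_cast; ring
  have hb : p^(2*((M:ℤ)+m)) = p^(2*((M:ℤ)+1+m)) / p^2 := by
    rw [eq_div_iff (by positivity), ← zpow_natCast, ← zpow_add₀ h0]; congr 1; push_cast; ring
  have hab : p^(2*(2*M+1)+2) = p^(2*((M:ℤ)+1-m)) * p^(2*((M:ℤ)+1+m)) := by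
    rw [← zpow_natCast, ← zpow_add₀ h0]; congr 1; push_cast; ring
  have hab2 : p^(2*(2*M)+2) = p^(2*((M:ℤ)+1-m)) * p^(2*((M:ℤ)+1+m)) / p^2 := by
    rw [eq_div_iff (by positivity), ← hab, ← pow_add]; congr 1
  rw [show 4*M+2 = 2*(2*M)+2 by ring, hab, hab2, ha, hb, show 2*(M:ℤ)+2-2*m = 2*((M:ℤ)+1-m) by ring,
    show 2*(M:ℤ)+2+2*m = 2*((M:ℤ)+1+m) by ring]
  generalize p^(2*((M:ℤ)+1-m)) = a
  generalize p^(2*((M:ℤ)+1+m)) = b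
  field_simp
  ring

lemma fJTP {p u : ℂ} (hp : ‖p‖ ≤ 1/8) (h0 : p ≠ 0) (hu : u ≠ 0) (M : ℕ) :
    ∏ i ∈ Finset.range M, ((1 + u * p^(2*i+1)) * (1 + u⁻¹ * p^(2*i+1))) =
      ∑' m : ℤ, p^(m^2) * u^m * (PP p (2*M) * DD p M m) := by
  induction M with
  | zero =>
    rw [tsum_eq_single 0]
    · simp [DD, invq_zero, PP]
    · intro m hm
      rw [DD_zero, mul_zero, mul_zero]; omega
  | succ M ih =>
    rw [Finset.prod_range_succ, ih]
    have e : ∀ m : ℤ, p^(m^2) * u^m * (PP p (2*(M+1)) * DD p (M+1) m) =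
        (1 + p^(4*M+2)) * (p^(m^2) * u^m * (PP p (2*M) * DD p M m)) +
        u * p^(2*M+1) * (p^((m-1)^2) * u^(m-1) * (PP p (2*M) * DD p M (m-1))) +
        u⁻¹ * p^(2*M+1) * (p^((m+1)^2) * u^(m+1) * (PP p (2*M) * DD p M (m+1))) := by
      intro m
      rw [DD_step hp h0]
      have e1 : p^(m^2) * u^m * p^(2*(M:ℤ)+2-2*m) = u * p^(2*M+1) * (p^((m-1)^2) * u^(m-1)) := by
        rw [zpow_sub_one₀ hu]
        have : p^(m^2) * p^(2*(M:ℤ)+2-2*m) = p^(2*M+1) * p^((m-1)^2) := by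
          rw [← zpow_natCast, ← zpow_add₀ h0, ← zpow_add₀ h0]; congr 1; push_cast; ring
        generalize u^m = w at *
        field_simp
        linear_combination w * this
      have e2 : p^(m^2) * u^m * p^(2*(M:ℤ)+2+2*m) = u⁻¹ * p^(2*M+1) * (p^((m+1)^2) * u^(m+1)) := by
        rw [zpow_add_one₀ hu]
        have : p^(m^2) * p^(2*(M:ℤ)+2+2*m) = p^(2*M+1) * p^((m+1)^2) := by
          rw [← zpow_natCast, ← zpow_add₀ h0, ← zpow_add₀ h0]; congr 1; push_cast; ring
        generalize u^m = w at *
        field_simp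
        linear_combination w * this
      linear_combination (PP p (2*M) * DD p M (m-1)) * e1 + (PP p (2*M) * DD p M (m+1)) * e2
    simp_rw [e]
    obtain ⟨f, hf⟩ : ∃ f : ℤ → ℂ, ∀ m, f m = p^(m^2) * u^m * (PP p (2*M) * DD p M m) := ⟨_, fun _ => rfl⟩
    simp_rw [← hf]
    have hs : Summable f := by
      have := summable_D p M (fun m => p^(m^2) * u^m * PP p (2*M))
      refine this.congr fun m => ?_
      rw [hf]; ring
    have hs1 : Summable (fun m => f (m-1)) := (Equiv.subRight (1:ℤ)).summable_iff.mpr hs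
    have hs2 : Summable (fun m => f (m+1)) := (Equiv.addRight (1:ℤ)).summable_iff.mpr hs
    have t1 : ∑' m, f (m-1) = ∑' m, f m := (Equiv.subRight (1:ℤ)).tsum_eq f
    have t2 : ∑' m, f (m+1) = ∑' m, f m := (Equiv.addRight (1:ℤ)).tsum_eq f
    rw [Summable.tsum_add ((hs.mul_left _).add (hs1.mul_left _)) (hs2.mul_left _),
      Summable.tsum_add (hs.mul_left _) (hs1.mul_left _), tsum_mul_left, tsum_mul_left, tsum_mul_left, t1, t2]
    have : p^(4*M+2) = p^(2*M+1) * p^(2*M+1) := by rw [← pow_add]; congr 1; ring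
    rw [this]
    field_simp
    ring

end M2

namespace M2
open Complex

lemma PP_norm {p : ℂ} (hp : ‖p‖ ≤ 1/8) (n : ℕ) : ‖PP p n‖ ≤ 2^n := by
  induction n with
  | zero => simp [PP]
  | succ n ih =>
    rw [PP_succ, norm_mul, pow_succ]
    refine mul_le_mul ih ?_ (norm_nonneg _) (pow_nonneg zero_le_two n)
    calc ‖1 - p^(2*n+2)‖ ≤ ‖(1:ℂ)‖ + ‖p^(2*n+2)‖ := norm_sub_le _ _
      _ ≤ 1 + 1 := by gcongr; simp; exact qpow_le hp _
      _ = 2 := by norm_num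

lemma PP_diff {p : ℂ} (hp : ‖p‖ ≤ 1/8) {l n : ℕ} (h : l ≤ n) : ‖PP p n - PP p l‖ ≤ 2^n * ‖p‖^l := by
  induction n, h using Nat.le_induction with
  | base => simp
  | succ n hn ih =>
    have e : PP p (n+1) - PP p l = (PP p n - PP p l) - PP p n * p^(2*n+2) := by rw [PP_succ]; ring
    rw [e]
    have h1 : ‖PP p n * p^(2*n+2)‖ ≤ 2^n * ‖p‖^l := by
      rw [norm_mul, norm_pow]
      have := PP_norm hp n
      have h2 : ‖p‖^(2*n+2) ≤ ‖p‖^l := pow_le_pow_of_le_one (norm_nonneg _) (by linarith) (by omega)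
      gcongr
    calc _ ≤ _ := norm_sub_le _ _
      _ ≤ 2^n * ‖p‖^l + 2^n * ‖p‖^l := add_le_add ih h1
      _ = _ := by rw [pow_succ]; ring

lemma invq_PP {p : ℂ} (hp : ‖p‖ ≤ 1/8) (n : ℕ) : invq p n * PP p n = 1 := by
  rw [invq, if_neg (by omega), PP, Int.toNat_natCast, ← Finset.prod_mul_distrib]
  apply Finset.prod_eq_one
  intro i _
  exact inv_mul_cancel₀ (one_sub_ne (qpow_le' hp _))

lemma PP_prod_diff {p : ℂ} (hp : ‖p‖ ≤ 1/8) {l a b K : ℕ} (ha : l ≤ a) (hb : l ≤ b) (haK : a ≤ K) (hbK : b ≤ K) :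
    ‖PP p a * PP p b - PP p l * PP p l‖ ≤ 2 * 4^K * ‖p‖^l := by
  have e : PP p a * PP p b - PP p l * PP p l = (PP p a - PP p l) * PP p b + PP p l * (PP p b - PP p l) := by ring
  rw [e]
  have m : ∀ {x}, x ≤ K → (2:ℝ)^x ≤ 2^K := fun h => pow_le_pow_right₀ (by norm_num) h
  have h1 := (PP_diff hp ha).trans (mul_le_mul_of_nonneg_right (m haK) (by positivity))
  have h2 := (PP_diff hp hb).trans (mul_le_mul_of_nonneg_right (m hbK) (by positivity))
  have h3 := (PP_norm hp b).trans (m hbK)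
  have h4 := (PP_norm hp l).trans (m (ha.trans haK))
  calc _ ≤ ‖PP p a - PP p l‖ * ‖PP p b‖ + ‖PP p l‖ * ‖PP p b - PP p l‖ := by
        refine (norm_add_le _ _).trans ?_; rw [norm_mul, norm_mul]
    _ ≤ (2^K * ‖p‖^l) * 2^K + 2^K * (2^K * ‖p‖^l) := by gcongr
    _ = _ := by
      rw [show (4:ℝ) = 2 * 2 by norm_num, mul_pow]; ring

lemma BB_bound {p : ℂ} (hp : ‖p‖ ≤ 1/8) (M : ℕ) (m : ℤ) (h : m.natAbs ≤ M) :
    ‖1 - PP p M * PP p (2*M) * DD p M m‖ ≤ (4 * 4^(2*M) * 4^M) * ‖p‖^(M - m.natAbs) := by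
  obtain ⟨a, ha⟩ : ∃ a : ℕ, (M:ℤ) - m = a := ⟨((M:ℤ)-m).toNat, by omega⟩
  obtain ⟨b, hb⟩ : ∃ b : ℕ, (M:ℤ) + m = b := ⟨((M:ℤ)+m).toNat, by omega⟩
  have hD : DD p M m * (PP p a * PP p b) = 1 := by
    rw [DD, ha, hb]
    linear_combination (invq p b * PP p b) * invq_PP hp a + invq_PP hp b
  have e : 1 - PP p M * PP p (2*M) * DD p M m = ((PP p a * PP p b - PP p (M - m.natAbs) * PP p (M - m.natAbs)) -
    (PP p M * PP p (2*M) - PP p (M - m.natAbs) * PP p (M - m.natAbs))) * DD p M m := by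
    linear_combination -hD
  rw [e, norm_mul]
  have h1 := PP_prod_diff hp (l := M - m.natAbs) (a := a) (b := b) (K := 2*M) (by omega) (by omega) (by omega) (by omega)
  have h2 := PP_prod_diff hp (l := M - m.natAbs) (a := M) (b := 2*M) (K := 2*M) (by omega) (by omega) (by omega) (by omega)
  have h3 := DD_norm hp M m
  calc _ ≤ (2 * 4^(2*M) * ‖p‖^(M - m.natAbs) + 2 * 4^(2*M) * ‖p‖^(M - m.natAbs)) * 4^M := by
        gcongr
        exact (norm_sub_le _ _).trans (add_le_add h1 h2)
    _ = _ := by ring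

noncomputable def JJ (Q : ℂ) (j M : ℕ) : ℂ :=
  PP (Q^8) M * ∏ i ∈ Finset.range M, ((1 - Q^(16*i+8+j)) * (1 - Q^(16*i+8-j)))

lemma TM_approx (j M : ℕ) (hj : j < 8) (hM : 1 ≤ M) : ∃ C : ℝ, ∀ Q : ℂ, ‖Q‖ ≤ 1/8 → Q ≠ 0 →
    ‖TM Q 8 j - JJ Q j M‖ ≤ C * ‖Q‖^(8*M-8) := by
  refine ⟨(4 * 4^(2*M) * 4^M) * 2, fun Q hQ h0 => ?_⟩
  have hp : ‖Q^8‖ ≤ 1/8 := qpow_le' hQ 7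
  have hu : -(Q^j) ≠ 0 := by simp [h0]
  have hJ : JJ Q j M = ∑' m : ℤ, ((-1)^m * Q^(8*m^2+j*m)) * (PP (Q^8) M * PP (Q^8) (2*M) * DD (Q^8) M m) := by
    have := fJTP hp (pow_ne_zero 8 h0) hu M
    rw [JJ]
    have e1 : ∏ i ∈ Finset.range M, ((1 - Q^(16*i+8+j)) * (1 - Q^(16*i+8-j))) =
        ∏ i ∈ Finset.range M, ((1 + -(Q^j) * (Q^8)^(2*i+1)) * (1 + (-(Q^j))⁻¹ * (Q^8)^(2*i+1))) := by
      apply Finset.prod_congr rfl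
      intro i _
      have a1 : Q^(16*i+8+j) = Q^j * (Q^8)^(2*i+1) := by rw [← pow_mul, ← pow_add]; congr 1; ring
      have a2 : Q^(16*i+8-j) = (Q^j)⁻¹ * (Q^8)^(2*i+1) := by
        rw [eq_inv_mul_iff_mul_eq₀ (by simpa using hu), ← pow_mul, ← pow_add]; congr 1; omega
      rw [a1, a2, inv_neg]; ring
    rw [e1, this, ← tsum_mul_left]
    apply tsum_congr
    intro m
    have : (Q^8)^(m^2) * (-(Q^j))^m = (-1)^m * Q^(8*m^2+j*m) := by
      rw [neg_eq_neg_one_mul (Q^j), mul_zpow, zpow_add₀ h0, zpow_mul, zpow_mul]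
      norm_cast; ring
    rw [this]; ring
  rw [hJ, show ((8:ℤ)) = 8 from rfl, TM_eq h0]
  have bound : ∀ m : ℤ, ‖((-1)^m * Q^(8*m^2+j*m)) * (1 - PP (Q^8) M * PP (Q^8) (2*M) * DD (Q^8) M m)‖ ≤
      (4 * 4^(2*M) * 4^M) * ‖Q‖^(8*M-8) * ‖Q‖^m.natAbs := by
    intro m
    have hjm : -(7*|m|) ≤ j*m := by
      have : |(j:ℤ)*m| ≤ 7*|m| := by rw [abs_mul]; gcongr; simp; omega
      have := neg_abs_le ((j:ℤ)*m); linarith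
    have hsq : m^2 = |m|^2 := (sq_abs m).symm
    have hab : (m.natAbs : ℤ) = |m| := Int.natCast_natAbs m
    rw [norm_mul, norm_mul, neg_one_zpow_norm, one_mul]
    rcases le_or_gt m.natAbs M with h | h
    · have b1 := BB_bound hp M m h
      calc _ ≤ ‖Q^(8*m^2+j*m)‖ * ((4 * 4^(2*M) * 4^M) * ‖Q^8‖^(M - m.natAbs)) := by gcongr
        _ = (4 * 4^(2*M) * 4^M) * ‖Q^(8*m^2+j*m + 8*((M:ℤ)-m.natAbs))‖ := by
          rw [zpow_add₀ h0 (8*m^2+j*m), norm_mul]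
          have : Q^(8*((M:ℤ)-m.natAbs)) = (Q^8)^(M - m.natAbs) := by
            rw [← pow_mul, ← zpow_natCast]; congr 1; push_cast [h]; ring
          rw [this, norm_pow (Q^8)]; ring
        _ ≤ (4 * 4^(2*M) * 4^M) * ‖Q‖^(8*M-8+m.natAbs) := by
          gcongr
          have := zp_le hQ (8*m^2+j*m + 8*((M:ℤ)-m.natAbs)) ((8*M-8+m.natAbs : ℕ):ℤ) (by
            rw [Nat.abs_cast, hsq, hab]
            push_cast [show 8 ≤ 8*M by omega]
            nlinarith [sq_nonneg (|m|-1)])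
          rwa [Int.natAbs_natCast] at this
        _ = _ := by rw [pow_add]; ring
    · rw [DD_zero _ h, mul_zero, sub_zero, norm_one, mul_one]
      calc _ ≤ ‖Q‖^(8*M-8+m.natAbs) := by
            have := zp_le hQ (8*m^2+j*m) ((8*M-8+m.natAbs : ℕ):ℤ) (by
              rw [Nat.abs_cast, hsq]
              push_cast [show 8 ≤ 8*M by omega]
              have h2 : (M:ℤ) + 1 ≤ |m| := by rw [← hab]; exact_mod_cast h
              nlinarith [sq_nonneg (|m|-1)])
            rwa [Int.natAbs_natCast] at this
        _ ≤ (4 * 4^(2*M) * 4^M) * ‖Q‖^(8*M-8+m.natAbs) := by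
            apply le_mul_of_one_le_left (by positivity)
            have a1 : (1:ℝ) ≤ 4^(2*M) := one_le_pow₀ (by norm_num)
            have a2 : (1:ℝ) ≤ 4^M := one_le_pow₀ (by norm_num)
            nlinarith
        _ = _ := by rw [pow_add]; ring
  have hr : ‖Q‖ < 1 := by linarith
  have hS := (tsum_natAbs (norm_nonneg Q) hr).mul_left ((4 * 4^(2*M) * 4^M) * ‖Q‖^(8*M-8))
  have s1 : Summable (fun m : ℤ => (-1)^m * Q^(8*m^2+j*m)) := by
    refine Summable.of_norm_bounded (tsum_natAbs (norm_nonneg Q) hr).summable fun m => ?_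
    rw [norm_mul, neg_one_zpow_norm, one_mul]
    exact zp_le hQ _ _ (quad_ge (by simp; omega) m)
  have s2 : Summable (fun m : ℤ => ((-1)^m * Q^(8*m^2+j*m)) * (PP (Q^8) M * PP (Q^8) (2*M) * DD (Q^8) M m)) := by
    have := summable_D (Q^8) M (fun m => ((-1)^m * Q^(8*m^2+j*m)) * (PP (Q^8) M * PP (Q^8) (2*M)))
    exact this.congr fun m => by ring
  rw [← Summable.tsum_sub s1 s2]
  have e : ∀ m : ℤ, (-1)^m * Q^(8*m^2+j*m) - ((-1)^m * Q^(8*m^2+j*m)) * (PP (Q^8) M * PP (Q^8) (2*M) * DD (Q^8) M m) =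
    ((-1)^m * Q^(8*m^2+j*m)) * (1 - PP (Q^8) M * PP (Q^8) (2*M) * DD (Q^8) M m) := fun m => by ring
  simp_rw [e]
  refine (tsum_of_norm_bounded hS bound).trans ?_
  have hx : (1-‖Q‖)⁻¹ + (1-‖Q‖)⁻¹ * ‖Q‖ ≤ 2 := by
    have h1 : 0 < 1 - ‖Q‖ := by linarith
    have : (1-‖Q‖)⁻¹ + (1-‖Q‖)⁻¹ * ‖Q‖ = (1+‖Q‖)/(1-‖Q‖) := by field_simp
    rw [this, div_le_iff₀ h1]; linarith
  calc _ ≤ (4 * 4^(2*M) * 4^M) * ‖Q‖^(8*M-8) * 2 := by gcongr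
    _ = _ := by ring

end M2

namespace M2
open Complex Asymptotics Topology Filter

/-- `f` is, up to `O(Q^(N+1))`, the truncation of the power series `φ`. -/
def AP (N : ℕ) (f : ℂ → ℂ) (φ : PowerSeries ℂ) : Prop :=
  (fun Q => f Q - (PowerSeries.trunc (N+1) φ).eval Q) =O[𝓝[≠] 0] (fun Q => Q^(N+1))

lemma poly_O1 (p : Polynomial ℂ) : (fun Q => p.eval Q) =O[𝓝[≠] 0] (fun _ => (1:ℂ)) := by
  have : Tendsto (fun Q => p.eval Q) (𝓝[≠] 0) (𝓝 (p.eval 0)) :=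
    (p.continuous.tendsto 0).mono_left nhdsWithin_le_nhds
  exact this.isBigO_one ℂ

lemma pow_O (a : ℕ) {b : ℕ} (h : b ≤ a) : (fun Q : ℂ => Q^a) =O[𝓝[≠] 0] (fun Q => Q^b) := by
  obtain ⟨c, rfl⟩ := Nat.exists_eq_add_of_le h
  have : (fun Q : ℂ => Q^(b+c)) = fun Q => Q^b * (Polynomial.X^c : Polynomial ℂ).eval Q := by
    ext Q; simp [pow_add]
  rw [this]
  simpa using (isBigO_refl (fun Q : ℂ => Q^b) (𝓝[≠] 0)).mul (poly_O1 (Polynomial.X^c))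

lemma poly_On (p : Polynomial ℂ) (N : ℕ) (h : ∀ n ≤ N, p.coeff n = 0) :
    (fun Q => p.eval Q) =O[𝓝[≠] 0] (fun Q => Q^(N+1)) := by
  have : Polynomial.X^(N+1) ∣ p := Polynomial.X_pow_dvd_iff.mpr (fun d hd => h d (by omega))
  obtain ⟨r, rfl⟩ := this
  simpa using (isBigO_refl (fun Q : ℂ => Q^(N+1)) (𝓝[≠] 0)).mul (poly_O1 r)

lemma poly_of_On (N : ℕ) (p : Polynomial ℂ) (h : (fun Q => p.eval Q) =O[𝓝[≠] 0] (fun Q => Q^(N+1))) :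
    ∀ n ≤ N, p.coeff n = 0 := by
  induction N with
  | zero =>
    intro n hn
    obtain rfl : n = 0 := by omega
    rw [Polynomial.coeff_zero_eq_eval_zero]
    have h1 : Tendsto (fun Q : ℂ => Q^(0+1)) (𝓝[≠] 0) (𝓝 0) := by
      have : Tendsto (fun Q : ℂ => Q^(0+1)) (𝓝 0) (𝓝 (0^(0+1))) := (continuous_pow 1).tendsto 0
      rw [zero_pow (by omega)] at this
      exact this.mono_left nhdsWithin_le_nhds
    have h2 := h.trans_tendsto h1
    have h3 : Tendsto (fun Q => p.eval Q) (𝓝[≠] 0) (𝓝 (p.eval 0)) :=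
      (p.continuous.tendsto 0).mono_left nhdsWithin_le_nhds
    exact tendsto_nhds_unique h3 h2
  | succ N ih =>
    have h1 := ih (h.trans (pow_O (N+1+1) (by omega)))
    have : Polynomial.X^(N+1) ∣ p := Polynomial.X_pow_dvd_iff.mpr (fun d hd => h1 d (by omega))
    obtain ⟨r, rfl⟩ := this
    intro n hn
    rcases Nat.lt_or_ge n (N+1) with h2 | h2
    · exact h1 n (by omega)
    · obtain rfl : n = 0 + (N+1) := by omega
      rw [Polynomial.coeff_X_pow_mul, Polynomial.coeff_zero_eq_eval_zero]
      have h3 : (fun Q => r.eval Q) =O[𝓝[≠] 0] (fun Q => Q) := by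
        have := h.mul (isBigO_refl (fun Q : ℂ => (Q^(N+1))⁻¹) (𝓝[≠] 0))
        refine this.congr' ?_ ?_
        · filter_upwards [self_mem_nhdsWithin] with Q hQ
          have : Q ≠ 0 := hQ
          simp; field_simp
        · filter_upwards [self_mem_nhdsWithin] with Q hQ
          have : Q ≠ 0 := hQ
          rw [pow_succ]; field_simp
      have h2 := h3.trans_tendsto (tendsto_id.mono_left nhdsWithin_le_nhds)
      have h3 : Tendsto (fun Q => r.eval Q) (𝓝[≠] 0) (𝓝 (r.eval 0)) :=
        (r.continuous.tendsto 0).mono_left nhdsWithin_le_nhds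
      exact tendsto_nhds_unique h3 h2

lemma AP.congr_fun {N : ℕ} {f g : ℂ → ℂ} {φ : PowerSeries ℂ} (h : AP N f φ) {δ : ℝ} (hδ : 0 < δ)
    (hfg : ∀ Q : ℂ, Q ≠ 0 → ‖Q‖ ≤ δ → g Q = f Q) : AP N g φ := by
  refine IsBigO.congr' h ?_ EventuallyEq.rfl
  have : Metric.closedBall (0:ℂ) δ ∈ 𝓝 (0:ℂ) := Metric.closedBall_mem_nhds _ hδ
  filter_upwards [self_mem_nhdsWithin, mem_nhdsWithin_of_mem_nhds this] with Q h1 h2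
  rw [hfg Q h1 (by simpa using h2)]

lemma AP.of_bound {N : ℕ} {f g : ℂ → ℂ} {φ : PowerSeries ℂ} (h : AP N f φ) {δ : ℝ} (hδ : 0 < δ) {C : ℝ}
    (hfg : ∀ Q : ℂ, Q ≠ 0 → ‖Q‖ ≤ δ → ‖g Q - f Q‖ ≤ C * ‖Q‖^(N+1)) : AP N g φ := by
  have h1 : (fun Q => g Q - f Q) =O[𝓝[≠] 0] (fun Q => Q^(N+1)) := by
    apply IsBigO.of_bound C
    have : Metric.closedBall (0:ℂ) δ ∈ 𝓝 (0:ℂ) := Metric.closedBall_mem_nhds _ hδ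
    filter_upwards [self_mem_nhdsWithin, mem_nhdsWithin_of_mem_nhds this] with Q h1 h2
    rw [norm_pow]
    exact hfg Q h1 (by simpa using h2)
  refine (IsBigO.add h1 h).congr_left fun Q => ?_
  ring

lemma AP.congr_coeff {N : ℕ} {f : ℂ → ℂ} {φ ψ : PowerSeries ℂ} (h : AP N f φ)
    (he : ∀ n ≤ N, PowerSeries.coeff n φ = PowerSeries.coeff n ψ) : AP N f ψ := by
  have : PowerSeries.trunc (N+1) ψ = PowerSeries.trunc (N+1) φ := by
    ext n
    rw [PowerSeries.coeff_trunc, PowerSeries.coeff_trunc]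
    split_ifs with hn
    · exact (he n (by omega)).symm
    · rfl
  rw [AP, this]; exact h

lemma AP.add {N : ℕ} {f g : ℂ → ℂ} {φ ψ : PowerSeries ℂ} (hf : AP N f φ) (hg : AP N g ψ) :
    AP N (fun Q => f Q + g Q) (φ + ψ) := by
  refine (IsBigO.add hf hg).congr_left fun Q => ?_
  rw [map_add, Polynomial.eval_add]; ring

lemma AP.neg {N : ℕ} {f : ℂ → ℂ} {φ : PowerSeries ℂ} (hf : AP N f φ) :
    AP N (fun Q => -f Q) (-φ) := by
  refine (IsBigO.neg_left hf).congr_left fun Q => ?_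
  have : PowerSeries.trunc (N+1) (-φ) = -PowerSeries.trunc (N+1) φ := by
    ext n
    rw [PowerSeries.coeff_trunc, Polynomial.coeff_neg, PowerSeries.coeff_trunc]
    split_ifs <;> simp
  rw [this, Polynomial.eval_neg]; ring

lemma AP.sub {N : ℕ} {f g : ℂ → ℂ} {φ ψ : PowerSeries ℂ} (hf : AP N f φ) (hg : AP N g ψ) :
    AP N (fun Q => f Q - g Q) (φ - ψ) := by
  have := hf.add hg.neg
  simpa [sub_eq_add_neg] using this

lemma AP.mul {N : ℕ} {f g : ℂ → ℂ} {φ ψ : PowerSeries ℂ} (hf : AP N f φ) (hg : AP N g ψ) :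
    AP N (fun Q => f Q * g Q) (φ * ψ) := by
  have g1 : g =O[𝓝[≠] 0] (fun _ => (1:ℂ)) := by
    have h1 : (fun Q => g Q - (PowerSeries.trunc (N+1) ψ).eval Q) =O[𝓝[≠] 0] (fun _ => (1:ℂ)) := by
      have := pow_O (N+1) (Nat.zero_le _)
      simp only [pow_zero] at this
      exact IsBigO.trans hg this
    refine (h1.add (poly_O1 (PowerSeries.trunc (N+1) ψ))).congr_left fun Q => ?_
    ring
  have a1 := IsBigO.mul hf g1
  have a2 := (poly_O1 (PowerSeries.trunc (N+1) φ)).mul hg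
  have a3 := poly_On (PowerSeries.trunc (N+1) φ * PowerSeries.trunc (N+1) ψ - PowerSeries.trunc (N+1) (φ * ψ)) N (by
    intro n hn
    rw [Polynomial.coeff_sub, PowerSeries.coeff_trunc, if_pos (by omega), Polynomial.coeff_mul, PowerSeries.coeff_mul, sub_eq_zero]
    apply Finset.sum_congr rfl
    intro x hx
    have := Finset.HasAntidiagonal.mem_antidiagonal.mp hx
    rw [PowerSeries.coeff_trunc, PowerSeries.coeff_trunc, if_pos (by omega), if_pos (by omega)])
  simp only [mul_one] at a1
  simp only [one_mul] at a2
  refine ((a1.add a2).add a3).congr_left fun Q => ?_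
  simp only [Polynomial.eval_sub, Polynomial.eval_mul]; ring

lemma AP.unique {N : ℕ} {f : ℂ → ℂ} {φ ψ : PowerSeries ℂ} (hf : AP N f φ) (hg : AP N f ψ) :
    ∀ n ≤ N, PowerSeries.coeff n φ = PowerSeries.coeff n ψ := by
  have h := poly_of_On N (PowerSeries.trunc (N+1) ψ - PowerSeries.trunc (N+1) φ) (by
    refine (IsBigO.sub hf hg).congr_left fun Q => ?_
    rw [Polynomial.eval_sub]; ring)
  intro n hn
  have := h n hn
  rw [Polynomial.coeff_sub, PowerSeries.coeff_trunc, PowerSeries.coeff_trunc, if_pos (by omega), if_pos (by omega)] at this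
  linear_combination -this

lemma AP.zero (N : ℕ) : AP N (fun _ => 0) 0 := by
  have : PowerSeries.trunc (N+1) (0 : PowerSeries ℂ) = 0 := by simp
  rw [AP, this]; simpa using isBigO_zero _ _

lemma AP.X_pow (N s : ℕ) : AP N (fun Q => Q^s) (PowerSeries.X^s) := by
  have := poly_On (Polynomial.X^s - PowerSeries.trunc (N+1) (PowerSeries.X^s : PowerSeries ℂ)) N (by
    intro n hn
    rw [Polynomial.coeff_sub, PowerSeries.coeff_trunc, if_pos (by omega), Polynomial.coeff_X_pow, PowerSeries.coeff_X_pow, sub_self])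
  refine this.congr_left fun Q => ?_
  simp

lemma AP.one (N : ℕ) : AP N (fun _ => 1) 1 := by
  simpa using AP.X_pow N 0

lemma AP.sum {N : ℕ} {ι : Type*} (s : Finset ι) {f : ι → ℂ → ℂ} {φ : ι → PowerSeries ℂ} (h : ∀ i ∈ s, AP N (f i) (φ i)) :
    AP N (fun Q => ∑ i ∈ s, f i Q) (∑ i ∈ s, φ i) := by
  induction s using Finset.induction_on with
  | empty => simpa using AP.zero N
  | insert a s ha ih =>
    simp_rw [Finset.sum_insert ha]
    exact (h a (Finset.mem_insert_self _ _)).add (ih fun i hi => h i (Finset.mem_insert_of_mem hi))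

lemma AP.prod {N : ℕ} {ι : Type*} (s : Finset ι) {f : ι → ℂ → ℂ} {φ : ι → PowerSeries ℂ} (h : ∀ i ∈ s, AP N (f i) (φ i)) :
    AP N (fun Q => ∏ i ∈ s, f i Q) (∏ i ∈ s, φ i) := by
  induction s using Finset.induction_on with
  | empty => simpa using AP.one N
  | insert a s ha ih =>
    simp_rw [Finset.prod_insert ha]
    exact (h a (Finset.mem_insert_self _ _)).mul (ih fun i hi => h i (Finset.mem_insert_of_mem hi))

end M2

namespace M2
open Complex Asymptotics Topology Filter

noncomputable abbrev toC : PowerSeries ℤ →+* PowerSeries ℂ := PowerSeries.map (Int.castRingHom ℂ)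

noncomputable def FF (N : ℕ) (st sp : ℕ → ℕ) : PowerSeries ℤ :=
  ∑ n ∈ Finset.range (N+1), ∑ k ∈ Finset.range (N+1), PowerSeries.X^(st n + k * sp n)

lemma _root_.HasSum.congr_fun' {f g : ℕ → ℂ} {a : ℂ} (h : HasSum g a) (e : ∀ n, f n = g n) : HasSum f a := by
  rw [funext e]; exact h

lemma fam_bound {Q : ℂ} (hQ : ‖Q‖ ≤ 1/8) (h0 : Q ≠ 0) {st sp n : ℕ} (h1 : n ≤ st) (h2 : 1 ≤ sp) :
    ‖Q^st / (1 - Q^sp)‖ ≤ 2 * ‖Q‖^n := by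
  have := (inv_bound hQ h0 (sp:ℤ) (by omega)).1
  rw [zpow_natCast] at this
  rw [div_eq_mul_inv, norm_mul, norm_pow, mul_comm]
  have h3 : ‖Q‖^st ≤ ‖Q‖^n := pow_le_pow_of_le_one (norm_nonneg _) (by linarith) h1
  gcongr

lemma fam_summable {Q : ℂ} (hQ : ‖Q‖ ≤ 1/8) (h0 : Q ≠ 0) {st sp : ℕ → ℕ} (h1 : ∀ n, n ≤ st n) (h2 : ∀ n, 1 ≤ sp n) :
    Summable (fun n => Q^(st n) / (1 - Q^(sp n))) :=
  Summable.of_norm_bounded ((summable_geometric_of_lt_one (norm_nonneg Q) (by linarith)).mul_left 2)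
    (fun n => fam_bound hQ h0 (h1 n) (h2 n))

lemma AP_geom (N st sp : ℕ) (h2 : 1 ≤ sp) :
    AP N (fun Q => Q^st / (1 - Q^sp)) (∑ k ∈ Finset.range (N+1), PowerSeries.X^(st + k * sp)) := by
  have h := AP.sum (N := N) (Finset.range (N+1)) (fun k _ => AP.X_pow N (st + k*sp))
  refine h.of_bound (δ := 1/8) (by norm_num) (C := 2) fun Q h0 hQ => ?_
  have hb := inv_bound hQ h0 (sp:ℤ) (by omega)
  rw [zpow_natCast] at hb
  have e : ∑ k ∈ Finset.range (N+1), Q^(st + k*sp) = Q^st * ((Q^sp)^(N+1) - 1) / (Q^sp - 1) := by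
    rw [mul_div_assoc, ← geom_sum_eq (fun h => hb.2 (by rw [h]; ring)), Finset.mul_sum]
    apply Finset.sum_congr rfl
    intro k _
    rw [pow_add, ← pow_mul, mul_comm k]
  have e2 : Q^st / (1 - Q^sp) - ∑ k ∈ Finset.range (N+1), Q^(st + k*sp) = Q^st * (Q^sp)^(N+1) / (1 - Q^sp) := by
    rw [e, ← neg_sub 1 (Q^sp)]
    have := hb.2
    field_simp
    ring
  rw [e2, ← pow_mul, ← pow_add]
  exact fam_bound hQ h0 (le_trans (by nlinarith) (Nat.le_add_left _ _)) h2

lemma fam_AP (N : ℕ) {st sp : ℕ → ℕ} (h1 : ∀ n, n ≤ st n) (h2 : ∀ n, 1 ≤ sp n) :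
    AP N (fun Q => ∑' n, Q^(st n) / (1 - Q^(sp n))) (toC (FF N st sp)) := by
  have h := AP.sum (N := N) (Finset.range (N+1)) (fun n _ => AP_geom N (st n) (sp n) (h2 n))
  have e : toC (FF N st sp) = ∑ n ∈ Finset.range (N+1), ∑ k ∈ Finset.range (N+1), PowerSeries.X^(st n + k * sp n) := by
    simp [toC, FF]
  rw [e]
  refine h.of_bound (δ := 1/8) (by norm_num) (C := 4) fun Q h0 hQ => ?_
  have hs := fam_summable hQ h0 h1 h2
  rw [← hs.sum_add_tsum_nat_add (N+1), add_sub_cancel_left]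
  have hg := ((hasSum_geometric_of_lt_one (norm_nonneg Q) (by linarith)).mul_left (2 * ‖Q‖^(N+1)))
  refine (tsum_of_norm_bounded hg fun n => ?_).trans ?_
  · rw [mul_assoc, ← pow_add]
    exact fam_bound hQ h0 (by have := h1 (n+(N+1)); omega) (h2 _)
  · have : (1 - ‖Q‖)⁻¹ ≤ 2 := by
      rw [inv_le_comm₀ (by linarith) (by norm_num)]; linarith
    calc _ ≤ 2 * ‖Q‖^(N+1) * 2 := by gcongr
      _ = _ := by ring

lemma neg_term {Q : ℂ} (hQ : ‖Q‖ ≤ 1/8) (h0 : Q ≠ 0) {e f : ℤ} {st sp : ℕ} (hf : f = -(sp:ℤ)) (he : e + sp = st) (h : 1 ≤ sp) :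
    Q^e / (1 - Q^f) = -(Q^st / (1 - Q^sp)) := by
  have hb := (inv_bound hQ h0 (sp:ℤ) (by omega)).2
  have hb2 := (inv_bound hQ h0 f (by omega)).2
  rw [← zpow_natCast Q st, ← zpow_natCast Q sp, ← he, zpow_add₀ h0]
  have : Q^(sp:ℤ) * Q^f = 1 := by rw [← zpow_add₀ h0, hf]; simp
  generalize Q^(sp:ℤ) = x at *
  generalize Q^f = y at *
  field_simp
  linear_combination -this

lemma KK_AP (N a b c : ℕ) (ha : 0 < a) (ha' : a < 16) (hb : 0 < b) (hb' : b < 16) (hc : a + b ≤ 16 + c) :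
    AP N (fun Q => Q^c * KK Q a b)
      (toC (FF N (fun n => a*n+c) (fun n => 16*n+b) - FF N (fun n => (16-a)*n+(16+c-a-b)) (fun n => 16*n+(16-b)))) := by
  have h1 : ∀ n, n ≤ a*n+c := fun n => by nlinarith
  have h1' : ∀ n, n ≤ (16-a)*n+(16+c-a-b) := fun n => by
    have : 1 * n ≤ (16-a) * n := Nat.mul_le_mul_right n (by omega)
    omega
  have h2 : ∀ n, 1 ≤ 16*n+b := fun n => by omega
  have h2' : ∀ n, 1 ≤ 16*n+(16-b) := fun n => by omega
  rw [map_sub]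
  refine ((fam_AP N h1 h2).sub (fam_AP N h1' h2')).congr_fun (δ := 1/8) (by norm_num) fun Q h0 hQ => ?_
  have s1 := (fam_summable hQ h0 h1 h2).hasSum
  have s2 := (fam_summable hQ h0 h1' h2').hasSum.neg
  have : HasSum (fun n : ℤ => Q^(c:ℤ) * (Q^((a:ℤ)*n) / (1 - Q^(16*n+b)))) _ :=
    HasSum.of_nat_of_neg_add_one (f := fun n : ℤ => Q^(c:ℤ) * (Q^((a:ℤ)*n) / (1 - Q^(16*n+b)))) (m := _) (m' := _)
      (by
        refine s1.congr_fun' fun n => ?_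
        rw [← mul_div_assoc, ← zpow_add₀ h0, ← zpow_natCast Q (16*n+b), ← zpow_natCast Q (a*n+c)]
        push_cast; ring_nf)
      (by
        refine s2.congr_fun' fun n => ?_
        rw [← mul_div_assoc, ← zpow_add₀ h0]
        apply neg_term hQ h0 _ _ (h2' n)
        · push_cast [hb'.le]; ring
        · push_cast [hb'.le, ha'.le, Nat.sub_sub, hc]; ring)
  rw [KK, ← tsum_mul_left, ← zpow_natCast, this.tsum_eq, sub_eq_add_neg]

lemma LA_AP (N k c : ℕ) (hk : k ≤ 20) :
    AP N (fun Q => Q^c * LA Q k)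
      (toC (FF N (fun n => 32*n^2+2*k*n+c) (fun n => 32*n+4) - FF N (fun n => 32*n^2+(32+2*k)*n+(8+k+c)) (fun n => 32*n+20)
       + (FF N (fun n => 32*n^2+(64-2*k)*n+(20-k+c)) (fun n => 32*n+12) - FF N (fun n => 32*n^2+(96-2*k)*n+(60-2*k+c)) (fun n => 32*n+28)))) := by
  have g : ∀ n x : ℕ, n ≤ 32*n^2 + x := fun n x => by nlinarith
  have h1 : ∀ n, n ≤ 32*n^2+2*k*n+c := fun n => by rw [add_assoc]; exact g _ _
  have h2 : ∀ n, n ≤ 32*n^2+(32+2*k)*n+(8+k+c) := fun n => by rw [add_assoc]; exact g _ _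
  have h3 : ∀ n, n ≤ 32*n^2+(64-2*k)*n+(20-k+c) := fun n => by rw [add_assoc]; exact g _ _
  have h4 : ∀ n, n ≤ 32*n^2+(96-2*k)*n+(60-2*k+c) := fun n => by rw [add_assoc]; exact g _ _
  have t1 : ∀ n, 1 ≤ 32*n+4 := fun n => by omega
  have t2 : ∀ n, 1 ≤ 32*n+20 := fun n => by omega
  have t3 : ∀ n, 1 ≤ 32*n+12 := fun n => by omega
  have t4 : ∀ n, 1 ≤ 32*n+28 := fun n => by omega
  rw [map_add, map_sub, map_sub]
  refine (((fam_AP N h1 t1).sub (fam_AP N h2 t2)).add ((fam_AP N h3 t3).sub (fam_AP N h4 t4))).congr_fun (δ := 1/8) (by norm_num) fun Q h0 hQ => ?_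
  have s1 := (fam_summable hQ h0 h1 t1).hasSum
  have s2 := (fam_summable hQ h0 h2 t2).hasSum.neg
  have s3 := (fam_summable hQ h0 h3 t3).hasSum
  have s4 := (fam_summable hQ h0 h4 t4).hasSum.neg
  have ev : ∀ n : ℤ, (-1:ℂ)^(2*n) = 1 := fun n => by rw [zpow_mul]; norm_num
  have this : HasSum (fun r : ℤ => Q^(c:ℤ) * ((-1)^r * Q^(8*r^2+k*r) / (1 - Q^(16*r+4)))) _ :=
    HasSum.of_nat_of_neg_add_one (f := fun r : ℤ => Q^(c:ℤ) * ((-1)^r * Q^(8*r^2+k*r) / (1 - Q^(16*r+4)))) (m := _) (m' := _)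
      (HasSum.even_add_odd (m := _) (m' := _)
        (by
          refine s1.congr_fun' fun n => ?_
          push_cast
          rw [ev, one_mul, ← mul_div_assoc, ← zpow_add₀ h0, ← zpow_natCast Q (32*n+4), ← zpow_natCast Q (32*n^2+2*k*n+c)]
          push_cast; ring_nf)
        (by
          refine s2.congr_fun' fun n => ?_
          push_cast
          rw [neg_one_zpow_add_one, ev, neg_one_mul, neg_div, mul_neg, ← mul_div_assoc, ← zpow_add₀ h0, ← zpow_natCast Q (32*n+20), ← zpow_natCast Q (32*n^2+(32+2*k)*n+(8+k+c))]
          push_cast; ring_nf))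
      (HasSum.even_add_odd (m := _) (m' := _)
        (by
          refine s3.congr_fun' fun n => ?_
          have : (-1:ℂ)^(-(((2*n:ℕ):ℤ)+1)) = -1 := by
            rw [neg_one_zpow_neg]; push_cast; rw [neg_one_zpow_add_one, ev]
          rw [this, neg_one_mul, neg_div, mul_neg, ← mul_div_assoc, ← zpow_add₀ h0, ← neg_neg (Q^(32*n^2+(64-2*k)*n+(20-k+c)) / _)]
          congr 1
          apply neg_term hQ h0 _ _ (t3 n)
          · push_cast; ring
          · push_cast [hk, show 2*k ≤ 64 by omega]; ring)
        (by
          refine s4.congr_fun' fun n => ?_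
          have : (-1:ℂ)^(-(((2*n+1:ℕ):ℤ)+1)) = 1 := by
            rw [neg_one_zpow_neg]; push_cast; rw [neg_one_zpow_add_one, neg_one_zpow_add_one, ev]; norm_num
          rw [this, one_mul, ← mul_div_assoc, ← zpow_add₀ h0]
          apply neg_term hQ h0 _ _ (t4 n)
          · push_cast; ring
          · push_cast [show 2*k ≤ 60 by omega, show 2*k ≤ 96 by omega]; ring))
  rw [LA, ← tsum_mul_left, ← zpow_natCast, this.tsum_eq, sub_eq_add_neg, sub_eq_add_neg]

noncomputable def PJ (j M : ℕ) : PowerSeries ℤ :=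
  (∏ i ∈ Finset.range M, (1 - PowerSeries.X^(16*i+16))) * ∏ i ∈ Finset.range M, ((1 - PowerSeries.X^(16*i+8+j)) * (1 - PowerSeries.X^(16*i+8-j)))

lemma TM_AP (N j : ℕ) (hj : j < 8) : AP N (fun Q => TM Q 8 j) (toC (PJ j (N+2))) := by
  obtain ⟨C, hC⟩ := TM_approx j (N+2) hj (by omega)
  have h : AP N (fun Q => JJ Q j (N+2)) (toC (PJ j (N+2))) := by
    have e : toC (PJ j (N+2)) = (∏ i ∈ Finset.range (N+2), (1 - PowerSeries.X^(16*i+16))) *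
       ∏ i ∈ Finset.range (N+2), ((1 - PowerSeries.X^(16*i+8+j)) * (1 - PowerSeries.X^(16*i+8-j))) := by
      simp [toC, PJ]
    rw [e]
    have h1 := fun s => (AP.one N).sub (AP.X_pow N s)
    refine ((AP.prod (N := N) (Finset.range (N+2)) (fun i _ => h1 (16*i+16))).mul
      (AP.prod (N := N) (Finset.range (N+2)) (fun i _ => (h1 (16*i+8+j)).mul (h1 (16*i+8-j))))).congr_fun (δ := 1) one_pos fun Q _ _ => ?_
    rw [JJ, PP]
    congr 1
    apply Finset.prod_congr rfl
    intro i _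
    rw [← pow_mul]; ring_nf
  refine h.of_bound (δ := 1/8) (by norm_num) (C := |C|) fun Q h0 hQ => ?_
  refine (hC Q hQ h0).trans ?_
  have : ‖Q‖^(8*(N+2)-8) ≤ ‖Q‖^(N+1) := pow_le_pow_of_le_one (norm_nonneg _) (by linarith) (by omega)
  calc _ ≤ |C| * ‖Q‖^(8*(N+2)-8) := by gcongr; exact le_abs_self C
    _ ≤ _ := by gcongr

lemma VV_AP (N c : ℕ) : AP N (fun Q => VV c Q) (PowerSeries.mk (vv c)) := by
  have vb : ∀ e, ‖vv c e‖ ≤ 2^c * 16^e := by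
    intro e
    rw [vv, norm_mul, norm_pow, norm_neg, norm_one, one_pow, one_mul]
    refine (uu_bound _).trans (le_of_eq ?_)
    rw [pow_add, pow_mul]; norm_num; ring
  have h : AP N (fun Q => ∑ e ∈ Finset.range (N+1), vv c e * Q^e) (PowerSeries.mk (vv c)) := by
    have : ∀ Q, ∑ e ∈ Finset.range (N+1), vv c e * Q^e = (PowerSeries.trunc (N+1) (PowerSeries.mk (vv c))).eval Q := by
      intro Q
      rw [Polynomial.eval, PowerSeries.eval₂_trunc_eq_sum_range]
      simp
    simp only [AP, this, sub_self]
    exact isBigO_zero _ _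
  refine h.of_bound (δ := 1/32) (by norm_num) (C := 2^c * 16^(N+1) * 2) fun Q h0 hQ => ?_
  have b : ∀ e, ‖vv c e * Q^e‖ ≤ 2^c * (16*‖Q‖)^e := by
    intro e
    rw [norm_mul, norm_pow, mul_pow, ← mul_assoc]
    gcongr
    exact vb e
  have hq : 16*‖Q‖ < 1 := by linarith
  have hs : Summable (fun e => vv c e * Q^e) :=
    Summable.of_norm_bounded ((summable_geometric_of_lt_one (by positivity) hq).mul_left _) b
  rw [VV, ← hs.sum_add_tsum_nat_add (N+1), add_sub_cancel_left]
  have hg := ((hasSum_geometric_of_lt_one (by positivity) hq).mul_left (2^c * (16*‖Q‖)^(N+1)))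
  refine (tsum_of_norm_bounded hg fun n => ?_).trans ?_
  · refine (b _).trans (le_of_eq ?_)
    rw [pow_add]; ring
  · have : (1 - 16*‖Q‖)⁻¹ ≤ 2 := by
      rw [inv_le_comm₀ (by linarith) (by norm_num)]; linarith
    calc _ ≤ 2^c * (16*‖Q‖)^(N+1) * 2 := by gcongr
      _ = _ := by rw [mul_pow]; ring

end M2

namespace M2

/-- Admissible weights: nonnegative, vanishing beyond `X`, decreasing along the semigroup `sg` and along jumps `≥ D`. -/
structure Ad (φ : ℕ → ℤ) (X : ℕ) (sg : ℕ → Bool) (D : ℕ) : Prop where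
  nonneg : ∀ s, 0 ≤ φ s
  vanish : ∀ s, X < s → φ s = 0
  mono_sg : ∀ s d, sg d = true → φ (s+d) ≤ φ s
  mono_D : ∀ s d, D ≤ d → φ (s+d) ≤ φ s

def AA (φ : ℕ → ℤ) (X : ℕ) (p : ℕ × ℕ) : ℤ := ∑ k ∈ Finset.range (X+1), φ (p.1 + k * p.2)

def cntAP (y : ℕ) (p : ℕ × ℕ) : ℕ := (y + p.2 - p.1) / p.2
def pm (T : ℕ) (p : ℕ × ℕ) : ℕ := (T + p.2 - 1 - p.1) / p.2
def els (T : ℕ) (p : ℕ × ℕ) : List ℕ := (List.range (pm T p)).map (fun k => p.1 + k * p.2)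
def rst (T : ℕ) (p : ℕ × ℕ) : ℕ × ℕ := (p.1 + pm T p * p.2, p.2)

lemma AA_peel {φ : ℕ → ℤ} {X : ℕ} (hX : ∀ s, X < s → φ s = 0) (s d : ℕ) (hd : 1 ≤ d) :
    AA φ X (s, d) = φ s + AA φ X (s+d, d) := by
  simp only [AA]
  have h1 := Finset.sum_range_succ' (fun k => φ (s + k * d)) (X+1)
  have h2 := Finset.sum_range_succ (fun k => φ (s + k * d)) (X+1)
  have h3 : φ (s + (X+1)*d) = 0 := hX _ (by nlinarith)
  rw [h3, add_zero] at h2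
  rw [← h2, h1]
  simp only [zero_mul, add_zero]
  rw [add_comm]
  congr 1
  apply Finset.sum_congr rfl
  intro k _
  congr 1; ring

lemma AA_peel_m {φ : ℕ → ℤ} {X : ℕ} (hX : ∀ s, X < s → φ s = 0) (s d : ℕ) (hd : 1 ≤ d) (m : ℕ) :
    AA φ X (s, d) = ((List.range m).map (fun k => φ (s + k * d))).sum + AA φ X (s+m*d, d) := by
  induction m with
  | zero => simp
  | succ m ih =>
    rw [ih, AA_peel hX (s+m*d) d hd, List.range_succ, List.map_append, List.sum_append]
    simp only [List.map_cons, List.map_nil, List.sum_cons, List.sum_nil]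
    rw [show s + (m+1)*d = s+m*d+d by ring]; ring

lemma AA_split {φ : ℕ → ℤ} {X : ℕ} (hX : ∀ s, X < s → φ s = 0) (T : ℕ) (p : ℕ × ℕ) (hd : 1 ≤ p.2) :
    AA φ X p = ((els T p).map φ).sum + AA φ X (rst T p) := by
  rw [els, rst, List.map_map]
  exact AA_peel_m hX p.1 p.2 hd (pm T p)

noncomputable def psi (φ : ℕ → ℤ) (X s : ℕ) : ℤ :=
  (Finset.range (X+1)).sup' ⟨0, by simp⟩ (fun i => φ (s+i))

section
variable {φ : ℕ → ℤ} {X : ℕ} {sg : ℕ → Bool} {D : ℕ}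

lemma le_psi (s : ℕ) : φ s ≤ psi φ X s :=
  Finset.le_sup' (f := fun i => φ (s+i)) (b := 0) (by simp)

lemma psi_D (h : Ad φ X sg D) (s : ℕ) : psi φ X (s+D) ≤ φ s := by
  apply Finset.sup'_le
  intro i _
  rw [add_assoc]
  exact h.mono_D s (D+i) (by omega)

lemma psi_anti (h : Ad φ X sg D) (s : ℕ) : psi φ X (s+1) ≤ psi φ X s := by
  apply Finset.sup'_le
  intro i hi
  simp only [Finset.mem_range] at hi
  rcases Nat.lt_or_ge (i+1) (X+1) with h1 | h1
  · have := Finset.le_sup' (s := Finset.range (X+1)) (f := fun i => φ (s+i)) (b := i+1) (by simpa using h1)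
    rw [show s+1+i = s+(i+1) by ring]; exact this
  · rw [h.vanish _ (by omega)]
    exact (h.nonneg s).trans (le_psi s)

lemma psi_zero (h : Ad φ X sg D) (s : ℕ) (hs : X < s) : psi φ X s = 0 := by
  apply le_antisymm
  · apply Finset.sup'_le
    intro i _
    rw [h.vanish _ (by omega)]
  · exact (h.nonneg s).trans (le_psi s)

lemma psi_abel (h : Ad φ X sg D) (t : ℕ) :
    psi φ X t = ∑ y ∈ Finset.range (X+1), (psi φ X y - psi φ X (y+1)) * (if t ≤ y then 1 else 0) := by
  have key : ∀ n, t ≤ n → ∑ y ∈ Finset.range n, (psi φ X y - psi φ X (y+1)) * (if t ≤ y then 1 else 0) = psi φ X t - psi φ X n := by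
    intro n hn
    induction n, hn using Nat.le_induction with
    | base =>
      rw [sub_self]
      apply Finset.sum_eq_zero
      intro y hy
      simp only [Finset.mem_range] at hy
      rw [if_neg (by omega), mul_zero]
    | succ n hn ih =>
      rw [Finset.sum_range_succ, ih, if_pos hn]; ring
  rcases Nat.lt_or_ge X t with h1 | h1
  · rw [psi_zero h t h1]
    symm
    apply Finset.sum_eq_zero
    intro y hy
    simp only [Finset.mem_range] at hy
    rw [if_neg (by omega), mul_zero]
  · rw [key (X+1) (by omega), psi_zero h (X+1) (by omega), sub_zero]

lemma count_AP (y s d n : ℕ) (hd : 1 ≤ d) (hn : y < n) :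
    ∑ k ∈ Finset.range n, (if s + k * d ≤ y then (1:ℤ) else 0) = ((y + d - s) / d : ℕ) := by
  rw [Finset.sum_ite, Finset.sum_const_zero, add_zero, Finset.sum_const, nsmul_eq_mul, mul_one]
  congr 1
  have : Finset.filter (fun k => s + k * d ≤ y) (Finset.range n) = Finset.range ((y + d - s) / d) := by
    ext k
    simp only [Finset.mem_filter, Finset.mem_range]
    rw [show (k < (y+d-s)/d) ↔ (k+1)*d ≤ y+d-s from by rw [Nat.lt_iff_add_one_le, Nat.le_div_iff_mul_le (by omega)], add_mul, one_mul]
    constructor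
    · intro h; omega
    · intro h
      refine ⟨?_, by omega⟩
      have : k * 1 ≤ k * d := Nat.mul_le_mul_left k hd
      omega
  rw [this, Finset.card_range]

lemma AA_psi (h : Ad φ X sg D) (p : ℕ × ℕ) (hd : 1 ≤ p.2) :
    AA (psi φ X) X p = ∑ y ∈ Finset.range (X+1), (psi φ X y - psi φ X (y+1)) * (cntAP y p : ℤ) := by
  rw [AA]
  have e : ∀ k ∈ Finset.range (X+1), psi φ X (p.1 + k*p.2) = ∑ y ∈ Finset.range (X+1), (psi φ X y - psi φ X (y+1)) * (if p.1 + k*p.2 ≤ y then 1 else 0) :=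
    fun k _ => psi_abel h _
  rw [Finset.sum_congr rfl e, Finset.sum_comm]
  apply Finset.sum_congr rfl
  intro y hy
  simp only [Finset.mem_range] at hy
  rw [← Finset.mul_sum, count_AP y p.1 p.2 (X+1) hd hy, cntAP]

lemma AA_le_psi (p : ℕ × ℕ) : AA φ X p ≤ AA (psi φ X) X p :=
  Finset.sum_le_sum fun _ _ => le_psi _

lemma psi_le_AA (h : Ad φ X sg D) (p : ℕ × ℕ) : AA (psi φ X) X (p.1+D, p.2) ≤ AA φ X p := by
  apply Finset.sum_le_sum
  intro k _
  have := psi_D h (p.1 + k*p.2)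
  rw [show p.1 + k*p.2 + D = p.1 + D + k*p.2 by ring] at this
  exact this

lemma list_le {α : Type*} (l : List α) (f g : α → ℤ) (h : ∀ a ∈ l, f a ≤ g a) : (l.map f).sum ≤ (l.map g).sum :=
  List.sum_le_sum h

lemma list_sum_comm {α : Type*} (l : List α) (n : ℕ) (w : ℕ → ℤ) (f : ℕ → α → ℕ) :
    (l.map (fun a => ∑ y ∈ Finset.range n, w y * (f y a : ℤ))).sum = ∑ y ∈ Finset.range n, w y * (((l.map (f y)).sum : ℕ) : ℤ) := by
  induction l with
  | nil => simp
  | cons a l ih =>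
    simp only [List.map_cons, List.sum_cons, ih]
    rw [← Finset.sum_add_distrib]
    apply Finset.sum_congr rfl
    intro y _
    push_cast; ring

/-- The pool inequality. -/
theorem pool_tail (h : Ad φ X sg D) (pos neg : List (ℕ × ℕ)) (ex : List ℕ)
    (hp : ∀ p ∈ pos, 1 ≤ p.2) (hn : ∀ p ∈ neg, 1 ≤ p.2)
    (hc : ∀ y, (neg.map (cntAP y)).sum ≤ (pos.map (fun p => cntAP y (p.1+D, p.2))).sum + (ex.map (fun e => if e + D ≤ y then 1 else 0)).sum) :
    (neg.map (AA φ X)).sum ≤ (pos.map (AA φ X)).sum + (ex.map φ).sum := by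
  have a1 : (neg.map (AA φ X)).sum ≤ (neg.map (fun p => ∑ y ∈ Finset.range (X+1), (psi φ X y - psi φ X (y+1)) * (cntAP y p : ℤ))).sum := by
    apply list_le
    intro p hpp
    rw [← AA_psi h p (hn p hpp)]
    exact AA_le_psi p
  have a2 : (pos.map (fun p => ∑ y ∈ Finset.range (X+1), (psi φ X y - psi φ X (y+1)) * (cntAP y (p.1+D, p.2) : ℤ))).sum ≤ (pos.map (AA φ X)).sum := by
    apply list_le
    intro p hpp
    rw [← AA_psi h (p.1+D, p.2) (hp p hpp)]
    exact psi_le_AA h p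
  have a3 : (ex.map (fun e => ∑ y ∈ Finset.range (X+1), (psi φ X y - psi φ X (y+1)) * (((if e + D ≤ y then 1 else 0 : ℕ)) : ℤ))).sum ≤ (ex.map φ).sum := by
    apply list_le
    intro e _
    refine le_trans (le_of_eq ?_) (psi_D h e)
    rw [psi_abel h (e+D)]
    apply Finset.sum_congr rfl
    intro y _
    push_cast; rfl
  rw [list_sum_comm] at a1 a2 a3
  refine a1.trans (le_trans ?_ (add_le_add a2 a3))
  rw [← Finset.sum_add_distrib]
  apply Finset.sum_le_sum
  intro y _
  rw [← mul_add]
  apply mul_le_mul_of_nonneg_left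
  · exact_mod_cast hc y
  · have := psi_anti h y; linarith

end

/-- Executable certificate check. -/
def chk (sg : ℕ → Bool) (D T W Y : ℕ) (pos neg pairs : List (ℕ × ℕ)) (ex : List ℕ) : Bool :=
  decide (1 ≤ W) && pos.all (fun p => decide (1 ≤ p.2) && decide (p.2 ∣ W) && decide ((rst T p).1 + D ≤ Y)) &&
  neg.all (fun p => decide (1 ≤ p.2) && decide (p.2 ∣ W) && decide ((rst T p).1 ≤ Y)) &&
  ex.all (fun e => decide (e + D ≤ Y)) &&
  (pairs.map Prod.fst ++ ex).isPerm (pos.flatMap (els T)) &&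
  (pairs.map Prod.snd).isPerm (neg.flatMap (els T)) &&
  pairs.all (fun p => decide (p.1 ≤ p.2) && sg (p.2 - p.1)) &&
  (List.range Y).all (fun y => decide ((neg.map (fun p => cntAP y (rst T p))).sum ≤
    (pos.map (fun p => cntAP y ((rst T p).1+D, p.2))).sum + (ex.map (fun e => if e + D ≤ y then 1 else 0)).sum)) &&
  decide ((neg.map (fun p => W / p.2)).sum ≤ (pos.map (fun p => W / p.2)).sum) &&
  decide ((neg.map (fun p => (W / p.2) * (Y + p.2 - (rst T p).1))).sum ≤
     (pos.map (fun p => (W / p.2) * (Y + 1 - (D + (rst T p).1)))).sum + W * ex.length)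


lemma list_nat_le {α : Type*} (l : List α) (f g : α → ℕ) (h : ∀ a ∈ l, f a ≤ g a) : (l.map f).sum ≤ (l.map g).sum :=
  List.sum_le_sum h

lemma flat_sum {α : Type*} (l : List α) (f : α → List ℕ) (φ : ℕ → ℤ) :
    ((l.flatMap f).map φ).sum = (l.map (fun a => ((f a).map φ).sum)).sum := by
  induction l with
  | nil => simp
  | cons a l ih => simp [ih]

theorem pool_of_chk {φ : ℕ → ℤ} {X : ℕ} {sg : ℕ → Bool} {D T W Y : ℕ} {pos neg pairs : List (ℕ × ℕ)} {ex : List ℕ}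
    (h : Ad φ X sg D) (hc : chk sg D T W Y pos neg pairs ex = true) :
    (neg.map (AA φ X)).sum ≤ (pos.map (AA φ X)).sum := by
  simp only [chk, Bool.and_eq_true, List.all_eq_true, decide_eq_true_eq, List.isPerm_iff] at hc
  obtain ⟨⟨⟨⟨⟨⟨⟨⟨⟨hW, hp⟩, hn⟩, he⟩, hp1⟩, hp2⟩, hpr⟩, hy⟩, hs⟩, hv⟩ := hc
  have e1 : (pos.map (AA φ X)).sum = ((pos.flatMap (els T)).map φ).sum + ((pos.map (rst T)).map (AA φ X)).sum := by
    rw [flat_sum, List.map_map, ← List.sum_map_add]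
    congr 1
    apply List.map_congr_left
    intro p hpp
    exact AA_split h.vanish T p (hp p hpp).1.1
  have e2 : (neg.map (AA φ X)).sum = ((neg.flatMap (els T)).map φ).sum + ((neg.map (rst T)).map (AA φ X)).sum := by
    rw [flat_sum, List.map_map, ← List.sum_map_add]
    congr 1
    apply List.map_congr_left
    intro p hpp
    exact AA_split h.vanish T p (hn p hpp).1.1
  rw [e1, e2, ← (hp1.map φ).sum_eq, ← (hp2.map φ).sum_eq, List.map_append, List.sum_append, List.map_map, List.map_map]
  have t1 : (pairs.map (φ ∘ Prod.snd)).sum ≤ (pairs.map (φ ∘ Prod.fst)).sum := by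
    apply list_le
    intro p hpp
    obtain ⟨a, b⟩ := hpr p hpp
    have := h.mono_sg p.1 _ b
    rwa [Nat.add_sub_cancel' a] at this
  have t2 := pool_tail h (pos.map (rst T)) (neg.map (rst T)) ex
    (by
      intro p hpp
      obtain ⟨q, hq, rfl⟩ := List.mem_map.mp hpp
      exact (hp q hq).1.1)
    (by
      intro p hpp
      obtain ⟨q, hq, rfl⟩ := List.mem_map.mp hpp
      exact (hn q hq).1.1) (by
    intro y
    rw [List.map_map, List.map_map]
    rcases Nat.lt_or_ge y Y with h1 | h1
    · exact hy y (List.mem_range.mpr h1)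
    obtain ⟨z, rfl⟩ := Nat.exists_eq_add_of_le h1
    have ee : (ex.map (fun e => if e + D ≤ Y + z then 1 else 0)).sum = ex.length := by
      rw [List.map_congr_left (g := fun _ => 1) (fun e hee => if_pos (by have := he e hee; omega))]
      simp
    rw [ee]
    apply Nat.le_of_mul_le_mul_left _ hW
    rw [mul_add]
    have c1 : (neg.map (fun p => W * (cntAP (Y+z) ∘ rst T) p)).sum ≤ (neg.map (fun p => (W / p.2) * (Y + p.2 - (rst T p).1) + z * (W / p.2))).sum := by
      apply list_nat_le
      intro p hpp
      obtain ⟨⟨a1, a2⟩, a3⟩ := hn p hpp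
      obtain ⟨w, hw⟩ := a2
      have hw2 : W / p.2 = w := by rw [hw]; exact Nat.mul_div_cancel_left w a1
      rw [hw2]
      simp only [Function.comp, cntAP]
      have r2 : (rst T p).2 = p.2 := rfl
      rw [r2]
      have : p.2 * ((Y + z + p.2 - (rst T p).1) / p.2) ≤ Y + z + p.2 - (rst T p).1 := Nat.mul_div_le _ _
      have e3 : Y + z + p.2 - (rst T p).1 = (Y + p.2 - (rst T p).1) + z := by omega
      rw [e3] at this ⊢
      calc W * _ = w * (p.2 * ((Y + p.2 - (rst T p).1 + z) / p.2)) := by rw [hw]; ring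
        _ ≤ w * (Y + p.2 - (rst T p).1 + z) := Nat.mul_le_mul_left _ this
        _ = _ := by ring
    have c2 : (pos.map (fun p => (W / p.2) * (Y + 1 - (D + (rst T p).1)) + z * (W / p.2))).sum ≤ (pos.map (fun p => W * ((fun p : ℕ × ℕ => cntAP (Y+z) (p.1+D, p.2)) ∘ rst T) p)).sum := by
      apply list_nat_le
      intro p hpp
      obtain ⟨⟨a1, a2⟩, a3⟩ := hp p hpp
      obtain ⟨w, hw⟩ := a2
      have hw2 : W / p.2 = w := by rw [hw]; exact Nat.mul_div_cancel_left w a1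
      rw [hw2]
      simp only [Function.comp, cntAP]
      have r2 : (rst T p).2 = p.2 := rfl
      rw [r2]
      have m1 := Nat.div_add_mod (Y + z + p.2 - ((rst T p).1 + D)) p.2
      have m2 := Nat.mod_lt (Y + z + p.2 - ((rst T p).1 + D)) a1
      have e3 : (Y + 1 - (D + (rst T p).1)) + z ≤ p.2 * ((Y + z + p.2 - ((rst T p).1 + D)) / p.2) := by omega
      calc _ = w * ((Y + 1 - (D + (rst T p).1)) + z) := by ring
        _ ≤ _ := Nat.mul_le_mul_left w e3
        _ = _ := by rw [hw]; ring
    simp only [List.sum_map_add, List.sum_map_mul_left] at c1 c2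
    have c3 := Nat.mul_le_mul_left z hs
    omega)
  simp only [List.map_map] at t2 ⊢
  linarith

end M2

namespace M2

/-- Membership in the numerical semigroup generated by `a` and `b`. -/
def sgAB (a b d : ℕ) : Bool := (List.range (d / b + 1)).any (fun j => (d - b * j) % a == 0)

theorem chk0 : chk (sgAB 3 13) 24 100 21912660 699
    [(13, 20), (8, 5), (36, 21), (29, 17), (50, 28), (50, 28)]
    [(18, 20), (33, 15), (24, 11), (60, 27), (69, 31), (42, 36), (42, 36), (101, 44), 
    (101, 44), (39, 660)]
    [(8, 24), (13, 35), (13, 39), (18, 18), (23, 42), (29, 38), (33, 33), (33, 48), (36, 42), 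
    (38, 57), (46, 46), (48, 60), (50, 63), (57, 69), (58, 58), (63, 78), (63, 78), 
    (68, 68), (73, 79), (78, 78), (78, 78), (78, 87), (78, 90), (93, 93), (98, 98)]
    [28, 43, 50, 53, 53, 73, 80, 83, 88, 93, 97, 99] = true := by decide +kernel

theorem chk1 : chk (fun _ => true) 0 0 420 56
    [(14, 12), (5, 12), (11, 12), (11, 12)]
    [(7, 20), (12, 20), (17, 20), (17, 20), (42, 28), (42, 28)]
    []
    [] = true := by decide +kernel

theorem chk2 : chk (sgAB 5 11) 40 60 2426169212567100 128
    [(1, 4), (2, 4), (9, 12), (3, 3), (23, 19), (43, 35), (8, 7), (28, 23), (48, 39), 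
    (68, 55), (88, 71)]
    [(6, 12), (22, 13), (50, 29), (78, 45), (15, 9), (43, 25), (71, 41), (99, 57), (127, 73), 
    (23, 20), (23, 20), (36, 28), (36, 28)]
    [(6, 6), (15, 15), (18, 18), (18, 23), (22, 22), (23, 23), (24, 24), (30, 30), (30, 35), 
    (33, 33), (36, 36), (36, 36), (38, 43), (42, 42), (42, 42), (43, 43), (43, 43), 
    (48, 48), (50, 50), (51, 51), (54, 54)]
    [1, 2, 3, 5, 6, 8, 9, 9, 9, 10, 12, 13, 14, 15, 17, 21, 21, 21, 22, 25, 26, 27, 28, 29, 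
    29, 33, 33, 34, 37, 39, 41, 42, 45, 45, 45, 46, 48, 49, 50, 51, 53, 54, 57, 57, 57, 
    57, 58] = true := by decide +kernel

theorem chk3 : chk (sgAB 7 9) 48 150 3222778143152439166194900 243
    [(3, 4), (2, 4), (6, 12), (8, 7), (28, 23), (48, 39), (68, 55), (88, 71), (108, 87), 
    (13, 11), (33, 27), (53, 43), (73, 59)]
    [(3, 12), (15, 9), (43, 25), (71, 41), (99, 57), (127, 73), (155, 89), (8, 5), (36, 21), 
    (64, 37), (92, 53), (120, 69), (28, 20), (28, 20), (29, 28), (29, 28)]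
    [(3, 3), (8, 8), (13, 13), (14, 28), (15, 15), (15, 15), (18, 18), (19, 28), (22, 29), 
    (23, 23), (24, 24), (26, 33), (27, 27), (28, 28), (29, 29), (30, 39), (33, 33), 
    (34, 48), (36, 36), (38, 38), (39, 48), (42, 42), (43, 43), (43, 43), (48, 48), 
    (50, 57), (50, 57), (51, 51), (51, 51), (53, 53), (54, 63), (54, 68), (57, 57), 
    (57, 64), (58, 58), (59, 68), (60, 60), (62, 69), (63, 63), (64, 71), (68, 68), 
    (68, 68), (71, 78), (71, 78), (73, 73), (74, 88), (75, 75), (78, 78), (78, 85), 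
    (78, 85), (79, 88), (79, 93), (83, 83), (85, 92), (86, 93), (87, 87), (87, 87), 
    (88, 88), (90, 99), (91, 98), (92, 99), (94, 101), (96, 96), (98, 105), (99, 99), 
    (99, 108), (101, 108), (102, 111), (103, 103), (106, 113), (106, 113), (107, 114), 
    (108, 108), (111, 118), (112, 112), (113, 113), (114, 123), (114, 128), (114, 128), 
    (118, 118), (119, 128), (120, 120), (120, 120), (123, 123), (123, 123), (123, 132), 
    (126, 133), (127, 127), (132, 141), (134, 141), (134, 141), (134, 141), (135, 135), 
    (138, 138), (138, 138), (141, 148), (141, 148), (143, 143), (143, 143), (145, 145), 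
    (147, 147), (148, 148)]
    [2, 6, 6, 7, 10, 11, 18, 22, 30, 31, 35, 35, 42, 46, 46, 47, 55, 66, 66, 67, 70, 74, 82, 
    87, 90, 90, 95, 97, 102, 110, 115, 122, 126, 126, 127, 130, 131, 139, 139, 142, 146] = true := by decide +kernel

/-- Double sums. -/
def SD (φ : ℕ → ℤ) (X : ℕ) (st sp : ℕ → ℕ) : ℤ := ∑ n ∈ Finset.range (X+1), AA φ X (st n, sp n)

/-- The double sum over `16 * n * k + a * n + b * k + c`. -/
def GD (φ : ℕ → ℤ) (X a b c : ℕ) : ℤ := SD φ X (fun n => a * n + c) (fun n => 16 * n + b)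

section
variable {φ : ℕ → ℤ} {X : ℕ} {sg : ℕ → Bool} {D : ℕ}

lemma AA_zero {p : ℕ × ℕ} (hX : ∀ s, X < s → φ s = 0) (hp : X < p.1) : AA φ X p = 0 :=
  Finset.sum_eq_zero fun k _ => hX _ (by omega)

lemma SD_peel (hX : ∀ s, X < s → φ s = 0) {st sp : ℕ → ℕ} (h : ∀ n, n ≤ st n) :
    SD φ X st sp = AA φ X (st 0, sp 0) + SD φ X (fun n => st (n+1)) (fun n => sp (n+1)) := by
  simp only [SD]
  have h1 := Finset.sum_range_succ' (fun n => AA φ X (st n, sp n)) (X+1)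
  have h2 := Finset.sum_range_succ (fun n => AA φ X (st n, sp n)) (X+1)
  rw [AA_zero hX (show X < (st (X+1), sp (X+1)).1 from h (X+1)), add_zero] at h2
  rw [← h2, h1, add_comm]

lemma GD_swap (a b c : ℕ) : GD φ X a b c = GD φ X b a c := by
  simp only [GD, SD, AA]
  rw [Finset.sum_comm]
  refine Finset.sum_congr rfl fun n _ => Finset.sum_congr rfl fun k _ => ?_
  congr 1; ring

/-- Peel off the row `n = 0`. -/
lemma GD_peel (hX : ∀ s, X < s → φ s = 0) (a b c a' c' : ℕ) (ha : 1 ≤ a) (hb : b + 16 = a') (hc : a + c = c') :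
    GD φ X a b c = AA φ X (c, b) + GD φ X a a' c' := by
  subst hb hc
  rw [GD, SD_peel hX (fun n => by nlinarith)]
  congr 1
  · simp
  · rw [GD]
    congr 1
    · funext n; ring
    · funext n; ring

/-- Peel off the column `k = 0`. -/
lemma GD_peel' (hX : ∀ s, X < s → φ s = 0) (a b c a' c' : ℕ) (hb : 1 ≤ b) (ha : a + 16 = a') (hc : b + c = c') :
    GD φ X a b c = AA φ X (c, a) + GD φ X a' b c' := by
  rw [GD_swap, GD_peel hX b a c a' c' hb ha hc, GD_swap b]

lemma SD_le (h : Ad φ X sg D) {st sp st' sp' : ℕ → ℕ} (hl : ∀ n k, st n + k * sp n + D ≤ st' n + k * sp' n) :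
    SD φ X st' sp' ≤ SD φ X st sp := by
  refine Finset.sum_le_sum fun n _ => Finset.sum_le_sum fun k _ => ?_
  have := hl n k
  obtain ⟨d, hd⟩ := Nat.exists_eq_add_of_le this
  simp only
  rw [hd, add_assoc]
  exact h.mono_D _ _ (by omega)

lemma GD_le (h : Ad φ X sg D) {a b c a' b' c' : ℕ} (ha : a ≤ a') (hb : b ≤ b') (hc : c + D ≤ c') :
    GD φ X a' b' c' ≤ GD φ X a b c := by
  apply SD_le h
  intro n k
  have := Nat.mul_le_mul_right n ha
  have := Nat.mul_le_mul_left k hb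
  simp only [mul_add]
  omega

lemma AA_nonneg (h : Ad φ X sg D) (p : ℕ × ℕ) : 0 ≤ AA φ X p := Finset.sum_nonneg fun _ _ => h.nonneg _

lemma AA_le_sg (h : Ad φ X sg D) (s t d : ℕ) (hd : sg t = true) : AA φ X (s+t, d) ≤ AA φ X (s, d) := by
  refine Finset.sum_le_sum fun k _ => ?_
  simp only
  rw [show s + t + k*d = s+k*d+t by ring]
  exact h.mono_sg _ _ hd

lemma le_AA (h : Ad φ X sg D) (s d : ℕ) (k : ℕ) (hk : k ≤ X) : φ (s + k*d) ≤ AA φ X (s, d) :=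
  Finset.single_le_sum (f := fun k => φ (s+k*d)) (fun _ _ => h.nonneg _) (Finset.mem_range.mpr (by omega))

theorem case2 (h : Ad φ X (sgAB 5 11) 40) :
    AA φ X (0, 4) + AA φ X (2, 4) ≤ (GD φ X 3 4 0 - GD φ X 13 12 9) + (GD φ X 7 4 1 - GD φ X 9 12 6)
      + 2 * (SD φ X (fun n => 32*n^2+26*n+2) (fun n => 32*n+4) - SD φ X (fun n => 32*n^2+58*n+23) (fun n => 32*n+20)
      + (SD φ X (fun n => 32*n^2+38*n+9) (fun n => 32*n+12) - SD φ X (fun n => 32*n^2+70*n+36) (fun n => 32*n+28))) := by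
  have hp := pool_of_chk h chk2
  have v := h.vanish
  simp only [List.map_cons, List.map_nil, List.sum_cons, List.sum_nil] at hp
  rw [GD_peel v 3 4 0 20 3 (by norm_num) rfl rfl, GD_peel' v 3 20 3 19 23 (by norm_num) rfl rfl,
    GD_peel' v 19 20 23 35 43 (by norm_num) rfl rfl, GD_peel' v 35 20 43 51 63 (by norm_num) rfl rfl,
    GD_peel v 13 12 9 28 22 (by norm_num) rfl rfl, GD_peel' v 13 28 22 29 50 (by norm_num) rfl rfl,
    GD_peel' v 29 28 50 45 78 (by norm_num) rfl rfl, GD_peel' v 45 28 78 61 106 (by norm_num) rfl rfl,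
    GD_peel v 7 4 1 20 8 (by norm_num) rfl rfl, GD_peel' v 7 20 8 23 28 (by norm_num) rfl rfl,
    GD_peel' v 23 20 28 39 48 (by norm_num) rfl rfl, GD_peel' v 39 20 48 55 68 (by norm_num) rfl rfl,
    GD_peel' v 55 20 68 71 88 (by norm_num) rfl rfl, GD_peel' v 71 20 88 87 108 (by norm_num) rfl rfl,
    GD_peel v 9 12 6 28 15 (by norm_num) rfl rfl, GD_peel' v 9 28 15 25 43 (by norm_num) rfl rfl,
    GD_peel' v 25 28 43 41 71 (by norm_num) rfl rfl, GD_peel' v 41 28 71 57 99 (by norm_num) rfl rfl,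
    GD_peel' v 57 28 99 73 127 (by norm_num) rfl rfl, GD_peel' v 73 28 127 89 155 (by norm_num) rfl rfl]
  rw [SD_peel v (st := fun n => 32*n^2+26*n+2) (by intro n; nlinarith), SD_peel v (st := fun n => 32*n^2+58*n+23) (by intro n; nlinarith),
    SD_peel v (st := fun n => 32*n^2+38*n+9) (by intro n; nlinarith), SD_peel v (st := fun n => 32*n^2+70*n+36) (by intro n; nlinarith)]
  have g1 : GD φ X 61 28 106 ≤ GD φ X 51 20 63 := GD_le h (by norm_num) (by norm_num) (by norm_num)
  have g2 : GD φ X 89 28 155 ≤ GD φ X 87 20 108 := GD_le h (by norm_num) (by norm_num) (by norm_num)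
  have l1 : SD φ X (fun n => 32*(n+1)^2+58*(n+1)+23) (fun n => 32*(n+1)+20) ≤ SD φ X (fun n => 32*(n+1)^2+26*(n+1)+2) (fun n => 32*(n+1)+4) :=
    SD_le h (by intro n k; nlinarith)
  have l2 : SD φ X (fun n => 32*(n+1)^2+70*(n+1)+36) (fun n => 32*(n+1)+28) ≤ SD φ X (fun n => 32*(n+1)^2+38*(n+1)+9) (fun n => 32*(n+1)+12) :=
    SD_le h (by intro n k; nlinarith)
  norm_num at l1 l2 ⊢
  linarith

theorem case3 (h : Ad φ X (sgAB 7 9) 48) :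
    AA φ X (1, 4) + AA φ X (3, 4) ≤ (GD φ X 7 4 1 - GD φ X 9 12 6) - (GD φ X 5 12 3 - GD φ X 11 4 2)
      + 2 * (SD φ X (fun n => 32*n^2+34*n+3) (fun n => 32*n+4) - SD φ X (fun n => 32*n^2+66*n+28) (fun n => 32*n+20)
      + (SD φ X (fun n => 32*n^2+30*n+6) (fun n => 32*n+12) - SD φ X (fun n => 32*n^2+62*n+29) (fun n => 32*n+28))) := by
  have hp := pool_of_chk h chk3
  have v := h.vanish
  simp only [List.map_cons, List.map_nil, List.sum_cons, List.sum_nil] at hp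
  rw [GD_peel v 7 4 1 20 8 (by norm_num) rfl rfl, GD_peel' v 7 20 8 23 28 (by norm_num) rfl rfl,
    GD_peel' v 23 20 28 39 48 (by norm_num) rfl rfl, GD_peel' v 39 20 48 55 68 (by norm_num) rfl rfl,
    GD_peel' v 55 20 68 71 88 (by norm_num) rfl rfl, GD_peel' v 71 20 88 87 108 (by norm_num) rfl rfl,
    GD_peel' v 87 20 108 103 128 (by norm_num) rfl rfl,
    GD_peel v 9 12 6 28 15 (by norm_num) rfl rfl, GD_peel' v 9 28 15 25 43 (by norm_num) rfl rfl,
    GD_peel' v 25 28 43 41 71 (by norm_num) rfl rfl, GD_peel' v 41 28 71 57 99 (by norm_num) rfl rfl,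
    GD_peel' v 57 28 99 73 127 (by norm_num) rfl rfl, GD_peel' v 73 28 127 89 155 (by norm_num) rfl rfl,
    GD_peel' v 89 28 155 105 183 (by norm_num) rfl rfl,
    GD_peel v 5 12 3 28 8 (by norm_num) rfl rfl, GD_peel' v 5 28 8 21 36 (by norm_num) rfl rfl,
    GD_peel' v 21 28 36 37 64 (by norm_num) rfl rfl, GD_peel' v 37 28 64 53 92 (by norm_num) rfl rfl,
    GD_peel' v 53 28 92 69 120 (by norm_num) rfl rfl, GD_peel' v 69 28 120 85 148 (by norm_num) rfl rfl,
    GD_peel v 11 4 2 20 13 (by norm_num) rfl rfl, GD_peel' v 11 20 13 27 33 (by norm_num) rfl rfl,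
    GD_peel' v 27 20 33 43 53 (by norm_num) rfl rfl, GD_peel' v 43 20 53 59 73 (by norm_num) rfl rfl,
    GD_peel' v 59 20 73 75 93 (by norm_num) rfl rfl]
  rw [SD_peel v (st := fun n => 32*n^2+34*n+3) (by intro n; nlinarith), SD_peel v (st := fun n => 32*n^2+66*n+28) (by intro n; nlinarith),
    SD_peel v (st := fun n => 32*n^2+30*n+6) (by intro n; nlinarith), SD_peel v (st := fun n => 32*n^2+62*n+29) (by intro n; nlinarith)]
  have g1 : GD φ X 105 28 183 ≤ GD φ X 103 20 128 := GD_le h (by norm_num) (by norm_num) (by norm_num)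
  have g2 : GD φ X 85 28 148 ≤ GD φ X 75 20 93 := GD_le h (by norm_num) (by norm_num) (by norm_num)
  have l1 : SD φ X (fun n => 32*(n+1)^2+66*(n+1)+28) (fun n => 32*(n+1)+20) ≤ SD φ X (fun n => 32*(n+1)^2+34*(n+1)+3) (fun n => 32*(n+1)+4) :=
    SD_le h (by intro n k; nlinarith)
  have l2 : SD φ X (fun n => 32*(n+1)^2+62*(n+1)+29) (fun n => 32*(n+1)+28) ≤ SD φ X (fun n => 32*(n+1)^2+30*(n+1)+6) (fun n => 32*(n+1)+12) :=
    SD_le h (by intro n k; nlinarith)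
  norm_num at l1 l2 ⊢
  linarith

theorem case1 (h : Ad φ X (fun _ => true) 0) :
    φ 2 + (φ 0 - φ 1) ≤ (GD φ X 5 12 2 - GD φ X 11 4 1) - (GD φ X 7 4 0 - GD φ X 9 12 5)
      + 2 * (SD φ X (fun n => 32*n^2+18*n) (fun n => 32*n+4) - SD φ X (fun n => 32*n^2+50*n+17) (fun n => 32*n+20)
      + (SD φ X (fun n => 32*n^2+46*n+11) (fun n => 32*n+12) - SD φ X (fun n => 32*n^2+78*n+42) (fun n => 32*n+28))) := by
  have hp := pool_of_chk h chk1
  have v := h.vanish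
  simp only [List.map_cons, List.map_nil, List.sum_cons, List.sum_nil] at hp
  rw [GD_peel v 5 12 2 28 7 (by norm_num) rfl rfl, AA_peel v 2 12 (by norm_num), GD_peel v 11 4 1 20 12 (by norm_num) rfl rfl,
    GD_peel v 11 20 12 36 23 (by norm_num) rfl rfl, GD_peel v 7 4 0 20 7 (by norm_num) rfl rfl,
    GD_peel v 7 20 7 36 14 (by norm_num) rfl rfl, GD_peel v 9 12 5 28 14 (by norm_num) rfl rfl]
  rw [SD_peel v (st := fun n => 32*n^2+18*n) (by intro n; nlinarith), SD_peel v (st := fun n => 32*n^2+50*n+17) (by intro n; nlinarith),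
    SD_peel v (st := fun n => 32*n^2+46*n+11) (by intro n; nlinarith), SD_peel v (st := fun n => 32*n^2+78*n+42) (by intro n; nlinarith)]
  have g1 : GD φ X 7 36 14 ≤ GD φ X 5 28 7 := GD_le h (by norm_num) (by norm_num) (by norm_num)
  have g2 : GD φ X 11 36 23 ≤ GD φ X 9 28 14 := GD_le h (by norm_num) (by norm_num) (by norm_num)
  have l1 : SD φ X (fun n => 32*(n+1)^2+50*(n+1)+17) (fun n => 32*(n+1)+20) ≤ SD φ X (fun n => 32*(n+1)^2+18*(n+1)) (fun n => 32*(n+1)+4) :=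
    SD_le h (by intro n k; nlinarith)
  have l2 : SD φ X (fun n => 32*(n+1)^2+78*(n+1)+42) (fun n => 32*(n+1)+28) ≤ SD φ X (fun n => 32*(n+1)^2+46*(n+1)+11) (fun n => 32*(n+1)+12) :=
    SD_le h (by intro n k; nlinarith)
  have t : φ 0 - φ 1 ≤ AA φ X (0, 4) - AA φ X (1, 4) := by
    rw [AA_peel v 0 4 (by norm_num), AA_peel v 1 4 (by norm_num)]
    have := AA_le_sg h (0+4) 1 4 rfl
    norm_num at this ⊢
    linarith
  norm_num at l1 l2 ⊢ hp
  linarith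

lemma sum_four (f : ℕ → ℤ) (m : ℕ) : ∑ k ∈ Finset.range (4*m), f k =
    ∑ k ∈ Finset.range m, f (0+k*4) + ∑ k ∈ Finset.range m, f (1+k*4) + ∑ k ∈ Finset.range m, f (2+k*4) + ∑ k ∈ Finset.range m, f (3+k*4) := by
  induction m with
  | zero => simp
  | succ m ih =>
    rw [show 4*(m+1) = 4*m+1+1+1+1 by ring]
    simp only [Finset.sum_range_succ, ih]
    rw [show 0 + m*4 = 4*m by ring, show 1 + m*4 = 4*m+1 by ring, show 2 + m*4 = 4*m+1+1 by ring, show 3 + m*4 = 4*m+1+1+1 by ring]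
    ring

lemma AA_four (hX : ∀ s, X < s → φ s = 0) : AA φ X (0, 1) = AA φ X (0,4) + AA φ X (1,4) + AA φ X (2,4) + AA φ X (3,4) := by
  simp only [AA]
  rw [← sum_four φ (X+1)]
  symm
  have : Finset.range (X+1) ⊆ Finset.range (4*(X+1)) := by
    intro a; simp only [Finset.mem_range]; omega
  rw [← Finset.sum_subset this]
  · simp
  · intro x _ hx
    simp only [Finset.mem_range] at hx
    exact hX _ (by omega)

/-- Raw one-dimensional lower bound for the case `c = 0`. -/
theorem case0 (h : Ad φ X (sgAB 3 13) 24) :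
    - φ 0 + (AA φ X (1,4) - AA φ X (4,4)) + (AA φ X (12,12) + AA φ X (3,12) - 2 * AA φ X (15,12)) +
      ((([(13, 20), (8, 5), (36, 21), (29, 17), (50, 28), (50, 28)] : List (ℕ × ℕ)).map (AA φ X)).sum
       - (([(18, 20), (33, 15), (24, 11), (60, 27), (69, 31), (42, 36), (42, 36), (101, 44), (101, 44)] : List (ℕ × ℕ)).map (AA φ X)).sum)
     ≤ (GD φ X 1 12 0 - GD φ X 15 4 3) + (GD φ X 5 12 3 - GD φ X 11 4 2)
      - 2 * (SD φ X (fun n => 32*n^2+10*n) (fun n => 32*n+4) - SD φ X (fun n => 32*n^2+42*n+13) (fun n => 32*n+20)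
      + (SD φ X (fun n => 32*n^2+54*n+15) (fun n => 32*n+12) - SD φ X (fun n => 32*n^2+86*n+50) (fun n => 32*n+28))) := by
  have v := h.vanish
  simp only [List.map_cons, List.map_nil, List.sum_cons, List.sum_nil]
  rw [GD_peel' v 1 12 0 17 12 (by norm_num) rfl rfl, GD_peel v 17 12 12 28 29 (by norm_num) rfl rfl,
    GD_peel' v 17 28 29 33 57 (by norm_num) rfl rfl, GD_peel v 5 12 3 28 8 (by norm_num) rfl rfl,
    GD_peel' v 5 28 8 21 36 (by norm_num) rfl rfl, GD_peel' v 21 28 36 37 64 (by norm_num) rfl rfl,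
    GD_peel v 15 4 3 20 18 (by norm_num) rfl rfl, GD_peel v 15 20 18 36 33 (by norm_num) rfl rfl,
    GD_peel' v 15 36 33 31 69 (by norm_num) rfl rfl, GD_peel' v 31 36 69 47 105 (by norm_num) rfl rfl,
    GD_peel v 11 4 2 20 13 (by norm_num) rfl rfl, GD_peel v 11 20 13 36 24 (by norm_num) rfl rfl,
    GD_peel' v 11 36 24 27 60 (by norm_num) rfl rfl, GD_peel' v 27 36 60 43 96 (by norm_num) rfl rfl]
  rw [SD_peel v (st := fun n => 32*n^2+10*n) (by intro n; nlinarith), SD_peel v (st := fun n => 32*n^2+42*n+13) (by intro n; nlinarith),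
    SD_peel v (st := fun n => 32*n^2+54*n+15) (by intro n; nlinarith), SD_peel v (st := fun n => 32*n^2+86*n+50) (by intro n; nlinarith)]
  rw [SD_peel v (st := fun n => 32*(n+1)^2+10*(n+1)) (by intro n; nlinarith), SD_peel v (st := fun n => 32*(n+1)^2+54*(n+1)+15) (by intro n; nlinarith)]
  have g1 : GD φ X 43 36 96 ≤ GD φ X 37 28 64 := GD_le h (by norm_num) (by norm_num) (by norm_num)
  have g2 : GD φ X 47 36 105 ≤ GD φ X 33 28 57 := GD_le h (by norm_num) (by norm_num) (by norm_num)
  have l1 : SD φ X (fun n => 32*(n+1+1)^2+10*(n+1+1)) (fun n => 32*(n+1+1)+4) ≤ SD φ X (fun n => 32*(n+1)^2+42*(n+1)+13) (fun n => 32*(n+1)+20) :=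
    SD_le h (by intro n k; nlinarith)
  have l2 : SD φ X (fun n => 32*(n+1+1)^2+54*(n+1+1)+15) (fun n => 32*(n+1+1)+12) ≤ SD φ X (fun n => 32*(n+1)^2+86*(n+1)+50) (fun n => 32*(n+1)+28) :=
    SD_le h (by intro n k; nlinarith)
  have t := AA_four v
  have t2 := AA_peel v 0 4 (by norm_num)
  norm_num at l1 l2 ⊢ t t2
  linarith

theorem case0_pool (h : Ad φ X (sgAB 3 13) 24) : 
    φ 39 ≤ (AA φ X (12,12) + AA φ X (3,12) - 2 * AA φ X (15,12)) +
     ((([(13, 20), (8, 5), (36, 21), (29, 17), (50, 28), (50, 28)] : List (ℕ × ℕ)).map (AA φ X)).sum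
       - (([(18, 20), (33, 15), (24, 11), (60, 27), (69, 31), (42, 36), (42, 36), (101, 44), (101, 44)] : List (ℕ × ℕ)).map (AA φ X)).sum) := by
  have hp := pool_of_chk h chk0
  have a1 := AA_le_sg h 12 3 12 (by decide +kernel)
  have a2 := AA_le_sg h 3 12 12 (by decide +kernel)
  have a3 := le_AA h 39 660 0 (Nat.zero_le _)
  simp only [List.map_cons, List.map_nil, List.sum_cons, List.sum_nil] at hp ⊢
  norm_num at a1 a2 a3
  linarith

end

end M2

namespace M2
open PowerSeries

noncomputable def gi (b : ℕ) : PowerSeries ℤ := invOfUnit (1 - X^b) 1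

lemma gi_inv (b : ℕ) (hb : 1 ≤ b) : (1 - X^b) * gi b = 1 := by
  apply mul_invOfUnit
  simp [show b ≠ 0 by omega]

lemma gi_rec (b : ℕ) (hb : 1 ≤ b) (K : PowerSeries ℤ) (m : ℕ) :
    coeff m (gi b * K) = coeff m K + if b ≤ m then coeff (m-b) (gi b * K) else 0 := by
  have e : gi b * K = K + X^b * (gi b * K) := by
    have := gi_inv b hb
    linear_combination K * this
  conv_lhs => rw [e]
  rw [map_add, coeff_X_pow_mul']

lemma gi_nonneg (b : ℕ) (hb : 1 ≤ b) (K : PowerSeries ℤ) (N : ℕ) (h : ∀ m ≤ N, 0 ≤ coeff m K) :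
    ∀ m ≤ N, coeff m K ≤ coeff m (gi b * K) ∧ 0 ≤ coeff m (gi b * K) := by
  intro m
  induction m using Nat.strong_induction_on with
  | _ m ih =>
    intro hm
    have hh := h m hm
    rw [gi_rec b hb K m]
    split_ifs with h1
    · have := (ih (m-b) (by omega) (by omega)).2
      constructor <;> linarith
    · constructor <;> linarith

def Good (N : ℕ) (F : PowerSeries ℤ) : Prop := (∀ m ≤ N, 0 ≤ coeff m F) ∧ 0 < coeff N F

lemma Good.gi {N : ℕ} {F : PowerSeries ℤ} (h : Good N F) (b : ℕ) (hb : 1 ≤ b) : Good N (gi b * F) := by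
  have := gi_nonneg b hb F N h.1
  exact ⟨fun m hm => (this m hm).2, lt_of_lt_of_le h.2 (this N le_rfl).1⟩

lemma Good.prod {N : ℕ} {F : PowerSeries ℤ} (h : Good N F) (M : ℕ) (f : ℕ → ℕ) (hf : ∀ i, 1 ≤ f i) :
    Good N ((∏ i ∈ Finset.range M, M2.gi (f i)) * F) := by
  induction M with
  | zero => simpa using h
  | succ M ih =>
    rw [Finset.prod_range_succ, mul_comm (∏ i ∈ Finset.range M, M2.gi (f i)), mul_assoc]
    exact ih.gi _ (hf M)

lemma prod_gg (M : ℕ) (f : ℕ → ℕ) (hf : ∀ i, 1 ≤ f i) :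
    (∏ i ∈ Finset.range M, (1 - X^(f i) : PowerSeries ℤ)) * ∏ i ∈ Finset.range M, gi (f i) = 1 := by
  rw [← Finset.prod_mul_distrib]
  exact Finset.prod_eq_one fun i _ => gi_inv _ (hf i)

/-- The reciprocal of the tail of `PJ`. -/
noncomputable def GT (j M : ℕ) : PowerSeries ℤ :=
  (∏ i ∈ Finset.range (M+1), gi (16*i+16)) * ((∏ i ∈ Finset.range M, gi (16*i+24+j)) * ∏ i ∈ Finset.range M, gi (16*i+24-j))

lemma PJ_inv (j M : ℕ) (hj : j < 8) : PJ j (M+1) * (GT j M * (gi (8+j) * gi (8-j))) = 1 := by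
  have h1 := prod_gg (M+1) (fun i => 16*i+16) (fun i => by omega)
  have h2 := prod_gg M (fun i => 16*i+24+j) (fun i => by omega)
  have h3 := prod_gg M (fun i => 16*i+24-j) (fun i => by omega)
  have h4 := gi_inv (8+j) (by omega)
  have h5 := gi_inv (8-j) (by omega)
  have e : PJ j (M+1) = (∏ i ∈ Finset.range (M+1), (1 - X^(16*i+16))) * (((∏ i ∈ Finset.range M, (1 - X^(16*i+24+j))) *
     (∏ i ∈ Finset.range M, (1 - X^(16*i+24-j)))) * ((1 - X^(8+j)) * (1 - X^(8-j)))) := by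
    rw [PJ, Finset.prod_range_succ' (fun i => (1 - X^(16*i+8+j)) * (1 - X^(16*i+8-j)))]
    rw [← Finset.prod_mul_distrib]
    simp only [mul_zero, zero_add]
    congr 3
  rw [e, GT]
  calc _ = ((∏ i ∈ Finset.range (M+1), (1 - X^(16*i+16) : PowerSeries ℤ)) * ∏ i ∈ Finset.range (M+1), gi (16*i+16)) *
      ((∏ i ∈ Finset.range M, (1 - X^(16*i+24+j) : PowerSeries ℤ)) * ∏ i ∈ Finset.range M, gi (16*i+24+j)) *
      ((∏ i ∈ Finset.range M, (1 - X^(16*i+24-j) : PowerSeries ℤ)) * ∏ i ∈ Finset.range M, gi (16*i+24-j)) *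
      ((1 - X^(8+j)) * gi (8+j)) * ((1 - X^(8-j)) * gi (8-j)) := by ring
    _ = 1 := by rw [h1, h2, h3, h4, h5]; ring

lemma coeff_from_AP (c N j : ℕ) (hj : j < 8) (NUM G : PowerSeries ℤ) (hG : PJ j (N+2) * G = 1)
    (h : AP N (fun Q => VV c Q * TM Q 8 j) (toC NUM)) : vv c N = ((coeff N (NUM * G) : ℤ) : ℂ) := by
  have h1 := (VV_AP N c).mul (TM_AP N j hj)
  have h2 := h1.unique h
  have e : PowerSeries.mk (vv c) = (PowerSeries.mk (vv c) * toC (PJ j (N+2))) * toC G := by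
    rw [mul_assoc, ← map_mul, hG, map_one, mul_one]
  have e2 : coeff N (PowerSeries.mk (vv c)) = coeff N (toC NUM * toC G) := by
    rw [e, coeff_mul, coeff_mul]
    apply Finset.sum_congr rfl
    intro p hp
    rw [Finset.HasAntidiagonal.mem_antidiagonal] at hp
    rw [h2 p.1 (by omega)]
  rw [coeff_mk, ← map_mul] at e2
  rw [e2, toC, coeff_map]; rfl

/-- The weight attached to a kernel series. -/
noncomputable def ph (H : PowerSeries ℤ) (x s : ℕ) : ℤ := if s ≤ x then coeff (x-s) H else 0

lemma coeff_FF (N x : ℕ) (H : PowerSeries ℤ) (st sp : ℕ → ℕ) : coeff x (FF N st sp * H) = SD (ph H x) N st sp := by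
  simp only [FF, SD, AA, Finset.sum_mul, map_sum, coeff_X_pow_mul', ph]

lemma Ad_of (a b : ℕ) (H : PowerSeries ℤ) (h0 : ∀ m, 0 ≤ coeff m H) (ha : ∀ m, coeff m H ≤ coeff (m+a) H)
    (hb : ∀ m, coeff m H ≤ coeff (m+b) H) (x N D : ℕ) (hx : x ≤ N) (hD : ∀ d, D ≤ d → ∃ i j, d = a*i+b*j) :
    Ad (ph H x) N (sgAB a b) D := by
  have nn : ∀ s, 0 ≤ ph H x s := by
    intro s; rw [ph]; split_ifs; exacts [h0 _, le_rfl]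
  have step : ∀ c, (∀ m, coeff m H ≤ coeff (m+c) H) → ∀ s, ph H x (s+c) ≤ ph H x s := by
    intro c hc s
    by_cases h1 : s + c ≤ x
    · rw [ph, if_pos h1, ph, if_pos (by omega)]
      have := hc (x - (s+c))
      rwa [show x - (s+c) + c = x - s by omega] at this
    · rw [ph, if_neg h1]; exact nn s
  have steps : ∀ c, (∀ m, coeff m H ≤ coeff (m+c) H) → ∀ i s, ph H x (s+c*i) ≤ ph H x s := by
    intro c hc i
    induction i with
    | zero => intro s; simp
    | succ i ih => intro s; rw [mul_add, mul_one, ← add_assoc]; exact (step c hc _).trans (ih s)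
  have comb : ∀ i j s, ph H x (s+(a*i+b*j)) ≤ ph H x s := by
    intro i j s
    rw [← add_assoc]
    exact (steps b hb j _).trans (steps a ha i s)
  refine ⟨nn, fun s hs => if_neg (by omega), ?_, ?_⟩
  · intro s d hd
    simp only [sgAB, List.any_eq_true, List.mem_range, beq_iff_eq] at hd
    obtain ⟨j, hj, hm⟩ := hd
    have h1 : b * j ≤ d := le_trans (Nat.mul_le_mul_left b (show j ≤ d / b by omega)) (Nat.mul_div_le d b)
    have h2 := Nat.div_add_mod (d - b*j) a
    have := comb ((d-b*j)/a) j s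
    rwa [show a * ((d-b*j)/a) + b*j = d by omega] at this
  · intro s d hd
    obtain ⟨i, j, rfl⟩ := hD d hd
    exact comb i j s

lemma gi_one_nonneg (b : ℕ) (hb : 1 ≤ b) (m : ℕ) : 0 ≤ coeff m (gi b) := by
  have := (gi_nonneg b hb 1 m (fun k _ => by rw [coeff_one]; split_ifs <;> norm_num) m le_rfl).2
  rwa [mul_one] at this

lemma ggg_nonneg (a b : ℕ) (ha : 1 ≤ a) (hb : 1 ≤ b) (m : ℕ) : 0 ≤ coeff m (gi a * gi b) :=
  (gi_nonneg a ha (gi b) m (fun k _ => gi_one_nonneg b hb k) m le_rfl).2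

lemma ggg_mono (a b : ℕ) (ha : 1 ≤ a) (hb : 1 ≤ b) (m : ℕ) : coeff m (gi a * gi b) ≤ coeff (m+a) (gi a * gi b) := by
  rw [gi_rec a ha (gi b) (m+a), if_pos (by omega), Nat.add_sub_cancel]
  have := gi_one_nonneg b hb (m+a)
  linarith

lemma ggg_zero (a b : ℕ) (ha : 1 ≤ a) (hb : 1 ≤ b) : coeff 0 (gi a * gi b) = 1 := by
  rw [gi_rec a ha, if_neg (by omega), add_zero, ← mul_one (gi b), gi_rec b hb, if_neg (by omega)]
  simp

lemma Ad_gg (a b : ℕ) (ha : 1 ≤ a) (hb : 1 ≤ b) (x N D : ℕ) (hx : x ≤ N) (hD : ∀ d, D ≤ d → ∃ i j, d = a*i+b*j) :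
    Ad (ph (gi b * gi a) x) N (sgAB a b) D := by
  refine Ad_of a b _ (ggg_nonneg b a hb ha) ?_ (ggg_mono b a hb ha) x N D hx hD
  rw [mul_comm]; exact ggg_mono a b ha hb

lemma coeff_gg_one (m : ℕ) : coeff m (gi 1) = 1 := by
  induction m with
  | zero => rw [← mul_one (gi 1), gi_rec 1 le_rfl]; simp
  | succ m ih =>
    rw [← mul_one (gi 1), gi_rec 1 le_rfl, if_pos (by omega), Nat.add_sub_cancel, mul_one, ih, coeff_one, if_neg (by omega)]
    norm_num

lemma Ad_one (x N : ℕ) (hx : x ≤ N) : Ad (ph (gi 1) x) N (fun _ => true) 0 := by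
  have key : ∀ s d, ph (gi 1) x (s+d) ≤ ph (gi 1) x s := by
    intro s d
    simp only [ph, coeff_gg_one]
    split_ifs <;> omega
  refine ⟨?_, fun s hs => if_neg (by omega), fun s d _ => key s d, fun s d _ => key s d⟩
  intro s; simp only [ph, coeff_gg_one]; split_ifs <;> norm_num

/-- Multiplication of a series with constant term `-1`. -/
lemma prod_Inv (N e : ℕ) (S : Finset ℕ) (hS : ∀ b ∈ S, 1 ≤ b) : ∀ F : PowerSeries ℤ, -1 ≤ coeff 0 F →
    (∀ n, 1 ≤ n → n ≤ N → (if n ∈ S then 1 else 0) + (if n = e then 1 else 0) ≤ coeff n F) →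
    -1 ≤ coeff 0 ((∏ b ∈ S, gi b) * F) ∧ ∀ n, 1 ≤ n → n ≤ N → (if n = e then 1 else 0) ≤ coeff n ((∏ b ∈ S, gi b) * F) := by
  induction S using Finset.induction_on with
  | empty =>
    intro F h0 h
    rw [Finset.prod_empty, one_mul]
    refine ⟨h0, fun n h1 hn => ?_⟩
    simpa using h n h1 hn
  | insert b S hb ih =>
    intro F h0 h
    have hb1 : 1 ≤ b := hS b (Finset.mem_insert_self _ _)
    rw [Finset.prod_insert hb, mul_comm (gi b), mul_assoc]
    apply ih (fun x hx => hS x (Finset.mem_insert_of_mem hx))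
    · rw [gi_rec b hb1, if_neg (by omega), add_zero]; exact h0
    · intro n
      induction n using Nat.strong_induction_on with
      | _ n ihn =>
        intro h1 hn
        have hh := h n h1 hn
        rw [gi_rec b hb1]
        rcases lt_trichotomy n b with hl | hl | hl
        · rw [if_neg (by omega : ¬ b ≤ n), add_zero]
          refine le_trans ?_ hh
          have : n ∈ S → n ∈ insert b S := Finset.mem_insert_of_mem
          by_cases h2 : n ∈ S
          · rw [if_pos h2, if_pos (this h2)]
          · rw [if_neg h2]; split_ifs <;> norm_num
        · subst hl
          rw [if_pos le_rfl, Nat.sub_self, gi_rec n hb1, if_neg (by omega : ¬ n ≤ 0)]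
          rw [if_pos (Finset.mem_insert_self _ _)] at hh
          rw [if_neg hb]; linarith
        · rw [if_pos hl.le]
          have h3 := ihn (n-b) (by omega) (by omega) (by omega)
          have h4 : (0:ℤ) ≤ (if n - b ∈ S then 1 else 0) + (if n - b = e then 1 else 0) := by split_ifs <;> norm_num
          have h5 : (if n ∈ S then (1:ℤ) else 0) ≤ (if n ∈ insert b S then 1 else 0) := by
            by_cases h2 : n ∈ S
            · rw [if_pos h2, if_pos (Finset.mem_insert_of_mem h2)]
            · rw [if_neg h2]; split_ifs <;> norm_num
          linarith

end M2

namespace M2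
open PowerSeries

/-- Shorthand for the `LA` numerator. -/
noncomputable def LN (N p1 c1 p2 c2 p3 c3 p4 c4 : ℕ) : PowerSeries ℤ :=
  FF N (fun n => 32*n^2+p1*n+c1) (fun n => 32*n+4) - FF N (fun n => 32*n^2+p2*n+c2) (fun n => 32*n+20)
       + (FF N (fun n => 32*n^2+p3*n+c3) (fun n => 32*n+12) - FF N (fun n => 32*n^2+p4*n+c4) (fun n => 32*n+28))

noncomputable def FG (N a b c : ℕ) : PowerSeries ℤ := FF N (fun n => a*n+c) (fun n => 16*n+b)

lemma coeff_FG (N x : ℕ) (H : PowerSeries ℤ) (a b c : ℕ) : coeff x (FG N a b c * H) = GD (ph H x) N a b c := by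
  rw [FG, coeff_FF, GD]

lemma coeff_LN (N x : ℕ) (H : PowerSeries ℤ) (p1 c1 p2 c2 p3 c3 p4 c4 : ℕ) :
    coeff x (LN N p1 c1 p2 c2 p3 c3 p4 c4 * H) =
    SD (ph H x) N (fun n => 32*n^2+p1*n+c1) (fun n => 32*n+4) - SD (ph H x) N (fun n => 32*n^2+p2*n+c2) (fun n => 32*n+20)
       + (SD (ph H x) N (fun n => 32*n^2+p3*n+c3) (fun n => 32*n+12) - SD (ph H x) N (fun n => 32*n^2+p4*n+c4) (fun n => 32*n+28)) := by
  rw [LN]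
  simp only [add_mul, sub_mul, map_add, map_sub, coeff_FF]

noncomputable def NUM0 (N : ℕ) : PowerSeries ℤ :=
  (FG N 1 12 0 - FG N 15 4 3) + (FG N 5 12 3 - FG N 11 4 2) - (LN N 10 0 42 13 54 15 86 50 + LN N 10 0 42 13 54 15 86 50)
noncomputable def NUM1 (N : ℕ) : PowerSeries ℤ :=
  (FG N 5 12 2 - FG N 11 4 1) - (FG N 7 4 0 - FG N 9 12 5) + (LN N 18 0 50 17 46 11 78 42 + LN N 18 0 50 17 46 11 78 42)
noncomputable def NUM2 (N : ℕ) : PowerSeries ℤ :=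
  (FG N 3 4 0 - FG N 13 12 9) + (FG N 7 4 1 - FG N 9 12 6) + (LN N 26 2 58 23 38 9 70 36 + LN N 26 2 58 23 38 9 70 36)
noncomputable def NUM3 (N : ℕ) : PowerSeries ℤ :=
  (FG N 7 4 1 - FG N 9 12 6) - (FG N 5 12 3 - FG N 11 4 2) + (LN N 34 3 66 28 30 6 62 29 + LN N 34 3 66 28 30 6 62 29)

lemma small_pos : (0:ℝ) < (1/128)^4 := by norm_num

lemma AP0 (N : ℕ) : AP N (fun Q => VV 0 Q * TM Q 8 5) (toC (-(NUM0 N))) := by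
  have k1 : AP N _ (toC (FG N 1 12 0 - FG N 15 4 3)) := KK_AP N 1 12 0 (by norm_num) (by norm_num) (by norm_num) (by norm_num) (by norm_num)
  have k2 : AP N _ (toC (FG N 5 12 3 - FG N 11 4 2)) := KK_AP N 5 12 3 (by norm_num) (by norm_num) (by norm_num) (by norm_num) (by norm_num)
  have l : AP N _ (toC (LN N 10 0 42 13 54 15 86 50)) := LA_AP N 5 0 (by norm_num)
  have := ((k1.add k2).sub (l.add l)).neg
  rw [NUM0, map_neg, map_sub, map_add, map_add]
  refine this.congr_fun small_pos fun Q h0 hQ => ?_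
  have h := (Vforms hQ h0).1
  simp only [Nat.cast_ofNat, Nat.cast_one, pow_zero, one_mul]
  linear_combination -h

lemma AP1 (N : ℕ) : AP N (fun Q => VV 1 Q * TM Q 8 7) (toC (NUM1 N)) := by
  have k1 : AP N _ (toC (FG N 5 12 2 - FG N 11 4 1)) := KK_AP N 5 12 2 (by norm_num) (by norm_num) (by norm_num) (by norm_num) (by norm_num)
  have k2 : AP N _ (toC (FG N 7 4 0 - FG N 9 12 5)) := KK_AP N 7 4 0 (by norm_num) (by norm_num) (by norm_num) (by norm_num) (by norm_num)
  have l : AP N _ (toC (LN N 18 0 50 17 46 11 78 42)) := LA_AP N 9 0 (by norm_num)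
  have := (k1.sub k2).add (l.add l)
  rw [NUM1, map_add, map_sub, map_add]
  refine this.congr_fun small_pos fun Q h0 hQ => ?_
  have h := (Vforms hQ h0).2.1
  simp only [Nat.cast_ofNat, pow_zero, one_mul]
  linear_combination h

lemma AP2 (N : ℕ) : AP N (fun Q => VV 2 Q * TM Q 8 3) (toC (NUM2 N)) := by
  have k1 : AP N _ (toC (FG N 3 4 0 - FG N 13 12 9)) := KK_AP N 3 4 0 (by norm_num) (by norm_num) (by norm_num) (by norm_num) (by norm_num)
  have k2 : AP N _ (toC (FG N 7 4 1 - FG N 9 12 6)) := KK_AP N 7 4 1 (by norm_num) (by norm_num) (by norm_num) (by norm_num) (by norm_num)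
  have l : AP N _ (toC (LN N 26 2 58 23 38 9 70 36)) := LA_AP N 13 2 (by norm_num)
  have := (k1.add k2).add (l.add l)
  rw [NUM2, map_add, map_add, map_add]
  refine this.congr_fun small_pos fun Q h0 hQ => ?_
  have h := (Vforms hQ h0).2.2.1
  simp only [Nat.cast_ofNat, pow_zero, one_mul]
  linear_combination h

lemma AP3 (N : ℕ) : AP N (fun Q => VV 3 Q * TM Q 8 1) (toC (-(NUM3 N))) := by
  have k1 : AP N _ (toC (FG N 7 4 1 - FG N 9 12 6)) := KK_AP N 7 4 1 (by norm_num) (by norm_num) (by norm_num) (by norm_num) (by norm_num)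
  have k2 : AP N _ (toC (FG N 5 12 3 - FG N 11 4 2)) := KK_AP N 5 12 3 (by norm_num) (by norm_num) (by norm_num) (by norm_num) (by norm_num)
  have l : AP N _ (toC (LN N 34 3 66 28 30 6 62 29)) := LA_AP N 17 3 (by norm_num)
  have := ((k1.sub k2).add (l.add l)).neg
  rw [NUM3, map_neg, map_add, map_sub, map_add]
  refine this.congr_fun small_pos fun Q h0 hQ => ?_
  have h := (Vforms hQ h0).2.2.2
  simp only [Nat.cast_ofNat, pow_one] at h ⊢
  linear_combination -h

lemma Good.GT {N : ℕ} {F : PowerSeries ℤ} (h : Good N F) (j M : ℕ) (hj : j < 8) : Good N (GT j M * F) := by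
  rw [M2.GT, mul_assoc, mul_assoc]
  refine Good.prod (Good.prod (Good.prod h _ _ ?_) _ _ ?_) _ _ ?_ <;> intro i <;> omega

lemma uu_fin {n : ℕ} {z : ℤ} (h : uu n = (z:ℂ)) (hz : 0 < z) : N2 0 4 n > N2 2 4 n := by
  have := uu_re n
  rw [h] at this
  simp only [Complex.intCast_re] at this
  have h2 : (0:ℝ) < z := by exact_mod_cast hz
  rw [this] at h2
  exact_mod_cast sub_pos.mp h2

lemma pos2 (e : ℕ) (he : e % 2 = 0) : 0 < coeff e (NUM2 e * (GT 3 (e+1) * (gi (8+3) * gi (8-3)))) := by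
  rw [show NUM2 e * (GT 3 (e+1) * (gi (8+3) * gi (8-3))) = GT 3 (e+1) * (NUM2 e * (gi 11 * gi 5)) by ring]
  refine (Good.GT ?_ 3 (e+1) (by norm_num)).2
  have key : ∀ x ≤ e, AA (ph (gi 11 * gi 5) x) e (0,4) + AA (ph (gi 11 * gi 5) x) e (2,4) ≤ coeff x (NUM2 e * (gi 11 * gi 5)) := by
    intro x hx
    have hA := Ad_gg 5 11 (by norm_num) (by norm_num) x e 40 hx (fun d hd => ⟨(d - 11*(d%5))/5, d%5, by omega⟩)
    refine (case2 hA).trans (le_of_eq ?_)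
    rw [NUM2]
    simp only [add_mul, sub_mul, map_add, map_sub, coeff_FG, coeff_LN]
    ring
  have hA : ∀ x ≤ e, Ad (ph (gi 11 * gi 5) x) e (sgAB 5 11) 40 := fun x hx =>
    Ad_gg 5 11 (by norm_num) (by norm_num) x e 40 hx (fun d hd => ⟨(d - 11*(d%5))/5, d%5, by omega⟩)
  have one : ph (gi 11 * gi 5) e e = 1 := by
    rw [ph, if_pos le_rfl, Nat.sub_self, ggg_zero 11 5 (by norm_num) (by norm_num)]
  constructor
  · intro x hx
    have := AA_nonneg (hA x hx) (0,4)
    have := AA_nonneg (hA x hx) (2,4)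
    linarith [key x hx]
  · have h1 := AA_nonneg (hA e le_rfl) (0,4)
    have h2 := AA_nonneg (hA e le_rfl) (2,4)
    have h3 := key e le_rfl
    rcases (show e % 4 = 0 ∨ e % 4 = 2 by omega) with h | h
    · have := le_AA (hA e le_rfl) 0 4 (e/4) (by omega)
      rw [show 0 + e/4*4 = e by omega, one] at this
      linarith
    · have := le_AA (hA e le_rfl) 2 4 (e/4) (by omega)
      rw [show 2 + e/4*4 = e by omega, one] at this
      linarith

lemma pos3 (e : ℕ) (he : e % 2 = 1) : 0 < coeff e (NUM3 e * (GT 1 (e+1) * (gi (8+1) * gi (8-1)))) := by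
  rw [show NUM3 e * (GT 1 (e+1) * (gi (8+1) * gi (8-1))) = GT 1 (e+1) * (NUM3 e * (gi 9 * gi 7)) by ring]
  refine (Good.GT ?_ 1 (e+1) (by norm_num)).2
  have hA : ∀ x ≤ e, Ad (ph (gi 9 * gi 7) x) e (sgAB 7 9) 48 := fun x hx =>
    Ad_gg 7 9 (by norm_num) (by norm_num) x e 48 hx (fun d hd => ⟨(d - 9*((4*d)%7))/7, (4*d)%7, by omega⟩)
  have key : ∀ x ≤ e, AA (ph (gi 9 * gi 7) x) e (1,4) + AA (ph (gi 9 * gi 7) x) e (3,4) ≤ coeff x (NUM3 e * (gi 9 * gi 7)) := by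
    intro x hx
    refine (case3 (hA x hx)).trans (le_of_eq ?_)
    rw [NUM3]
    simp only [add_mul, sub_mul, map_add, map_sub, coeff_FG, coeff_LN]
    ring
  have one : ph (gi 9 * gi 7) e e = 1 := by
    rw [ph, if_pos le_rfl, Nat.sub_self, ggg_zero 9 7 (by norm_num) (by norm_num)]
  constructor
  · intro x hx
    have := AA_nonneg (hA x hx) (1,4)
    have := AA_nonneg (hA x hx) (3,4)
    linarith [key x hx]
  · have h1 := AA_nonneg (hA e le_rfl) (1,4)
    have h2 := AA_nonneg (hA e le_rfl) (3,4)
    have h3 := key e le_rfl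
    rcases (show e % 4 = 1 ∨ e % 4 = 3 by omega) with h | h
    · have := le_AA (hA e le_rfl) 1 4 (e/4) (by omega)
      rw [show 1 + e/4*4 = e by omega, one] at this
      linarith
    · have := le_AA (hA e le_rfl) 3 4 (e/4) (by omega)
      rw [show 3 + e/4*4 = e by omega, one] at this
      linarith

lemma pos1 (e : ℕ) (he : e % 2 = 0) : 0 < coeff e (NUM1 e * (GT 7 (e+1) * (gi (8+7) * gi (8-7)))) := by
  rw [show NUM1 e * (GT 7 (e+1) * (gi (8+7) * gi (8-7))) = GT 7 (e+1) * (gi 15 * (NUM1 e * gi 1)) by ring]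
  refine (Good.GT (Good.gi ?_ 15 (by norm_num)) 7 (e+1) (by norm_num)).2
  have key : ∀ x ≤ e, ph (gi 1) x 2 + (ph (gi 1) x 0 - ph (gi 1) x 1) ≤ coeff x (NUM1 e * gi 1) := by
    intro x hx
    refine (case1 (Ad_one x e hx)).trans (le_of_eq ?_)
    rw [NUM1]
    simp only [add_mul, sub_mul, map_add, map_sub, coeff_FG, coeff_LN, add_zero]
    ring
  constructor
  · intro x hx
    refine le_trans ?_ (key x hx)
    simp only [ph, coeff_gg_one]
    split_ifs <;> omega
  · refine lt_of_lt_of_le ?_ (key e le_rfl)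
    simp only [ph, coeff_gg_one]
    split_ifs <;> omega

theorem final1 (m : ℕ) (hm : m % 8 = 1) : N2 0 4 m > N2 2 4 m := by
  obtain ⟨e, rfl, he⟩ : ∃ e, m = 4*e+1 ∧ e % 2 = 0 := ⟨m/4, by omega, by omega⟩
  have h := coeff_from_AP 1 e 7 (by norm_num) _ _ (PJ_inv 7 (e+1) (by norm_num)) (AP1 e)
  rw [vv, Even.neg_one_pow (Nat.even_iff.mpr he), one_mul] at h
  exact uu_fin h (pos1 e he)

theorem final2 (m : ℕ) (hm : m % 8 = 2) : N2 0 4 m > N2 2 4 m := by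
  obtain ⟨e, rfl, he⟩ : ∃ e, m = 4*e+2 ∧ e % 2 = 0 := ⟨m/4, by omega, by omega⟩
  have h := coeff_from_AP 2 e 3 (by norm_num) _ _ (PJ_inv 3 (e+1) (by norm_num)) (AP2 e)
  rw [vv, Even.neg_one_pow (Nat.even_iff.mpr he), one_mul] at h
  exact uu_fin h (pos2 e he)

theorem final3 (m : ℕ) (hm : m % 8 = 7) : N2 0 4 m > N2 2 4 m := by
  obtain ⟨e, rfl, he⟩ : ∃ e, m = 4*e+3 ∧ e % 2 = 1 := ⟨m/4, by omega, by omega⟩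
  have h := coeff_from_AP 3 e 1 (by norm_num) _ _ (PJ_inv 1 (e+1) (by norm_num)) (AP3 e)
  rw [vv, Odd.neg_one_pow (Nat.odd_iff.mpr he), neg_one_mul, neg_mul, map_neg, Int.cast_neg, neg_inj] at h
  exact uu_fin h (pos3 e he)

end M2

namespace M2
open PowerSeries

/-- Number of representations `m = 3 * i + 13 * j`. -/
def EE (m : ℕ) : ℕ := (m + 39 - 13 * (m % 3)) / 39

lemma coeff_gi13 (m : ℕ) : coeff m (gi 13) = if m % 13 = 0 then 1 else 0 := by
  induction m using Nat.strong_induction_on with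
  | _ m ih =>
    rw [← mul_one (gi 13), gi_rec 13 (by norm_num), mul_one, coeff_one]
    by_cases h : 13 ≤ m
    · rw [if_pos h, ih (m-13) (by omega), if_neg (by omega), zero_add]
      congr 1
      exact propext (by omega)
    · rw [if_neg h, add_zero]
      congr 1
      exact propext (by omega)

lemma EE_rec (m : ℕ) (h : 3 ≤ m) : EE m = EE (m-3) + (if m % 13 = 0 then 1 else 0) := by
  obtain ⟨q, r, hr, rfl⟩ : ∃ q r, r < 39 ∧ m = 39*q + r :=
    ⟨m/39, m%39, Nat.mod_lt _ (by norm_num), (Nat.div_add_mod m 39).symm⟩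
  simp only [EE]
  interval_cases r <;> split_ifs <;> omega

lemma EE_small (m : ℕ) (h : m < 3) : EE m = if m % 13 = 0 then 1 else 0 := by
  interval_cases m <;> decide

lemma coeff_H0 (m : ℕ) : coeff m (gi 13 * gi 3) = (EE m : ℤ) := by
  rw [mul_comm]
  induction m using Nat.strong_induction_on with
  | _ m ih =>
    rw [gi_rec 3 (by norm_num), coeff_gi13]
    by_cases h : 3 ≤ m
    · rw [if_pos h, ih (m-3) (by omega)]
      rw [EE_rec m h]
      push_cast
      ring
    · rw [if_neg h, EE_small m (by omega)]
      push_cast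
      ring

/-- Evaluated one-dimensional sums. -/
def ASn (x : ℕ) (p : ℕ × ℕ) : ℕ := ((List.range (cntAP x p)).map (fun k => EE (x - (p.1 + k * p.2)))).sum

lemma AA_eval (x N : ℕ) (hx : x ≤ N) (p : ℕ × ℕ) (hp : 1 ≤ p.2) :
    AA (ph (gi 13 * gi 3) x) N p = (ASn x p : ℤ) := by
  have v : ∀ s, x < s → ph (gi 13 * gi 3) x s = 0 := fun s hs => if_neg (by omega)
  rw [AA_split (fun s hs => v s (by omega)) (x+1) p hp]
  have hpm : pm (x+1) p = cntAP x p := by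
    rw [pm, cntAP]; congr 1; omega
  have m1 := Nat.div_add_mod (x + p.2 - p.1) p.2
  have m2 := Nat.mod_lt (x + p.2 - p.1) hp
  have z : AA (ph (gi 13 * gi 3) x) N (rst (x+1) p) = 0 := by
    apply Finset.sum_eq_zero
    intro k _
    apply v
    simp only [rst, hpm, cntAP]
    rw [mul_comm ((x + p.2 - p.1) / p.2)]
    omega
  rw [z, add_zero, els, ASn, List.map_map, hpm, Nat.cast_list_sum, List.map_map]
  congr 1
  apply List.map_congr_left
  intro k hk
  rw [List.mem_range, cntAP] at hk
  have : (k+1) * p.2 ≤ x + p.2 - p.1 := (Nat.le_div_iff_mul_le hp).mp hk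
  rw [add_mul, one_mul] at this
  simp only [Function.comp]
  rw [ph, if_pos (by omega), coeff_H0]

def reqn (x : ℕ) : ℕ := (if x % 16 = 0 ∨ (x % 16 = 13 ∧ 29 ≤ x) ∨ (x % 16 = 3 ∧ 19 ≤ x) then 1 else 0) +
  (if x % 2 = 1 ∧ 17 ≤ x then 1 else 0)

def posL : List (ℕ × ℕ) := [(1, 4), (12, 12), (3, 12), (13, 20), (8, 5), (36, 21), (29, 17), (50, 28), (50, 28)]
def negL : List (ℕ × ℕ) := [(4, 4), (15, 12), (15, 12), (18, 20), (33, 15), (24, 11), (60, 27), (69, 31), (42, 36), (42, 36), (101, 44), (101, 44)]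

theorem small_check : (List.range 144).all (fun x => decide ((if x = 0 then 0 else reqn x + 1) + EE x + (negL.map (ASn x)).sum ≤ (posL.map (ASn x)).sum + 1)) = true := by
  decide +kernel

lemma F0_bound (e x : ℕ) (hx : x ≤ e) : (if x = 0 then (-1:ℤ) else reqn x) ≤ coeff x (NUM0 e * (gi 13 * gi 3)) := by
  have hA : Ad (ph (gi 13 * gi 3) x) e (sgAB 3 13) 24 :=
    Ad_gg 3 13 (by norm_num) (by norm_num) x e 24 hx (fun d hd => ⟨(d - 13*(d%3))/3, d%3, by omega⟩)
  have key := (case0 hA).trans (le_of_eq (show _ = coeff x (NUM0 e * (gi 13 * gi 3)) from by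
    rw [NUM0]
    simp only [add_mul, sub_mul, map_add, map_sub, coeff_FG, coeff_LN, add_zero]
    ring))
  have p0 : ph (gi 13 * gi 3) x 0 = EE x := by rw [ph, if_pos (by omega), coeff_H0]; rfl
  rcases Nat.lt_or_ge x 144 with h | h
  · have hc := small_check
    rw [List.all_eq_true] at hc
    have hc := of_decide_eq_true (hc x (List.mem_range.mpr h))
    simp only [posL, negL, List.map_cons, List.map_nil, List.sum_cons, List.sum_nil] at hc key
    simp only [AA_eval x e hx (1, 4) (by norm_num), AA_eval x e hx (12, 12) (by norm_num), AA_eval x e hx (3, 12) (by norm_num), AA_eval x e hx (13, 20) (by norm_num), AA_eval x e hx (8, 5) (by norm_num), AA_eval x e hx (36, 21) (by norm_num), AA_eval x e hx (29, 17) (by norm_num), AA_eval x e hx (50, 28) (by norm_num), AA_eval x e hx (4, 4) (by norm_num), AA_eval x e hx (15, 12) (by norm_num), AA_eval x e hx (18, 20) (by norm_num), AA_eval x e hx (33, 15) (by norm_num), AA_eval x e hx (24, 11) (by norm_num), AA_eval x e hx (60, 27) (by norm_num), AA_eval x e hx (69, 31) (by norm_num), AA_eval x e hx (42, 36) (by norm_num),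 AA_eval x e hx (101, 44) (by norm_num), p0] at key
    split_ifs at hc ⊢ with h0
    · zify at hc; linarith
    · zify at hc; linarith
  · have pl := case0_pool hA
    have r : (reqn x : ℤ) ≤ 2 := by
      rw [reqn]; split_ifs <;> norm_num
    rw [if_neg (by omega)]
    have p39 : ph (gi 13 * gi 3) x 39 = EE (x-39) := by rw [ph, if_pos (by omega), coeff_H0]
    have d1 : EE x ≤ EE (x-39) + 1 := by simp only [EE]; omega
    have d2 : (3:ℤ) ≤ AA (ph (gi 13 * gi 3) x) e (1,4) - AA (ph (gi 13 * gi 3) x) e (4,4) := by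
      simp only [AA]
      rw [← Finset.sum_sub_distrib]
      obtain ⟨r, hr⟩ : ∃ r, r = (x-1) % 4 := ⟨_, rfl⟩
      have hval : ∀ m, 13 * m + 1 ≤ x → (x - 1 - 13*m) % 4 = 0 →
         ph (gi 13 * gi 3) x (1 + (x-1-13*m)/4*4) - ph (gi 13 * gi 3) x (4 + (x-1-13*m)/4*4) = 1 := by
        intro m h1 h2
        rw [show 1 + (x-1-13*m)/4*4 = x - 13*m by omega, show 4 + (x-1-13*m)/4*4 = x - 13*m + 3 by omega]
        rw [ph, ph, if_pos (by omega), coeff_H0, coeff_H0, show x - (x - 13*m) = 13*m by omega]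
        split_ifs with h3
        · rw [show x - (x - 13*m + 3) = 13*m - 3 by omega, EE_rec (13*m) (by omega), if_pos (by omega)]
          push_cast
          ring
        · have : m = 0 := by omega
          subst this
          norm_num [EE]
      have sub : ({(x-1-13*r)/4, (x-1-13*(r+4))/4, (x-1-13*(r+8))/4} : Finset ℕ) ⊆ Finset.range (e+1) := by
        intro k hk
        simp only [Finset.mem_insert, Finset.mem_singleton] at hk
        rw [Finset.mem_range]; omega
      have h3 := Finset.sum_le_sum_of_subset_of_nonneg (f := fun k => ph (gi 13 * gi 3) x (1 + k*4) - ph (gi 13 * gi 3) x (4 + k*4)) sub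
        (fun k _ _ => by
          have := hA.mono_sg (1+k*4) 3 (by decide +kernel)
          rw [show 1 + k*4 + 3 = 4 + k*4 by ring] at this
          linarith)
      refine le_trans (le_of_eq ?_) h3
      rw [Finset.sum_insert, Finset.sum_insert, Finset.sum_singleton, hval r (by omega) (by omega), hval (r+4) (by omega) (by omega), hval (r+8) (by omega) (by omega)]
      · norm_num
      · simp only [Finset.mem_singleton]; omega
      · simp only [Finset.mem_insert, Finset.mem_singleton]; omega
    zify at d1
    rw [p0] at key
    rw [p39] at pl
    linarith

lemma GT5 (M : ℕ) : ∃ S : Finset ℕ, GT 5 M = ∏ b ∈ S, gi b ∧ ∀ b ∈ S, 1 ≤ b ∧ (b % 16 = 0 ∨ (b % 16 = 13 ∧ 29 ≤ b) ∨ (b % 16 = 3 ∧ 19 ≤ b)) := by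
  refine ⟨(Finset.range (M+1)).image (fun i => 16*i+16) ∪ ((Finset.range M).image (fun i => 16*i+24+5) ∪ (Finset.range M).image (fun i => 16*i+24-5)), ?_, ?_⟩
  · rw [Finset.prod_union, Finset.prod_union, Finset.prod_image, Finset.prod_image, Finset.prod_image, GT]
    · intro a _ b _ h; simp only at h; omega
    · intro a _ b _ h; simp only at h; omega
    · intro a _ b _ h; simp only at h; omega
    · rw [Finset.disjoint_left]
      intro a h1 h2
      simp only [Finset.mem_image] at h1 h2
      obtain ⟨i, _, hi⟩ := h1
      obtain ⟨k, _, hk⟩ := h2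
      omega
    · rw [Finset.disjoint_left]
      intro a h1 h2
      simp only [Finset.mem_image, Finset.mem_union] at h1 h2
      obtain ⟨i, _, hi⟩ := h1
      rcases h2 with ⟨k, _, hk⟩ | ⟨k, _, hk⟩ <;> omega
  · intro b hb
    simp only [Finset.mem_image, Finset.mem_union] at hb
    rcases hb with ⟨k, _, hk⟩ | ⟨k, _, hk⟩ | ⟨k, _, hk⟩ <;> omega

lemma pos0 (e : ℕ) (he : e % 2 = 1) (h17 : 17 ≤ e) : 0 < coeff e (NUM0 e * (GT 5 (e+1) * (gi (8+5) * gi (8-5)))) := by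
  rw [show NUM0 e * (GT 5 (e+1) * (gi (8+5) * gi (8-5))) = GT 5 (e+1) * (NUM0 e * (gi 13 * gi 3)) by ring]
  obtain ⟨S, hS, hb⟩ := GT5 (e+1)
  rw [hS]
  have := (prod_Inv e e S (fun b h => (hb b h).1) (NUM0 e * (gi 13 * gi 3)) (F0_bound e 0 (Nat.zero_le _)) ?_).2 e (by omega) le_rfl
  · rw [if_pos rfl] at this; linarith
  · intro n h1 hn
    refine le_trans ?_ (F0_bound e n hn)
    rw [if_neg (show ¬ n = 0 by omega), reqn]
    push_cast
    apply add_le_add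
    · by_cases h : n ∈ S
      · rw [if_pos h, if_pos (hb n h).2]
      · rw [if_neg h]; split_ifs <;> norm_num
    · by_cases h : n = e
      · rw [if_pos h, if_pos (by omega)]
      · rw [if_neg h]; split_ifs <;> norm_num

theorem final0 (m : ℕ) (h68 : 68 ≤ m) (hm : m % 8 = 4) : N2 0 4 m > N2 2 4 m := by
  obtain ⟨e, rfl, he⟩ : ∃ e, m = 4*e+0 ∧ e % 2 = 1 := ⟨m/4, by omega, by omega⟩
  have h := coeff_from_AP 0 e 5 (by norm_num) _ _ (PJ_inv 5 (e+1) (by norm_num)) (AP0 e)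
  rw [vv, Odd.neg_one_pow (Nat.odd_iff.mpr he), neg_one_mul, neg_mul, map_neg, Int.cast_neg, neg_inj] at h
  exact uu_fin h (pos0 e he (by omega))

end M2

theorem N2_mod4_inequalities_zero_gt_two :
    (∀ m : ℕ, m % 8 = 1 → N2 0 4 m > N2 2 4 m) ∧
    (∀ m : ℕ, m % 8 = 2 → N2 0 4 m > N2 2 4 m) ∧
    (∀ m : ℕ, m % 8 = 7 → N2 0 4 m > N2 2 4 m) ∧
    (∀ m : ℕ, 68 ≤ m → m % 8 = 4 → N2 0 4 m > N2 2 4 m) := by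
  exact ⟨M2.final1, M2.final2, M2.final3, M2.final0⟩
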